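/- Let φ be a conformal mapping (an injective holomorphic map) from the unit disk Δ onto a simply connected domain Ω ⊊ ℂ whose boundary ∂Ω is a locally rectifiable curve. Then ∂Ω is Ahlfors-regular if and only if the push-forward operator (φ⁻¹)* is well-defined from CM(Δ) to CM(Ω), i.e., for every Carleson measure ν on Δ the measure μ defined by μ(A) = ∫_{φ⁻¹(A)} |φ′| dν for Borel sets A ⊂ Ω is a Carleson measure on Ω. -/

import Mathlib

open MeasureTheory Metric Set
open scoped ENNReal NNReal

/-- The open unit disk `Δ` in the complex plane. -/
def unitDisk : Set ℂ := Metric.ball (0 : ℂ) 1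

/-- The Carleson "norm" `‖μ‖_* = sup { μ(Ω ∩ D(z,r))/r : z ∈ ∂Ω, 0 < r < diam ∂Ω }`
of a positive Borel measure relative to a domain `Ω`. -/
noncomputable def carlesonNorm (Ω : Set ℂ) (μ : Measure ℂ) : ℝ≥0∞ :=
  ⨆ z ∈ frontier Ω, ⨆ r : ℝ,
    ⨆ (_ : 0 < r ∧ ENNReal.ofReal r < EMetric.diam (frontier Ω)),
      μ (Ω ∩ Metric.ball z r) / ENNReal.ofReal r

/-- `μ` is a Carleson measure on `Ω`. -/
def IsCarleson (Ω : Set ℂ) (μ : Measure ℂ) : Prop :=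
  carlesonNorm Ω μ < ⊤

/-- The push-forward `(φ⁻¹)* ν` of a measure `ν` on `D` under a conformal map `φ` of `D`:
the measure `A ↦ ∫_{φ⁻¹(A)} |φ′| dν`. -/
noncomputable def pushForward (D : Set ℂ) (φ : ℂ → ℂ) (ν : Measure ℂ) : Measure ℂ :=
  Measure.map φ ((ν.restrict D).withDensity fun z => (‖deriv φ z‖₊ : ℝ≥0∞))

section ConformalMaps

open Filter Topology

variable {f : ℂ → ℂ} {c : ℂ} {R : ℝ}

theorem isOpen_image_of_injOn_ball (hf : DifferentiableOn ℂ f (ball c R))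
    (hinj : InjOn f (ball c R)) {s : Set ℂ} (hs : s ⊆ ball c R) (hso : IsOpen s) :
    IsOpen (f '' s) := by
  rcases (hf.analyticOnNhd isOpen_ball).is_constant_or_isOpen
    (convex_ball c R).isPreconnected with ⟨w, hw⟩ | h
  · have hsub : (ball c R).Subsingleton := fun x hx y hy =>
      hinj hx hy ((hw x hx).trans (hw y hy).symm)
    rcases s.eq_empty_or_nonempty with rfl | ⟨x, hx⟩
    · simp
    · exfalso
      have hR : 0 < R := pos_of_mem_ball (hs hx)
      have h1 : c + ((R / 2 : ℝ) : ℂ) ∈ ball c R := by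
        simp [abs_of_pos hR]; linarith
      have := hsub h1 (mem_ball_self hR)
      have h2 : ((R / 2 : ℝ) : ℂ) = 0 := by simpa using this
      have h3 : R / 2 = 0 := by exact_mod_cast h2
      linarith
  · exact h s hs hso

theorem continuousAt_invFunOn_ball (hf : DifferentiableOn ℂ f (ball c R))
    (hinj : InjOn f (ball c R)) {z : ℂ} (hz : z ∈ ball c R) :
    ContinuousAt (Function.invFunOn f (ball c R)) (f z) := by
  have hleft := hinj.leftInvOn_invFunOn
  rw [ContinuousAt, hleft hz]
  intro V hV
  obtain ⟨W, hWV, hWo, hzW⟩ := _root_.mem_nhds_iff.1 (inter_mem hV (isOpen_ball.mem_nhds hz))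
  have ho := isOpen_image_of_injOn_ball hf hinj (fun x hx => (hWV hx).2) hWo
  refine mem_map.2 (mem_of_superset (ho.mem_nhds (mem_image_of_mem f hzW)) ?_)
  rintro _ ⟨x, hx, rfl⟩
  have := hleft (hWV hx).2
  simp only [mem_preimage]
  rw [this]
  exact (hWV hx).1

theorem eventually_apply_invFunOn_ball (hf : DifferentiableOn ℂ f (ball c R))
    (hinj : InjOn f (ball c R)) {z : ℂ} (hz : z ∈ ball c R) :
    ∀ᶠ w in 𝓝 (f z), f (Function.invFunOn f (ball c R) w) = w := by
  filter_upwards [(isOpen_image_of_injOn_ball hf hinj subset_rfl isOpen_ball).mem_nhds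
    (mem_image_of_mem f hz)] with w hw
  exact Function.invFunOn_eq hw

theorem hasDerivAt_invFunOn_ball (hf : DifferentiableOn ℂ f (ball c R))
    (hinj : InjOn f (ball c R)) {z : ℂ} (hz : z ∈ ball c R) (h0 : deriv f z ≠ 0) :
    HasDerivAt (Function.invFunOn f (ball c R)) (deriv f z)⁻¹ (f z) := by
  refine HasDerivAt.of_local_left_inverse (f := f) (continuousAt_invFunOn_ball hf hinj hz) ?_ h0
    (eventually_apply_invFunOn_ball hf hinj hz)
  rw [hinj.leftInvOn_invFunOn hz]
  exact (hf.differentiableAt (isOpen_ball.mem_nhds hz)).hasDerivAt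

/-- An injective holomorphic function has nonvanishing derivative. -/
theorem deriv_ne_zero_of_injOn_ball (hf : DifferentiableOn ℂ f (ball c R))
    (hinj : InjOn f (ball c R)) {z : ℂ} (hz : z ∈ ball c R) : deriv f z ≠ 0 := by
  intro h0
  have hzn := isOpen_ball.mem_nhds hz
  have han : AnalyticAt ℂ f z := hf.analyticAt hzn
  set g := Function.invFunOn f (ball c R) with hg
  have hleft := hinj.leftInvOn_invFunOn
  have hgc := continuousAt_invFunOn_ball hf hinj hz
  rcases han.deriv.eventually_eq_zero_or_eventually_ne_zero with h | h
  · obtain ⟨r, hr, hball⟩ := Metric.mem_nhds_iff.1 (inter_mem h hzn)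
    have hconst : ∀ x ∈ ball z r, f x = f z := by
      intro x hx
      refine (convex_ball z r).is_const_of_fderivWithin_eq_zero (𝕜 := ℂ)
        (hf.mono fun y hy => (hball hy).2) ?_ hx (mem_ball_self hr)
      intro y hy
      rw [fderivWithin_of_isOpen isOpen_ball hy]
      ext
      simpa using (hball hy).1
    have h1 : z + ((r / 2 : ℝ) : ℂ) ∈ ball z r := by
      simp [abs_of_pos hr]; linarith
    have h2 := hinj (hball h1).2 hz (hconst _ h1)
    have h2 : ((r / 2 : ℝ) : ℂ) = 0 := by simpa using h2
    have h3 : r / 2 = 0 := by exact_mod_cast h2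
    linarith
  · have hU : f '' ball c R ∈ 𝓝 (f z) :=
      (isOpen_image_of_injOn_ball hf hinj subset_rfl isOpen_ball).mem_nhds (mem_image_of_mem f hz)
    have hd : ∀ᶠ w in 𝓝[≠] (f z), DifferentiableAt ℂ g w := by
      have h' : ∀ᶠ x in 𝓝 z, x ≠ z → deriv f x ≠ 0 := eventually_nhdsWithin_iff.1 h
      rw [ContinuousAt, hleft hz] at hgc
      refine eventually_nhdsWithin_iff.2 ?_
      filter_upwards [hgc.eventually h', hU] with w hw hwU hne
      obtain ⟨x, hx, rfl⟩ := hwU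
      have hx' : Function.invFunOn f (ball c R) (f x) = x := hleft hx
      rw [hx'] at hw
      exact (hasDerivAt_invFunOn_ball hf hinj hx (hw fun e => hne (by rw [e]; rfl))).differentiableAt
    have hga := Complex.analyticAt_of_differentiable_on_punctured_nhds_of_continuousAt hd hgc
    have hcomp : HasDerivAt (g ∘ f) (deriv g (f z) * deriv f z) z :=
      hga.differentiableAt.hasDerivAt.comp z han.differentiableAt.hasDerivAt
    have hid : HasDerivAt (g ∘ f) 1 z := by
      refine (hasDerivAt_id z).congr_of_eventuallyEq ?_
      filter_upwards [hzn] with x hx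
      exact hleft hx
    have := hcomp.unique hid
    rw [h0, mul_zero] at this
    exact zero_ne_one this

end ConformalMaps

section Koebe

open Filter Topology

variable {f : ℂ → ℂ} {c : ℂ} {R : ℝ}

/-- A weak form of Bloch's theorem. -/
theorem exists_ball_subset_image_of_deriv {L : ℂ → ℂ} (hL : DifferentiableOn ℂ L (ball c R))
    (hR : 0 < R) (h0 : deriv L c ≠ 0) :
    ∃ (w : ℂ) (ρ : ℝ), ‖deriv L c‖ * R ≤ 112 * ρ ∧ ball w ρ ⊆ L '' ball c R := by
  have hsub : closedBall c (R / 2) ⊆ ball c R := closedBall_subset_ball (by linarith)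
  have hL' : DifferentiableOn ℂ (deriv L) (ball c R) := hL.deriv isOpen_ball
  have hcont : ContinuousOn (fun z => ‖deriv L z‖ * (R / 2 - dist z c)) (closedBall c (R / 2)) := by
    refine ContinuousOn.mul (hL'.continuousOn.mono hsub).norm ?_
    fun_prop
  obtain ⟨z₁, hz₁, hmax⟩ := (isCompact_closedBall c (R / 2)).exists_isMaxOn
    ⟨c, mem_closedBall_self (by linarith)⟩ hcont
  have hmax' : ∀ z ∈ closedBall c (R / 2), ‖deriv L z‖ * (R / 2 - dist z c) ≤
      ‖deriv L z₁‖ * (R / 2 - dist z₁ c) := fun z hz => hmax hz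
  have hc := hmax' c (mem_closedBall_self (by linarith))
  rw [dist_self, sub_zero] at hc
  set m := ‖deriv L z₁‖ with hm
  set s := (R / 2 - dist z₁ c) / 2 with hs
  have hms : ‖deriv L c‖ * R ≤ 4 * (m * s) := by rw [hs]; linarith
  have hpos : 0 < ‖deriv L c‖ * R := mul_pos (norm_pos_iff.2 h0) hR
  have hms0 : 0 < m * s := by linarith
  have hm0 : 0 < m := by
    rcases (norm_nonneg (deriv L z₁)).lt_or_eq with h | h
    · exact h
    · rw [hm, ← h] at hms0; simp at hms0
  have hs0 : 0 < s := by
    by_contra h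
    nlinarith
  have hball : ball z₁ s ⊆ closedBall c (R / 2) := by
    intro z hz
    rw [mem_ball] at hz
    rw [mem_closedBall]
    linarith [dist_triangle z z₁ c]
  have hbd : ∀ z ∈ ball z₁ s, ‖deriv L z‖ ≤ 2 * m := by
    intro z hz
    have h1 := hmax' z (hball hz)
    rw [mem_ball] at hz
    have h2 : s ≤ R / 2 - dist z c := by linarith [dist_triangle z z₁ c]
    have h3 : ‖deriv L z‖ * s ≤ (2 * m) * s := by
      calc ‖deriv L z‖ * s ≤ ‖deriv L z‖ * (R / 2 - dist z c) := by gcongr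
        _ ≤ _ := h1
        _ = (2 * m) * s := by rw [hs]; ring
    exact le_of_mul_le_mul_right h3 hs0
  have hsw : ∀ z ∈ ball z₁ (s / 6), ‖deriv L z - deriv L z₁‖ ≤ m / 2 := by
    intro z hz
    have hz' : z ∈ ball z₁ s := ball_subset_ball (by linarith) hz
    have := Complex.dist_le_div_mul_dist_of_mapsTo_ball (f := deriv L) (c := z₁) (R₁ := s)
      (R₂ := 3 * m) (hL'.mono (hball.trans hsub)) (fun y hy => by
        rw [mem_closedBall, dist_eq_norm]
        refine (norm_sub_le _ _).trans ?_
        linarith [hbd y hy]) hz'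
    rw [← dist_eq_norm]
    refine this.trans ?_
    rw [mem_ball] at hz
    calc 3 * m / s * dist z z₁ ≤ 3 * m / s * (s / 6) := by gcongr
      _ = m / 2 := by field_simp; norm_num
  have hcl : closedBall z₁ (s / 7) ⊆ ball z₁ (s / 6) := closedBall_subset_ball (by linarith)
  have hsub2 : ball z₁ (s / 6) ⊆ ball c R :=
    (ball_subset_ball (by linarith)).trans (hball.trans hsub)
  have hlow : ∀ z ∈ sphere z₁ (s / 7), m * s / 14 ≤ ‖L z - L z₁‖ := by
    intro z hz
    have hz' := hcl (sphere_subset_closedBall hz)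
    have hmv := (convex_ball z₁ (s / 6)).norm_image_sub_le_of_norm_hasDerivWithin_le
      (f := fun z => L z - deriv L z₁ * z) (f' := fun z => deriv L z - deriv L z₁) (C := m / 2)
      (fun x hx => (((hL.differentiableAt (isOpen_ball.mem_nhds (hsub2 hx))).hasDerivAt).sub
        (by simpa using (hasDerivAt_id x).const_mul (deriv L z₁))).hasDerivWithinAt)
      hsw (mem_ball_self (by linarith)) hz'
    rw [mem_sphere, dist_eq_norm] at hz
    rw [hz] at hmv
    have h2 : deriv L z₁ * (z - z₁) = (L z - L z₁) -
        ((L z - deriv L z₁ * z) - (L z₁ - deriv L z₁ * z₁)) := by ring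
    have h3 : m * (s / 7) ≤ ‖L z - L z₁‖ + m / 2 * (s / 7) := by
      calc m * (s / 7) = ‖deriv L z₁ * (z - z₁)‖ := by rw [norm_mul, hz]
        _ ≤ _ := by rw [h2]; exact (norm_sub_le _ _).trans (by gcongr)
    linarith
  have hdc : DiffContOnCl ℂ L (ball z₁ (s / 7)) := by
    refine DifferentiableOn.diffContOnCl ?_
    rw [closure_ball _ (by positivity)]
    exact hL.mono (hcl.trans hsub2)
  have hfreq : ∃ᶠ z in 𝓝 z₁, L z ≠ L z₁ := by
    have hd := (hL.differentiableAt (isOpen_ball.mem_nhds (hsub2 (mem_ball_self (by linarith))))).hasDerivAt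
    exact (hd.eventually_ne (norm_pos_iff.1 hm0)).frequently.filter_mono nhdsWithin_le_nhds
  refine ⟨L z₁, m * s / 14 / 2, by linarith, ?_⟩
  refine (hdc.ball_subset_image_closedBall (by positivity) hlow hfreq).trans ?_
  exact image_mono (hcl.trans hsub2)

/-- A holomorphic logarithm of a nonvanishing function on a disk. -/
theorem exists_log_on_ball (hf : DifferentiableOn ℂ f (ball c R)) (h0 : ∀ z ∈ ball c R, f z ≠ 0) :
    ∃ L : ℂ → ℂ, (∀ z ∈ ball c R, HasDerivAt L (deriv f z / f z) z) ∧
      ∀ z ∈ ball c R, Complex.exp (L z) = f z := by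
  rcases (ball c R).eq_empty_or_nonempty with he | ⟨z₀, hz₀⟩
  · exact ⟨0, by simp [he], by simp [he]⟩
  have hd : DifferentiableOn ℂ (fun z => deriv f z / f z) (ball c R) :=
    (hf.deriv isOpen_ball).div hf h0
  obtain ⟨L, hval, hL⟩ := hd.isExactOn_ball.with_val_at z₀ (Complex.log (f z₀))
  refine ⟨L, hL, fun z hz => ?_⟩
  have hfd : ∀ x ∈ ball c R, HasDerivAt f (deriv f x) x := fun x hx =>
    (hf.differentiableAt (isOpen_ball.mem_nhds hx)).hasDerivAt
  have hD : ∀ x ∈ ball c R, HasDerivAt (fun x => f x * Complex.exp (-L x)) 0 x := by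
    intro x hx
    have := (hfd x hx).mul (hL x hx).neg.cexp
    refine HasDerivAt.congr_deriv (f := fun x => f x * Complex.exp (-L x)) this ?_
    have h1 : f x * (deriv f x / f x) = deriv f x := mul_div_cancel₀ _ (h0 x hx)
    simp only [Pi.neg_apply]
    linear_combination (-Complex.exp (-L x)) * h1
  have hconst : f z * Complex.exp (-L z) = f z₀ * Complex.exp (-L z₀) := by
    refine (convex_ball c R).is_const_of_fderivWithin_eq_zero (𝕜 := ℂ)
      (f := fun x => f x * Complex.exp (-L x))
      (fun x hx => (hD x hx).differentiableAt.differentiableWithinAt) ?_ hz hz₀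
    intro y hy
    rw [fderivWithin_of_isOpen isOpen_ball hy]
    ext
    simpa using (hD y hy).deriv
  rw [hval, Complex.exp_neg, Complex.exp_neg, Complex.exp_log (h0 z₀ hz₀),
    mul_inv_cancel₀ (h0 z₀ hz₀)] at hconst
  field_simp at hconst
  exact hconst.symm

/-- A weak form of the Koebe quarter theorem. -/
theorem norm_deriv_mul_le_of_notMem_image (hf : DifferentiableOn ℂ f (ball c R))
    (hinj : InjOn f (ball c R)) (hR : 0 < R) {a : ℂ} (ha : a ∉ f '' ball c R) :
    ‖deriv f c‖ * R ≤ 784 * ‖f c - a‖ := by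
  have hne : ∀ z ∈ ball c R, f z - a ≠ 0 := fun z hz h => ha ⟨z, hz, sub_eq_zero.1 h⟩
  obtain ⟨L, hL, hexp⟩ := exists_log_on_ball (hf.sub_const a) hne
  have hcR := mem_ball_self (x := c) hR
  have hd : deriv L c = deriv f c / (f c - a) := by
    rw [(hL c hcR).deriv, deriv_sub_const]
  have hpos : 0 < ‖f c - a‖ := norm_pos_iff.2 (hne c hcR)
  have hd0 : deriv L c ≠ 0 := by
    rw [hd]
    exact div_ne_zero (deriv_ne_zero_of_injOn_ball hf hinj hcR) (hne c hcR)
  obtain ⟨w, ρ, hρ, hsub⟩ := exists_ball_subset_image_of_deriv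
    (fun z hz => (hL z hz).differentiableAt.differentiableWithinAt) hR hd0
  have hρ7 : ρ ≤ 7 := by
    by_contra! hlt
    have h1 : w ∈ ball w ρ := mem_ball_self (by linarith)
    have h2 : w + 2 * Real.pi * Complex.I ∈ ball w ρ := by
      simp only [mem_ball, dist_self_add_left, norm_mul, Complex.norm_I, Complex.norm_real,
        Real.norm_eq_abs, abs_of_pos Real.pi_pos, Complex.norm_ofNat]
      linarith [Real.pi_lt_d2]
    obtain ⟨z₁, hz₁, e₁⟩ := hsub h1
    obtain ⟨z₂, hz₂, e₂⟩ := hsub h2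
    have he : f z₁ - a = f z₂ - a := by
      rw [← hexp z₁ hz₁, ← hexp z₂ hz₂, e₁, e₂, Complex.exp_add, Complex.exp_two_pi_mul_I, mul_one]
    have hz : z₁ = z₂ := hinj hz₁ hz₂ (by simpa using he)
    have := e₁.symm.trans ((congrArg L hz).trans e₂)
    exact Complex.two_pi_I_ne_zero (left_eq_add.1 this)
  rw [hd, norm_div, div_mul_eq_mul_div, div_le_iff₀ hpos] at hρ
  nlinarith

theorem ball_subset_image_of_injOn (hf : DifferentiableOn ℂ f (ball c R))
    (hinj : InjOn f (ball c R)) (hR : 0 < R) :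
    ball (f c) (‖deriv f c‖ * R / 784) ⊆ f '' ball c R := by
  intro a ha
  by_contra h
  have := norm_deriv_mul_le_of_notMem_image hf hinj hR h
  rw [mem_ball, dist_comm, dist_eq_norm] at ha
  linarith

/-- If the image of a univalent function on a disk contains a disk about the image of `c`, the
radius of the latter is controlled by the derivative at `c`. -/
theorem le_of_ball_subset_image {c₀ : ℂ} (hf : DifferentiableOn ℂ f (ball c₀ R))
    (hinj : InjOn f (ball c₀ R)) (hc : c ∈ ball c₀ R) {ρ : ℝ} (hρ : 0 < ρ)
    (hsub : ball (f c) ρ ⊆ f '' ball c₀ R) {b : ℂ} (hb : b ∉ ball c₀ R) :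
    ρ ≤ 784 * ‖deriv f c‖ * dist c b := by
  have hleft := hinj.leftInvOn_invFunOn
  have hd0 := deriv_ne_zero_of_injOn_ball hf hinj hc
  have hgd' := (hasDerivAt_invFunOn_ball hf hinj hc hd0).deriv
  have hgc : Function.invFunOn f (ball c₀ R) (f c) = c := hleft hc
  set g := Function.invFunOn f (ball c₀ R) with hg
  have hgd : DifferentiableOn ℂ g (ball (f c) ρ) := by
    intro w hw
    obtain ⟨x, hx, rfl⟩ := hsub hw
    exact (hasDerivAt_invFunOn_ball hf hinj hx
      (deriv_ne_zero_of_injOn_ball hf hinj hx)).differentiableAt.differentiableWithinAt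
  have hgi : InjOn g (ball (f c) ρ) := by
    intro w hw w' hw' h
    rw [← Function.invFunOn_eq (hsub hw), ← Function.invFunOn_eq (hsub hw')]
    exact congrArg f h
  have hb' : b ∉ g '' ball (f c) ρ := by
    rintro ⟨w, hw, rfl⟩
    exact hb (Function.invFunOn_mem (hsub hw))
  have := norm_deriv_mul_le_of_notMem_image hgd hgi hρ hb'
  rw [hgd', hgc, norm_inv,
    inv_mul_eq_div, div_le_iff₀ (norm_pos_iff.2 hd0), ← dist_eq_norm] at this
  linarith

/-- A weak form of the distortion theorem. -/
theorem exists_norm_deriv_deriv_le : ∃ C : ℝ, 0 < C ∧ ∀ (f : ℂ → ℂ) (c : ℂ) (R : ℝ),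
    DifferentiableOn ℂ f (ball c R) → InjOn f (ball c R) → 0 < R →
    ‖deriv (deriv f) c‖ * R ≤ C * ‖deriv f c‖ := by
  refine ⟨1568 * 3 * 785 * 1568 * 1568, by norm_num, fun f c R hf hinj hR => ?_⟩
  have hcR := mem_ball_self (x := c) hR
  have hd0 := deriv_ne_zero_of_injOn_ball hf hinj hcR
  have hdp : 0 < ‖deriv f c‖ := norm_pos_iff.2 hd0
  obtain ⟨a, hdist, ha⟩ : ∃ a, dist a (f c) < 785 * (‖deriv f c‖ * R) ∧ a ∉ f '' ball c R := by
    by_contra! h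
    have h1 := le_of_ball_subset_image hf hinj hcR (ρ := 785 * (‖deriv f c‖ * R)) (by positivity)
      (fun a ha => h a ha) (b := c + (R : ℂ)) (by simp [abs_of_pos hR])
    rw [dist_self_add_right, Complex.norm_real, Real.norm_eq_abs, abs_of_pos hR] at h1
    nlinarith [mul_pos hdp hR]
  have hne : ∀ z ∈ ball c R, f z - a ≠ 0 := fun z hz h => ha ⟨z, hz, sub_eq_zero.1 h⟩
  obtain ⟨L, hL, hexp⟩ := exists_log_on_ball (hf.sub_const a) hne
  have hsub : ∀ z ∈ ball c (R / 2), ball z (R / 2) ⊆ ball c R := by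
    intro z hz x hx
    rw [mem_ball] at *
    linarith [dist_triangle x z c]
  have hK : ∀ z ∈ ball c (R / 2), ‖deriv f z‖ ≤ 1568 / R * ‖f z - a‖ := by
    intro z hz
    have := norm_deriv_mul_le_of_notMem_image (hf.mono (hsub z hz)) (hinj.mono (hsub z hz))
      (by linarith) (fun h => ha (image_mono (hsub z hz) h))
    rw [div_mul_eq_mul_div, le_div_iff₀ hR]
    linarith
  have hh : ball c (R / 2) ⊆ ball c R := ball_subset_ball (by linarith)
  have hLip : ∀ z ∈ ball c (R / 1568), ‖L z - L c‖ ≤ 1 := by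
    intro z hz
    have hz2 : z ∈ ball c (R / 2) := ball_subset_ball (by linarith) hz
    have := (convex_ball c (R / 2)).norm_image_sub_le_of_norm_hasDerivWithin_le
      (f := L) (f' := fun z => deriv f z / (f z - a)) (C := 1568 / R)
      (fun x hx => by simpa using (hL x (hh hx)).hasDerivWithinAt)
      (fun x hx => by
        rw [norm_div, div_le_iff₀ (norm_pos_iff.2 (hne x (hh hx)))]
        exact hK x hx) (mem_ball_self (by linarith)) hz2
    refine this.trans ?_
    rw [mem_ball, dist_eq_norm] at hz
    calc 1568 / R * ‖z - c‖ ≤ 1568 / R * (R / 1568) := by gcongr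
      _ = 1 := by field_simp
  have hgrow : ∀ z ∈ ball c (R / 1568), ‖deriv f z‖ ≤ 1568 * 3 * 785 * ‖deriv f c‖ := by
    intro z hz
    have hz2 : z ∈ ball c (R / 2) := ball_subset_ball (by linarith) hz
    have h1 : ‖f z - a‖ ≤ 3 * ‖f c - a‖ := by
      rw [← hexp z (hh hz2), ← hexp c hcR, Complex.norm_exp, Complex.norm_exp]
      have h2 : (L z).re ≤ 1 + (L c).re := by
        have := (Complex.re_le_norm (L z - L c)).trans (hLip z hz)
        rw [Complex.sub_re] at this
        linarith
      calc Real.exp (L z).re ≤ Real.exp (1 + (L c).re) := Real.exp_le_exp.2 h2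
        _ = Real.exp 1 * Real.exp (L c).re := Real.exp_add _ _
        _ ≤ _ := by gcongr; linarith [Real.exp_one_lt_d9]
    rw [dist_comm, dist_eq_norm] at hdist
    calc ‖deriv f z‖ ≤ 1568 / R * ‖f z - a‖ := hK z hz2
      _ ≤ 1568 / R * (3 * (785 * (‖deriv f c‖ * R))) := by gcongr; linarith
      _ = _ := by field_simp
  have hs : 0 < R / 1568 := by positivity
  have hcd := Complex.norm_deriv_le_div_of_mapsTo_ball (f := deriv f) (c := c) (R₁ := R / 1568)
    (R₂ := 2 * (1568 * 3 * 785 * ‖deriv f c‖))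
    ((hf.deriv isOpen_ball).mono (ball_subset_ball (by linarith)))
    (fun z hz => by
      rw [mem_closedBall, dist_eq_norm]
      refine (norm_sub_le _ _).trans ?_
      linarith [hgrow z hz, hgrow c (mem_ball_self hs)]) hs
  rw [le_div_iff₀ hs] at hcd
  linarith

end Koebe

section Carleson

theorem carlesonNorm_le_iff {Ω : Set ℂ} {μ : Measure ℂ} {K : ℝ≥0∞} :
    carlesonNorm Ω μ ≤ K ↔ ∀ z ∈ frontier Ω, ∀ r : ℝ, 0 < r →
      ENNReal.ofReal r < ediam (frontier Ω) →
        μ (Ω ∩ ball z r) ≤ K * ENNReal.ofReal r := by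
  simp only [carlesonNorm, iSup_le_iff, and_imp]
  refine forall₅_congr fun z hz r hr hd => ?_
  rw [ENNReal.div_le_iff (ENNReal.ofReal_pos.2 hr).ne' ENNReal.ofReal_ne_top]

theorem isOpen_unitDisk : IsOpen unitDisk := isOpen_ball

theorem frontier_unitDisk : frontier unitDisk = sphere 0 1 :=
  frontier_ball _ one_ne_zero

theorem ediam_frontier_unitDisk : ediam (frontier unitDisk) = ENNReal.ofReal 2 := by
  rw [frontier_unitDisk]
  apply le_antisymm
  · refine (ediam_mono sphere_subset_closedBall).trans ?_
    refine ediam_le fun x hx y hy => ?_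
    rw [edist_dist]
    refine ENNReal.ofReal_le_ofReal ?_
    rw [mem_closedBall] at hx hy
    linarith [dist_triangle_right x y 0]
  · have := edist_le_ediam_of_mem (s := sphere (0 : ℂ) 1) (x := 1) (y := -1)
      (by simp) (by simp)
    refine le_trans (le_of_eq ?_) this
    rw [edist_dist, dist_eq_norm]
    norm_num

variable {φ : ℂ → ℂ} {D : Set ℂ}

theorem pushForward_apply (hD : IsOpen D) (hφ : ContinuousOn φ D) (ν : Measure ℂ) {A : Set ℂ}
    (hA : IsOpen A) :
    pushForward D φ ν A = ∫⁻ z in D ∩ φ ⁻¹' A, ‖deriv φ z‖₊ ∂ν := by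
  have hae : AEMeasurable φ (ν.restrict D) := hφ.aemeasurable hD.measurableSet
  have hae' : AEMeasurable φ ((ν.restrict D).withDensity fun z => (‖deriv φ z‖₊ : ℝ≥0∞)) :=
    hae.mono_ac (withDensity_absolutelyContinuous _ _)
  have hn := hae.nullMeasurableSet_preimage hA.measurableSet
  rw [pushForward, Measure.map_apply_of_aemeasurable hae' hA.measurableSet,
    withDensity_apply₀ _ hn, Measure.restrict_restrict₀ hn, inter_comm]

/-- A positive operator between spaces of Carleson measures is bounded. -/
theorem exists_carlesonNorm_pushForward_le {Ω : Set ℂ} (hD : IsOpen D) (hΩ : IsOpen Ω)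
    (hφ : ContinuousOn φ D)
    (h : ∀ ν : Measure ℂ, IsCarleson D ν → IsCarleson Ω (pushForward D φ ν)) :
    ∃ K : ℝ≥0, ∀ ν : Measure ℂ, carlesonNorm D ν ≤ 1 →
      carlesonNorm Ω (pushForward D φ ν) ≤ K := by
  by_contra! hcon
  choose ν hν hbig using fun n : ℕ => hcon (4 ^ n)
  set c : ℕ → ℝ≥0∞ := fun n => 2⁻¹ ^ n with hc
  set N : Measure ℂ := Measure.sum fun n => c n • ν n with hN
  have hsum : ∑' n, c n = 2 := by
    rw [hc, ENNReal.tsum_geometric, ENNReal.one_sub_inv_two, inv_inv]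
  have hNc : IsCarleson D N := by
    refine lt_of_le_of_lt (carlesonNorm_le_iff (K := 2).2 fun z hz r hr hd => ?_) (by simp)
    rw [hN, Measure.sum_apply _ (hD.inter isOpen_ball).measurableSet, ← hsum, ← ENNReal.tsum_mul_right]
    refine ENNReal.tsum_le_tsum fun n => ?_
    rw [Measure.smul_apply, smul_eq_mul]
    gcongr
    simpa using carlesonNorm_le_iff.1 (hν n) z hz r hr hd
  have hlow : ∀ n, c n * carlesonNorm Ω (pushForward D φ (ν n)) ≤
      carlesonNorm Ω (pushForward D φ N) := by
    intro n
    have hc0 : c n ≠ 0 := by simp [hc]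
    have hct : c n ≠ ⊤ := by simp [hc]
    rw [mul_comm, ← ENNReal.le_div_iff_mul_le (Or.inl hc0) (Or.inl hct)]
    refine carlesonNorm_le_iff.2 fun z hz r hr hd => ?_
    have h1 := carlesonNorm_le_iff.1 (le_refl (carlesonNorm Ω (pushForward D φ N))) z hz r hr hd
    rw [pushForward_apply hD hφ _ (hΩ.inter isOpen_ball)] at h1 ⊢
    rw [← ENNReal.mul_div_right_comm, ENNReal.le_div_iff_mul_le (Or.inl hc0) (Or.inl hct), mul_comm]
    refine le_trans ?_ h1
    rw [← smul_eq_mul, ← lintegral_smul_measure, ← Measure.restrict_smul]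
    exact lintegral_mono' (Measure.restrict_mono le_rfl (Measure.le_sum _ n)) le_rfl
  have hfin := h N hNc
  obtain ⟨n, hn⟩ := ENNReal.exists_nat_gt hfin.ne
  have h2 : (n : ℝ≥0∞) ≤ c n * carlesonNorm Ω (pushForward D φ (ν n)) := by
    calc (n : ℝ≥0∞) ≤ 2 ^ n := by exact_mod_cast Nat.lt_two_pow_self.le
      _ = c n * 4 ^ n := by
        rw [hc]
        simp only
        rw [← mul_pow]
        congr 1
        rw [show (4 : ℝ≥0∞) = 2 * 2 by norm_num, ← mul_assoc,
          ENNReal.inv_mul_cancel two_ne_zero ENNReal.ofNat_ne_top, one_mul]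
      _ ≤ _ := by
        gcongr
        simpa using (hbig n).le
  exact absurd ((h2.trans (hlow n)).trans_lt hn) (lt_irrefl _)

end Carleson

section AhlforsOfCarleson

open Filter Topology

/-- Arclength (in the angular variable) on the circle of radius `ρ`. -/
noncomputable def circleMeasure (ρ : ℝ) : Measure ℂ :=
  Measure.map (circleMap 0 ρ) (volume.restrict (Ioc 0 (2 * Real.pi)))

theorem circleMeasure_ball_le {ρ : ℝ} (hρ0 : 0 < ρ) (hρ1 : ρ < 1) {w : ℂ} (hw : ‖w‖ = 1) {r : ℝ}
    (hr : 0 < r) : circleMeasure ρ (ball w r) ≤ ENNReal.ofReal (4 * Real.pi * r) := by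
  rw [circleMeasure, Measure.map_apply (measurable_circleMap 0 ρ) measurableSet_ball,
    Measure.restrict_apply ((measurable_circleMap 0 ρ) measurableSet_ball)]
  set α := w.arg with hα
  have hwα : w = Complex.exp (Complex.I * α) := by
    have := Complex.norm_mul_exp_arg_mul_I w
    rw [hw, Complex.ofReal_one, one_mul, mul_comm] at this
    exact this.symm
  have hsub : circleMap 0 ρ ⁻¹' ball w r ∩ Ioc 0 (2 * Real.pi) ⊆
      closedBall α (Real.pi * r) ∪ closedBall (α + 2 * Real.pi) (Real.pi * r) := by
    rintro θ ⟨hθ, hθ0, hθ1⟩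
    rw [mem_preimage, mem_ball, dist_eq_norm, circleMap, zero_add, mul_comm (θ : ℂ)] at hθ
    set e := Complex.exp (Complex.I * θ) with he
    have hen : ‖e‖ = 1 := Complex.norm_exp_I_mul_ofReal θ
    have h1 : 1 - ρ < r := by
      have := norm_sub_norm_le w (ρ * e)
      rw [norm_mul, hen, hw, Complex.norm_real, Real.norm_eq_abs, abs_of_pos hρ0, norm_sub_rev] at this
      linarith
    have h2 : ‖e - w‖ < 2 * r := by
      have h3 : e - w = ((1 - ρ : ℝ) : ℂ) * e + (ρ * e - w) := by push_cast; ring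
      rw [h3]
      refine (norm_add_le _ _).trans_lt ?_
      rw [norm_mul, hen, Complex.norm_real, Real.norm_eq_abs, abs_of_pos (by linarith)]
      linarith
    have h4 : ‖e - w‖ = 2 * |Real.sin ((θ - α) / 2)| := by
      have h5 : e - w = w * (Complex.exp (Complex.I * (θ - α : ℝ)) - 1) := by
        rw [hwα, he, mul_sub, ← Complex.exp_add, mul_one]
        congr 2
        push_cast
        ring
      rw [h5, norm_mul, hw, one_mul, Complex.norm_exp_I_mul_ofReal_sub_one, norm_mul,
        Real.norm_eq_abs, Real.norm_eq_abs, abs_two]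
    rw [h4] at h2
    have hα1 := Complex.arg_le_pi w
    have hα2 := Complex.neg_pi_lt_arg w
    have hπ := Real.pi_pos
    have key : ∀ x : ℝ, |x| ≤ Real.pi / 2 → |Real.sin x| < r → 2 * |x| ≤ Real.pi * r := by
      intro x hx hxr
      have := Real.mul_abs_le_abs_sin hx
      have h6 : 2 / Real.pi * |x| ≤ r := this.trans hxr.le
      rw [div_mul_eq_mul_div, div_le_iff₀ hπ] at h6
      linarith
    rcases le_total ((θ - α) / 2) (Real.pi / 2) with h | h
    · left
      have := key ((θ - α) / 2) (abs_le.2 ⟨by linarith, h⟩) (by linarith)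
      rw [mem_closedBall, Real.dist_eq]
      rw [abs_div, abs_two] at this
      linarith
    · right
      have := key ((θ - α) / 2 - Real.pi) (abs_le.2 ⟨by linarith, by linarith⟩)
        (by rw [Real.sin_sub_pi, abs_neg]; linarith)
      rw [mem_closedBall, Real.dist_eq]
      rw [show (θ - α) / 2 - Real.pi = (θ - (α + 2 * Real.pi)) / 2 by ring, abs_div, abs_two] at this
      linarith
  refine (measure_mono hsub).trans ((measure_union_le _ _).trans ?_)
  rw [Real.volume_closedBall, Real.volume_closedBall, ← ENNReal.ofReal_add (by positivity) (by positivity)]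
  refine ENNReal.ofReal_le_ofReal (by linarith)

theorem exists_carlesonNorm_circleMeasure_le {φ : ℂ → ℂ} {Ω : Set ℂ} (hΩ : IsOpen Ω)
    (hφ : ContinuousOn φ unitDisk)
    (h : ∀ ν : Measure ℂ, IsCarleson unitDisk ν → IsCarleson Ω (pushForward unitDisk φ ν)) :
    ∃ K : ℝ≥0, ∀ ρ : ℝ, 0 < ρ → ρ < 1 →
      carlesonNorm Ω (pushForward unitDisk φ (circleMeasure ρ)) ≤ K := by
  obtain ⟨K, hK⟩ := exists_carlesonNorm_pushForward_le isOpen_unitDisk hΩ hφ h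
  set c : ℝ≥0 := (4 * Real.pi).toNNReal with hc
  have hc0 : c ≠ 0 := by
    rw [hc, Ne, Real.toNNReal_eq_zero, not_le]
    positivity
  have hcc : (c⁻¹ : ℝ≥0) * ENNReal.ofReal (4 * Real.pi) = (1 : ℝ≥0∞) := by
    rw [ENNReal.ofReal, ← hc, ← ENNReal.coe_mul, inv_mul_cancel₀ hc0, ENNReal.coe_one]
  refine ⟨c * K, fun ρ hρ0 hρ1 => ?_⟩
  have h1 : carlesonNorm unitDisk (c⁻¹ • circleMeasure ρ) ≤ 1 := by
    refine carlesonNorm_le_iff.2 fun z hz r hr hd => ?_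
    rw [frontier_unitDisk, mem_sphere_zero_iff_norm] at hz
    have := circleMeasure_ball_le hρ0 hρ1 hz hr
    rw [Measure.smul_apply, one_mul, ENNReal.smul_def, smul_eq_mul]
    calc _ ≤ (c⁻¹ : ℝ≥0) * ENNReal.ofReal (4 * Real.pi * r) := by
          gcongr
          exact (measure_mono inter_subset_right).trans this
      _ = ENNReal.ofReal r := by
          rw [ENNReal.ofReal_mul (by positivity), ← mul_assoc, hcc, one_mul]
  refine carlesonNorm_le_iff.2 fun z hz r hr hd => ?_
  have h2 := carlesonNorm_le_iff.1 (hK _ h1) z hz r hr hd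
  have hO : IsOpen (Ω ∩ ball z r) := hΩ.inter isOpen_ball
  rw [pushForward_apply isOpen_unitDisk hφ _ hO] at h2 ⊢
  rw [Measure.restrict_smul, lintegral_smul_measure, ENNReal.smul_def, smul_eq_mul] at h2
  calc _ = (c : ℝ≥0∞) * ((c⁻¹ : ℝ≥0) * ∫⁻ z in unitDisk ∩ φ ⁻¹' (Ω ∩ ball z r),
        ‖deriv φ z‖₊ ∂circleMeasure ρ) := by
        rw [← mul_assoc, ← ENNReal.coe_mul, mul_inv_cancel₀ hc0, ENNReal.coe_one, one_mul]
    _ ≤ c * (K * ENNReal.ofReal r) := by gcongr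
    _ = _ := by rw [ENNReal.coe_mul, mul_assoc]

theorem circleMap_mem_unitDisk {ρ : ℝ} (hρ0 : 0 < ρ) (hρ1 : ρ < 1) (θ : ℝ) :
    circleMap 0 ρ θ ∈ unitDisk := by
  rw [unitDisk, mem_ball_zero_iff, norm_circleMap_zero, abs_of_pos hρ0]
  exact hρ1

/-- A curve inequality: the image of a circle near the boundary has length at least `2ε` in the
disk of radius `4ε` about an omitted value. -/
theorem le_pushForward_circleMeasure {φ : ℂ → ℂ} (hφ : DifferentiableOn ℂ φ unitDisk)
    (hΩ : IsOpen (φ '' unitDisk)) {p : ℂ} (hp : p ∉ φ '' unitDisk) {ε ρ : ℝ} (hε : 0 < ε) (h0 : 4 * ε < ‖φ 0 - p‖) {z : ℂ}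
    (hzρ : ‖z‖ < ρ) (hρ : ρ < 1) (hz : ‖φ z - p‖ < 2 * ε) :
    ENNReal.ofReal (2 * ε) ≤ pushForward unitDisk φ (circleMeasure ρ)
      (φ '' unitDisk ∩ ball p (4 * ε)) := by
  have hρ0 : 0 < ρ := (norm_nonneg z).trans_lt hzρ
  have hne : ∀ z ∈ unitDisk, φ z - p ≠ 0 := fun z hz h => hp ⟨z, hz, sub_eq_zero.1 h⟩
  have hcl : closedBall 0 ρ ⊆ unitDisk := closedBall_subset_ball hρ
  have hdc : DiffContOnCl ℂ (fun z => φ z - p) (ball 0 ρ) := by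
    refine DifferentiableOn.diffContOnCl ?_
    rw [closure_ball _ hρ0.ne']
    exact (hφ.sub_const p).mono hcl
  have hsph : ∀ x ∈ sphere (0 : ℂ) ρ, ∃ θ ∈ Ioc 0 (2 * Real.pi), circleMap 0 ρ θ = x := by
    intro x hx
    rw [← abs_of_pos hρ0, ← image_circleMap_Ioc] at hx
    exact hx
  set h : ℝ → ℝ := fun θ => ‖φ (circleMap 0 ρ θ) - p‖ with hh
  obtain ⟨θ₁, hθ₁, hlt⟩ : ∃ θ ∈ Ioc 0 (2 * Real.pi), h θ < 2 * ε := by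
    by_contra! hcon
    have := Complex.norm_le_of_forall_mem_frontier_norm_le (f := fun z => (φ z - p)⁻¹)
      (U := ball 0 ρ) isBounded_ball (C := (2 * ε)⁻¹)
      (hdc.inv (by
        rw [closure_ball _ hρ0.ne']
        exact fun z hz => hne z (hcl hz)))
      (fun x hx => by
        rw [frontier_ball _ hρ0.ne'] at hx
        obtain ⟨θ, hθ, rfl⟩ := hsph x hx
        rw [norm_inv]
        exact inv_anti₀ (by positivity) (hcon θ hθ))
      (subset_closure (mem_ball_zero_iff.2 hzρ))
    rw [norm_inv] at this
    have h2 : 0 < ‖φ z - p‖ := norm_pos_iff.2 (hne z (hcl (by simpa using hzρ.le)))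
    exact absurd ((inv_le_inv₀ h2 (by positivity)).1 this) (not_le.2 hz)
  obtain ⟨θ₂, hθ₂, hge⟩ : ∃ θ ∈ Ioc 0 (2 * Real.pi), 4 * ε ≤ h θ := by
    by_contra! hcon
    have := Complex.norm_le_of_forall_mem_frontier_norm_le (f := fun z => φ z - p)
      (U := ball 0 ρ) isBounded_ball (C := 4 * ε) hdc
      (fun x hx => by
        rw [frontier_ball _ hρ0.ne'] at hx
        obtain ⟨θ, hθ, rfl⟩ := hsph x hx
        exact (hcon θ hθ).le)
      (subset_closure (mem_ball_self hρ0))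
    linarith
  have hγ : ∀ θ, HasDerivAt (fun θ : ℝ => φ (circleMap 0 ρ θ) - p)
      (deriv φ (circleMap 0 ρ θ) * (circleMap 0 ρ θ * Complex.I)) θ := by
    intro θ
    exact (((hφ.differentiableAt (isOpen_ball.mem_nhds
      (circleMap_mem_unitDisk hρ0 hρ θ))).hasDerivAt.comp θ (hasDerivAt_circleMap 0 ρ θ))).sub_const p
  have hd : ∀ θ, DifferentiableAt ℝ h θ := fun θ =>
    (hγ θ).differentiableAt.norm ℝ (hne _ (circleMap_mem_unitDisk hρ0 hρ θ))
  have hbound : ∀ θ, |deriv h θ| ≤ ‖deriv φ (circleMap 0 ρ θ)‖ := by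
    intro θ
    have hγn := circleMap_mem_unitDisk hρ0 hρ θ
    have hpos : 0 < h θ := norm_pos_iff.2 (hne _ hγn)
    have h1 := ((hγ θ).norm_sq).unique ((hd θ).hasDerivAt.pow 2)
    have h2 := abs_real_inner_le_norm (φ (circleMap 0 ρ θ) - p)
      (deriv φ (circleMap 0 ρ θ) * (circleMap 0 ρ θ * Complex.I))
    rw [norm_mul, norm_mul, Complex.norm_I, mul_one, norm_circleMap_zero, abs_of_pos hρ0] at h2
    have h3 : |h θ * deriv h θ| ≤ h θ * (‖deriv φ (circleMap 0 ρ θ)‖ * ρ) := by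
      refine le_trans (le_of_eq ?_) h2
      congr 1
      simp only [Nat.cast_ofNat, Nat.add_one_sub_one, pow_one] at h1
      linarith
    rw [abs_mul, abs_of_pos hpos] at h3
    refine (le_of_mul_le_mul_left h3 hpos).trans ?_
    exact mul_le_of_le_one_right (norm_nonneg _) hρ.le
  set S := {θ | h θ < 4 * ε} ∩ Ioc 0 (2 * Real.pi) with hS
  have hhc : Continuous h := continuous_iff_continuousAt.2 fun θ => (hd θ).continuousAt
  have hSm : MeasurableSet S := (measurableSet_lt hhc.measurable measurable_const).inter measurableSet_Ioc
  have himage : Ico (2 * ε) (4 * ε) ⊆ h '' S := by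
    intro y hy
    have := isPreconnected_Ioc.intermediate_value hθ₁ hθ₂ hhc.continuousOn
      (show y ∈ Icc _ _ from ⟨hlt.le.trans hy.1, hy.2.le.trans hge⟩)
    obtain ⟨θ, hθ, rfl⟩ := this
    exact ⟨θ, ⟨hy.2, hθ⟩, rfl⟩
  have hO : IsOpen (φ '' unitDisk ∩ ball p (4 * ε)) := hΩ.inter isOpen_ball
  rw [pushForward_apply isOpen_unitDisk hφ.continuousOn _ hO]
  have hm : MeasurableSet (unitDisk ∩ φ ⁻¹' (φ '' unitDisk ∩ ball p (4 * ε))) :=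
    (hφ.continuousOn.isOpen_inter_preimage isOpen_ball hO).measurableSet
  have hpre : S = circleMap 0 ρ ⁻¹' (unitDisk ∩ φ ⁻¹' (φ '' unitDisk ∩ ball p (4 * ε))) ∩
      Ioc 0 (2 * Real.pi) := by
    ext θ
    have := circleMap_mem_unitDisk hρ0 hρ θ
    have h3 : φ (circleMap 0 ρ θ) ∈ φ '' unitDisk := mem_image_of_mem φ this
    simp only [hS, hh, mem_inter_iff, mem_ofPred_eq, mem_preimage, this, h3, true_and, mem_ball,
      dist_eq_norm]
  rw [circleMeasure, Measure.restrict_map (measurable_circleMap 0 ρ) hm,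
    Measure.restrict_restrict ((measurable_circleMap 0 ρ) hm), ← hpre,
    lintegral_map (by
      have := measurable_deriv φ
      fun_prop) (measurable_circleMap 0 ρ)]
  calc ENNReal.ofReal (2 * ε) = volume (Ico (2 * ε) (4 * ε)) := by
        rw [Real.volume_Ico]; congr 1; ring
    _ ≤ volume (h '' S) := measure_mono himage
    _ ≤ ∫⁻ θ in S, ENNReal.ofReal |(fderiv ℝ h θ).det| :=
        addHaar_image_le_lintegral_abs_det_fderiv volume hSm
          fun θ _ => (hd θ).hasFDerivAt.hasFDerivWithinAt
    _ ≤ _ := by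
        refine lintegral_mono fun θ => ?_
        rw [← enorm_eq_nnnorm, ← ofReal_norm]
        refine ENNReal.ofReal_le_ofReal (le_trans (le_of_eq ?_) (hbound θ))
        rw [← toSpanSingleton_deriv, ContinuousLinearMap.det_toSpanSingleton]

end AhlforsOfCarleson

section AhlforsOfCarleson

open Filter Topology

theorem exists_finset_cover_of_card_le {X : Type*} [PseudoMetricSpace X] {S : Set X} {η : ℝ} (hη : 0 < η) {N : ℕ}
    (h : ∀ F : Finset X, ↑F ⊆ S → (∀ x ∈ F, ∀ y ∈ F, x ≠ y → η ≤ dist x y) → F.card ≤ N) :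
    ∃ F : Finset X, ↑F ⊆ S ∧ (∀ x ∈ F, ∀ y ∈ F, x ≠ y → η ≤ dist x y) ∧
      S ⊆ ⋃ x ∈ F, ball x η := by
  classical
  set P : ℕ → Prop := fun n => ∃ F : Finset X, ↑F ⊆ S ∧
    (∀ x ∈ F, ∀ y ∈ F, x ≠ y → η ≤ dist x y) ∧ F.card = n with hP
  obtain ⟨F, hFS, hF, hcard⟩ : P (Nat.findGreatest P N) :=
    Nat.findGreatest_spec (m := 0) (Nat.zero_le _) ⟨∅, by simp⟩
  refine ⟨F, hFS, hF, fun x hx => ?_⟩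
  by_contra hcon
  simp only [mem_iUnion, mem_ball, not_exists, not_lt] at hcon
  have hxF : x ∉ F := fun hxF => absurd (hcon x hxF) (by rwa [dist_self, not_le])
  have hP' : P (F.card + 1) := by
    refine ⟨insert x F, ?_, ?_, Finset.card_insert_of_notMem hxF⟩
    · rw [Finset.coe_insert]
      exact insert_subset hx hFS
    · intro a ha b hb hab
      rcases Finset.mem_insert.1 ha with rfl | ha' <;> rcases Finset.mem_insert.1 hb with rfl | hb'
      · exact absurd rfl hab
      · exact hcon b hb'
      · rw [dist_comm]
        exact hcon a ha'
      · exact hF a ha' b hb' hab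
  obtain ⟨G, hGS, hG, hGc⟩ := hP'
  have := Nat.le_findGreatest (P := P) (hGc ▸ h G hGS hG) ⟨G, hGS, hG, hGc⟩
  omega

theorem hausdorffMeasure_le_of_separated {S : Set ℂ} {M ε₀ : ℝ} (hε₀ : 0 < ε₀)
    (h : ∀ ε : ℝ, 0 < ε → ε < ε₀ → ∀ F : Finset ℂ, ↑F ⊆ S →
      (∀ x ∈ F, ∀ y ∈ F, x ≠ y → 8 * ε ≤ dist x y) → F.card * ε ≤ M) :
    μH[1] S ≤ ENNReal.ofReal (16 * M) := by
  have hcov : ∀ n : ℕ, ∃ F : Finset ℂ, F.card * (ε₀ / (n + 2)) ≤ M ∧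
      S ⊆ ⋃ x ∈ F, ball x (8 * (ε₀ / (n + 2))) := by
    intro n
    have he : 0 < ε₀ / (n + 2) := by positivity
    have he' : ε₀ / (n + 2) < ε₀ := by
      rw [div_lt_iff₀ (by positivity)]
      nlinarith [(Nat.cast_nonneg n : (0 : ℝ) ≤ n)]
    obtain ⟨F, hFS, hF, hc⟩ := exists_finset_cover_of_card_le (S := S)
      (η := 8 * (ε₀ / (n + 2))) (by positivity) (N := ⌊M / (ε₀ / (n + 2))⌋₊) (fun F hFS hF => by
        refine Nat.le_floor ?_
        rw [le_div_iff₀ he]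
        exact h _ he he' F hFS hF)
    exact ⟨F, h _ he he' F hFS hF, hc⟩
  choose F hFM hFc using hcov
  have hlim : Tendsto (fun n : ℕ => ENNReal.ofReal (16 * (ε₀ / (n + 2)))) atTop (𝓝 0) := by
    rw [← ENNReal.ofReal_zero]
    refine (ENNReal.continuous_ofReal.tendsto _).comp ?_
    have h1 : Tendsto (fun n : ℕ => ε₀ / ((n : ℝ) + 2)) atTop (𝓝 0) :=
      tendsto_const_nhds.div_atTop
        (tendsto_atTop_add_const_right _ _ tendsto_natCast_atTop_atTop)
    simpa using h1.const_mul 16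
  have hdiam : ∀ (n : ℕ) (x : ℂ),
      ediam (ball x (8 * (ε₀ / (n + 2)))) ≤ ENNReal.ofReal (16 * (ε₀ / (n + 2))) := by
    intro n x
    refine ediam_le fun y hy z hz => ?_
    rw [edist_dist]
    refine ENNReal.ofReal_le_ofReal ?_
    rw [mem_ball] at hy hz
    linarith [dist_triangle_right y z x]
  refine (Measure.hausdorffMeasure_le_liminf_sum (ι := fun n => F n) 1 S (l := atTop)
    (fun n : ℕ => ENNReal.ofReal (16 * (ε₀ / (n + 2)))) hlim
    (fun n x => ball (x : ℂ) (8 * (ε₀ / (n + 2)))) (Eventually.of_forall fun n x => hdiam n x)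
    (Eventually.of_forall fun n => by simpa [iUnion_subtype] using hFc n)).trans ?_
  refine liminf_le_of_frequently_le' (Frequently.of_forall fun n => ?_)
  simp only [ENNReal.rpow_one]
  refine (Finset.sum_le_sum fun (x : F n) _ => hdiam n x).trans ?_
  rw [Finset.sum_const, nsmul_eq_mul, ← ENNReal.ofReal_natCast, ← ENNReal.ofReal_mul (by positivity)]
  refine ENNReal.ofReal_le_ofReal ?_
  rw [Finset.card_univ, Fintype.card_coe]
  linarith [hFM n]

theorem exists_hausdorffMeasure_le_of_pushForward {φ : ℂ → ℂ} (hφ : DifferentiableOn ℂ φ unitDisk)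
    (hΩ : IsOpen (φ '' unitDisk)) (h : ∀ ν : Measure ℂ, IsCarleson unitDisk ν →
      IsCarleson (φ '' unitDisk) (pushForward unitDisk φ ν)) :
    ∃ C : ℝ, 0 < C ∧ ∀ w ∈ frontier (φ '' unitDisk), ∀ r : ℝ, 0 < r →
      ENNReal.ofReal (2 * r) < ediam (frontier (φ '' unitDisk)) →
      μH[1] (frontier (φ '' unitDisk) ∩ ball w r) ≤ ENNReal.ofReal (C * r) := by
  set Ω := φ '' unitDisk with hΩdef
  obtain ⟨K, hK⟩ := exists_carlesonNorm_circleMeasure_le hΩ hφ.continuousOn h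
  have h00 : φ 0 ∈ Ω := mem_image_of_mem φ (mem_ball_self one_pos)
  obtain ⟨δ, hδ, hδΩ⟩ := Metric.isOpen_iff.1 hΩ _ h00
  refine ⟨16 * (K + 1), by positivity, fun w hw r hr hd => ?_⟩
  rw [mul_assoc]
  refine hausdorffMeasure_le_of_separated (ε₀ := min (δ / 4) (r / 4)) (by positivity) ?_
  intro ε hε hlt F hFS hF
  have hlt1 : ε < δ / 4 := hlt.trans_le (min_le_left _ _)
  have hlt2 : ε < r / 4 := hlt.trans_le (min_le_right _ _)
  have hnot : ∀ p ∈ frontier Ω, p ∉ Ω := fun p hp hpΩ => by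
    rw [hΩ.frontier_eq] at hp
    exact hp.2 hpΩ
  have hz : ∀ p ∈ F, ∃ z ∈ unitDisk, ‖φ z - p‖ < 2 * ε := by
    intro p hp
    have h1 : p ∈ closure Ω := frontier_subset_closure (hFS hp).1
    obtain ⟨q, ⟨z, hz, rfl⟩, hq⟩ := Metric.mem_closure_iff.1 h1 (2 * ε) (by positivity)
    rw [dist_comm, dist_eq_norm] at hq
    exact ⟨z, hz, hq⟩
  choose! z hzD hzε using hz
  obtain ⟨ρ, hρ0, hρ1, hρF⟩ : ∃ ρ : ℝ, 0 < ρ ∧ ρ < 1 ∧ ∀ p ∈ F, ‖z p‖ < ρ := by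
    have h1 : ∀ p ∈ F, ∀ᶠ ρ in 𝓝[<] (1 : ℝ), ‖z p‖ < ρ := fun p hp =>
      nhdsWithin_le_nhds (lt_mem_nhds (by simpa [unitDisk] using hzD p hp))
    have h2 := (F.eventually_all).2 h1
    have h3 : ∀ᶠ ρ in 𝓝[<] (1 : ℝ), (0 : ℝ) < ρ := nhdsWithin_le_nhds (lt_mem_nhds one_pos)
    obtain ⟨ρ, ⟨ha, hb⟩, hc⟩ := ((h2.and h3).and self_mem_nhdsWithin).exists
    exact ⟨ρ, hb, hc, ha⟩
  have hup := carlesonNorm_le_iff.1 (hK ρ hρ0 hρ1) w hw (2 * r) (by positivity) hd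
  have hlow : ∀ p ∈ F, ENNReal.ofReal (2 * ε) ≤
      pushForward unitDisk φ (circleMeasure ρ) (Ω ∩ ball p (4 * ε)) := by
    intro p hp
    refine le_pushForward_circleMeasure hφ hΩ (hnot p (hFS hp).1) hε ?_ (hρF p hp) hρ1 (hzε p hp)
    by_contra hcon
    refine hnot p (hFS hp).1 (hδΩ ?_)
    rw [mem_ball, dist_comm, dist_eq_norm]
    linarith
  have hdisj : (F : Set ℂ).PairwiseDisjoint fun p => Ω ∩ ball p (4 * ε) := by
    intro p hp q hq hpq
    refine (ball_disjoint_ball ?_).mono inter_subset_right inter_subset_right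
    linarith [hF p hp q hq hpq]
  have hsum : (F.card : ℝ≥0∞) * ENNReal.ofReal (2 * ε) ≤ K * ENNReal.ofReal (2 * r) := by
    calc (F.card : ℝ≥0∞) * ENNReal.ofReal (2 * ε) = ∑ p ∈ F, ENNReal.ofReal (2 * ε) := by
          rw [Finset.sum_const, nsmul_eq_mul]
      _ ≤ ∑ p ∈ F, pushForward unitDisk φ (circleMeasure ρ) (Ω ∩ ball p (4 * ε)) :=
          Finset.sum_le_sum hlow
      _ = pushForward unitDisk φ (circleMeasure ρ) (⋃ p ∈ F, Ω ∩ ball p (4 * ε)) :=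
          (measure_biUnion_finset hdisj fun p _ => (hΩ.inter isOpen_ball).measurableSet).symm
      _ ≤ _ := by
          refine (measure_mono (iUnion₂_subset fun p hp => ?_)).trans hup
          refine inter_subset_inter_right _ (ball_subset_ball' ?_)
          have := (hFS hp).2
          rw [mem_ball] at this
          linarith
  have h3 : ENNReal.ofReal (F.card * (2 * ε)) ≤ ENNReal.ofReal (K * (2 * r)) := by
    rw [ENNReal.ofReal_mul (Nat.cast_nonneg _), ENNReal.ofReal_mul K.coe_nonneg,
      ENNReal.ofReal_natCast, ENNReal.ofReal_coe_nnreal]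
    exact hsum
  have h4 := (ENNReal.ofReal_le_ofReal_iff (by positivity)).1 h3
  nlinarith

/-- Boundedness of the push-forward operator implies Ahlfors regularity of the boundary. -/
theorem ahlforsRegular_of_pushForward {φ : ℂ → ℂ} (hφ : DifferentiableOn ℂ φ unitDisk)
    (hΩ : IsOpen (φ '' unitDisk)) (h : ∀ ν : Measure ℂ, IsCarleson unitDisk ν →
      IsCarleson (φ '' unitDisk) (pushForward unitDisk φ ν)) :
    ∃ C : ℝ, 0 < C ∧ ∀ z : ℂ, ∀ r : ℝ, 0 < r →
      μH[1] (frontier (φ '' unitDisk) ∩ ball z r) ≤ ENNReal.ofReal (C * r) := by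
  obtain ⟨C, hC, hloc⟩ := exists_hausdorffMeasure_le_of_pushForward hφ hΩ h
  set S := frontier (φ '' unitDisk) with hS
  suffices hs : ∃ C : ℝ, 0 < C ∧ ∀ w ∈ S, ∀ r : ℝ, 0 < r →
      μH[1] (S ∩ ball w r) ≤ ENNReal.ofReal (C * r) by
    obtain ⟨C', hC', hs⟩ := hs
    refine ⟨2 * C', by positivity, fun z r hr => ?_⟩
    rcases (S ∩ ball z r).eq_empty_or_nonempty with he | ⟨w, hwS, hw⟩
    · rw [he, measure_empty]
      exact zero_le
    · refine (measure_mono ?_).trans ((hs w hwS (2 * r) (by positivity)).trans (le_of_eq ?_))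
      · refine inter_subset_inter_right _ (ball_subset_ball' ?_)
        rw [mem_ball, dist_comm] at hw
        linarith
      · congr 1
        ring
  by_cases hd : ediam S = ⊤
  · exact ⟨C, hC, fun w hw r hr => hloc w hw r hr (by rw [hd]; exact ENNReal.ofReal_lt_top)⟩
  rcases eq_or_ne (ediam S) 0 with h0 | h0
  · refine ⟨1, one_pos, fun w hw r hr => ?_⟩
    have hsub : (S ∩ ball w r).Subsingleton :=
      (ediam_eq_zero_iff.1 h0).anti inter_subset_left
    have : μH[1] (S ∩ ball w r) = 0 := by
      have hna := Measure.nullSingletonClass_hausdorff ℂ one_pos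
      exact hsub.measure_zero _
    rw [this]
    exact zero_le
  · obtain ⟨d, hdpos, hde⟩ : ∃ d : ℝ, 0 < d ∧ ediam S = ENNReal.ofReal d :=
      ⟨_, ENNReal.toReal_pos h0 hd, (ENNReal.ofReal_toReal hd).symm⟩
    have hb : Bornology.IsBounded S := isBounded_iff_ediam_ne_top.2 hd
    have hcomp : IsCompact S := Metric.isCompact_of_isClosed_isBounded isClosed_frontier hb
    obtain ⟨t, htS, hcov⟩ := hcomp.elim_nhds_subcover (fun x => ball x (d / 4))
      fun x _ => ball_mem_nhds x (by positivity)
    have hM : μH[1] S ≤ ENNReal.ofReal (t.card * (C * (d / 4))) := by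
      calc μH[1] S ≤ μH[1] (⋃ x ∈ t, S ∩ ball x (d / 4)) := by
            refine measure_mono fun y hy => ?_
            obtain ⟨x, hx, hyx⟩ := mem_iUnion₂.1 (hcov hy)
            exact mem_iUnion₂.2 ⟨x, hx, hy, hyx⟩
        _ ≤ ∑ x ∈ t, μH[1] (S ∩ ball x (d / 4)) := measure_biUnion_finset_le _ _
        _ ≤ ∑ x ∈ t, ENNReal.ofReal (C * (d / 4)) := by
            refine Finset.sum_le_sum fun x hx => hloc x (htS x hx) _ (by positivity) ?_
            rw [hde]
            exact (ENNReal.ofReal_lt_ofReal_iff hdpos).2 (by linarith)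
        _ = _ := by
            rw [Finset.sum_const, nsmul_eq_mul, ENNReal.ofReal_mul (Nat.cast_nonneg _),
              ENNReal.ofReal_natCast]
    refine ⟨(t.card + 1) * C, by positivity, fun w hw r hr => ?_⟩
    rcases lt_or_ge (2 * r) d with hrd | hrd
    · refine (hloc w hw r hr (by rw [hde]; exact (ENNReal.ofReal_lt_ofReal_iff hdpos).2 hrd)).trans ?_
      refine ENNReal.ofReal_le_ofReal ?_
      have : 0 ≤ t.card * (C * r) := by positivity
      nlinarith
    · refine (measure_mono inter_subset_left).trans (hM.trans (ENNReal.ofReal_le_ofReal ?_))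
      have h1 : (t.card : ℝ) * (C * (d / 4)) ≤ t.card * (C * r) := by
        gcongr
        linarith
      have : 0 ≤ C * r := by positivity
      linarith

end AhlforsOfCarleson

section DyadicTree

/-- The leaves, among the dyadic descendants of `(n, j)` of generation at most `n + k`, of the
stopping time given by `halts`. -/
noncomputable def stoppedLeaves (halts : ℕ × ℕ → Prop) [DecidablePred halts] :
    ℕ → ℕ → ℕ → Finset (ℕ × ℕ)
  | 0, n, j => {(n, j)}
  | k + 1, n, j => if halts (n, j) then {(n, j)} else
      stoppedLeaves halts k (n + 1) (2 * j) ∪ stoppedLeaves halts k (n + 1) (2 * j + 1)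

/-- The sum of `f` over the descendants of `(n, j)` of generation `n + e`. -/
noncomputable def generationSum (f : ℕ → ℕ → ℝ) (e n j : ℕ) : ℝ :=
  ∑ i ∈ Finset.range (2 ^ e), f (n + e) (j * 2 ^ e + i)

theorem generationSum_zero (f : ℕ → ℕ → ℝ) (n j : ℕ) : generationSum f 0 n j = f n j := by
  simp [generationSum]

theorem generationSum_succ (f : ℕ → ℕ → ℝ) (e n j : ℕ) : generationSum f (e + 1) n j =
    generationSum f e (n + 1) (2 * j) + generationSum f e (n + 1) (2 * j + 1) := by
  unfold generationSum
  rw [pow_succ, mul_two, Finset.sum_range_add]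
  congr 1 <;> refine Finset.sum_congr rfl fun i _ => ?_
  · congr 1 <;> ring
  · congr 1 <;> ring

variable {halts : ℕ × ℕ → Prop} [DecidablePred halts]

theorem stoppedLeaves_succ {k n j : ℕ} (h : ¬ halts (n, j)) : stoppedLeaves halts (k + 1) n j =
    stoppedLeaves halts k (n + 1) (2 * j) ∪ stoppedLeaves halts k (n + 1) (2 * j + 1) := by
  rw [stoppedLeaves, if_neg h]

theorem exists_of_mem_stoppedLeaves {k n j : ℕ} {p : ℕ × ℕ} (hp : p ∈ stoppedLeaves halts k n j) :
    ∃ e ≤ k, p.1 = n + e ∧ p.2 / 2 ^ e = j := by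
  induction k generalizing n j with
  | zero =>
    rw [stoppedLeaves, Finset.mem_singleton] at hp
    subst hp
    exact ⟨0, le_rfl, rfl, by simp⟩
  | succ k ih =>
    rw [stoppedLeaves] at hp
    split_ifs at hp
    · rw [Finset.mem_singleton] at hp
      subst hp
      exact ⟨0, Nat.zero_le _, rfl, by simp⟩
    · rcases Finset.mem_union.1 hp with hp | hp <;> obtain ⟨e, he, h1, h2⟩ := ih hp <;>
        refine ⟨e + 1, by omega, by omega, ?_⟩ <;> rw [pow_succ, ← Nat.div_div_eq_div_mul, h2] <;> omega

theorem disjoint_stoppedLeaves (k n j : ℕ) : Disjoint (stoppedLeaves halts k (n + 1) (2 * j))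
    (stoppedLeaves halts k (n + 1) (2 * j + 1)) := by
  rw [Finset.disjoint_left]
  intro p hp hp'
  obtain ⟨e, -, h1, h2⟩ := exists_of_mem_stoppedLeaves hp
  obtain ⟨e', -, h1', h2'⟩ := exists_of_mem_stoppedLeaves hp'
  obtain rfl : e = e' := by omega
  omega

theorem snd_lt_of_mem_stoppedLeaves {k n j : ℕ} {p : ℕ × ℕ} (hj : j < 2 ^ n)
    (hp : p ∈ stoppedLeaves halts k n j) : p.2 < 2 ^ p.1 := by
  obtain ⟨e, -, h1, h2⟩ := exists_of_mem_stoppedLeaves hp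
  rw [h1, pow_add]
  rw [← h2] at hj
  exact (Nat.div_lt_iff_lt_mul (by positivity)).1 hj

/-- If every node of generation `n + k` is stopped, then all leaves are. -/
theorem halts_of_mem_stoppedLeaves {k n j : ℕ} {p : ℕ × ℕ} (hj : j < 2 ^ n)
    (hN : ∀ i < 2 ^ (n + k), halts (n + k, i)) (hp : p ∈ stoppedLeaves halts k n j) : halts p := by
  induction k generalizing n j with
  | zero =>
    rw [stoppedLeaves, Finset.mem_singleton] at hp
    subst hp
    exact hN j hj
  | succ k ih =>
    rw [stoppedLeaves] at hp
    split_ifs at hp with h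
    · rw [Finset.mem_singleton] at hp
      subst hp
      exact h
    · have hN' : ∀ i < 2 ^ (n + 1 + k), halts (n + 1 + k, i) := by
        rwa [add_right_comm, add_assoc]
      rcases Finset.mem_union.1 hp with hp | hp
      · exact ih (by rw [pow_succ]; omega) hN' hp
      · exact ih (by rw [pow_succ]; omega) hN' hp

theorem not_halts_parent_of_mem_stoppedLeaves {k n j : ℕ} {p : ℕ × ℕ}
    (hp : p ∈ stoppedLeaves halts k n j) :
    p = (n, j) ∨ ∃ m, p.1 = m + 1 ∧ ¬ halts (m, p.2 / 2) := by
  induction k generalizing n j with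
  | zero => exact Or.inl (Finset.mem_singleton.1 hp)
  | succ k ih =>
    rw [stoppedLeaves] at hp
    split_ifs at hp with h
    · exact Or.inl (Finset.mem_singleton.1 hp)
    · right
      rcases Finset.mem_union.1 hp with hp | hp <;> rcases ih hp with rfl | h'
      · exact ⟨n, rfl, by simpa using h⟩
      · exact h'
      · refine ⟨n, rfl, ?_⟩
        rwa [show (n + 1, 2 * j + 1).2 / 2 = j by dsimp only; omega]
      · exact h'

theorem sum_stoppedLeaves_eq {S : ℕ → ℕ → ℝ} {k n j : ℕ}
    (hS : ∀ m < n + k, ∀ i, S m i = S (m + 1) (2 * i) + S (m + 1) (2 * i + 1)) :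
    ∑ p ∈ stoppedLeaves halts k n j, S p.1 p.2 = S n j := by
  induction k generalizing n j with
  | zero => simp [stoppedLeaves]
  | succ k ih =>
    rw [stoppedLeaves]
    split_ifs with h
    · simp
    · rw [Finset.sum_union (disjoint_stoppedLeaves k n j), ih fun m hm => hS m (by omega),
        ih fun m hm => hS m (by omega), ← hS n (by omega)]

theorem sum_stoppedLeaves_weight (k n j : ℕ) :
    ∑ p ∈ stoppedLeaves halts k n j, (1 / 2 : ℝ) ^ p.1 = (1 / 2) ^ n :=
  sum_stoppedLeaves_eq (S := fun m _ => (1 / 2 : ℝ) ^ m) fun m _ i => by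
    rw [pow_succ]; ring

theorem sum_stoppedLeaves_abs_sub_le {Y t : ℕ → ℕ → ℝ}
    (ht : ∀ n j, |Y (n + 1) (2 * j) - Y n j| ≤ t n j ∧ |Y (n + 1) (2 * j + 1) - Y n j| ≤ t n j)
    (k n j : ℕ) :
    ∑ p ∈ stoppedLeaves halts k n j, (1 / 2 : ℝ) ^ p.1 * |Y p.1 p.2 - Y n j| ≤
      ∑ e ∈ Finset.range k, (1 / 2 : ℝ) ^ (n + e) * generationSum t e n j := by
  have ht0 : ∀ n j, 0 ≤ t n j := fun n j => (abs_nonneg _).trans (ht n j).1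
  induction k generalizing n j with
  | zero => simp [stoppedLeaves]
  | succ k ih =>
    rw [stoppedLeaves]
    split_ifs with h
    · rw [Finset.sum_singleton, sub_self, abs_zero, mul_zero]
      exact Finset.sum_nonneg fun e _ => mul_nonneg (by positivity)
        (Finset.sum_nonneg fun _ _ => ht0 _ _)
    · have key : ∀ i, |Y (n + 1) i - Y n j| ≤ t n j →
          ∑ p ∈ stoppedLeaves halts k (n + 1) i, (1 / 2 : ℝ) ^ p.1 * |Y p.1 p.2 - Y n j| ≤
          (∑ e ∈ Finset.range k, (1 / 2 : ℝ) ^ (n + 1 + e) * generationSum t e (n + 1) i) +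
            (1 / 2) ^ (n + 1) * t n j := by
        intro i hi
        refine le_trans ?_ (add_le_add_left (ih (n + 1) i) _)
        rw [← sum_stoppedLeaves_weight (halts := halts) k (n + 1) i, Finset.sum_mul,
          ← Finset.sum_add_distrib]
        refine Finset.sum_le_sum fun p _ => ?_
        rw [← mul_add]
        gcongr
        refine (abs_sub_le _ (Y (n + 1) i) _).trans ?_
        gcongr
      rw [Finset.sum_union (disjoint_stoppedLeaves k n j), Finset.sum_range_succ']
      refine (add_le_add (key _ (ht n j).1) (key _ (ht n j).2)).trans (le_of_eq ?_)
      simp only [generationSum_zero, generationSum_succ, mul_add, Finset.sum_add_distrib, add_zero]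
      simp only [add_assoc, add_comm 1]
      rw [pow_succ]
      ring

end DyadicTree

section ConformalTree

/-- The properties of the images `q n j` of the dyadic points of a half-plane under a covering map
onto `Ω`, and of the quantities `d n j` comparable to the distance to the complement, which are
used below. -/
structure IsConformalTree (Ω : Set ℂ) (K : ℝ) (q : ℕ → ℕ → ℂ) (d : ℕ → ℕ → ℝ) : Prop where
  one_le : 1 ≤ K
  mem : ∀ n j, q n j ∈ Ω
  pos : ∀ n j, 0 < d n j
  le_infDist : ∀ n j, d n j ≤ K * infDist (q n j) Ωᶜ
  infDist_le : ∀ n j, infDist (q n j) Ωᶜ ≤ K * d n j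
  le_child : ∀ n i, d n (i / 2) ≤ K * d (n + 1) i
  dist_child : ∀ n i, dist (q (n + 1) i) (q n (i / 2)) ≤ K * d n (i / 2)
  disjoint : ∀ p p' : ℕ × ℕ, p ≠ p' → p.2 < 2 ^ p.1 → p'.2 < 2 ^ p'.1 →
    Disjoint (ball (q p.1 p.2) (d p.1 p.2 / K)) (ball (q p'.1 p'.2) (d p'.1 p'.2 / K))
  exists_log : ∀ N, ∃ S : ℕ → ℕ → ℝ,
    (∀ n < N, ∀ j, S n j = S (n + 1) (2 * j) + S (n + 1) (2 * j + 1)) ∧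
    ∀ n ≤ N, ∀ j, |S n j - (1 / 2) ^ n * Real.log (d n j * 2 ^ n)| ≤ K * (1 / 2) ^ n

/-- A finite family of nodes of size comparable to `ε * (r ^ 2 + dist q b ^ 2)`. -/
structure IsBalanced (q : ℕ → ℕ → ℂ) (d : ℕ → ℕ → ℝ) (c : ℝ) (b : ℂ) (r ε : ℝ)
    (s : Finset (ℕ × ℕ)) : Prop where
  lt : ∀ p ∈ s, p.2 < 2 ^ p.1
  low : ∀ p ∈ s, c * (ε * (r ^ 2 + dist (q p.1 p.2) b ^ 2)) ≤ d p.1 p.2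
  up : ∀ p ∈ s, d p.1 p.2 ≤ ε * (r ^ 2 + dist (q p.1 p.2) b ^ 2)

theorem IsBalanced.mono {q : ℕ → ℕ → ℂ} {d : ℕ → ℕ → ℝ} {c : ℝ} {b : ℂ} {r ε : ℝ}
    {s t : Finset (ℕ × ℕ)} (h : IsBalanced q d c b r ε t) (hst : s ⊆ t) :
    IsBalanced q d c b r ε s :=
  ⟨fun p hp => h.lt p (hst hp), fun p hp => h.low p (hst hp), fun p hp => h.up p (hst hp)⟩

theorem sum_sq_le_of_disjoint_balls {ι : Type*} (s : Finset ι) {x : ι → ℂ} {ρ : ι → ℝ} {a : ℂ}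
    {R : ℝ} (hR : 0 ≤ R) (hρ : ∀ i ∈ s, 0 ≤ ρ i)
    (hd : ∀ i ∈ s, ∀ j ∈ s, i ≠ j → Disjoint (ball (x i) (ρ i)) (ball (x j) (ρ j)))
    (hsub : ∀ i ∈ s, ball (x i) (ρ i) ⊆ ball a R) : ∑ i ∈ s, ρ i ^ 2 ≤ R ^ 2 := by
  have h1 : ∑ i ∈ s, volume (ball (x i) (ρ i)) ≤ volume (ball a R) := by
    rw [← measure_biUnion_finset (fun i hi j hj hij => hd i hi j hj hij)
      fun i _ => measurableSet_ball]
    exact measure_mono (iUnion₂_subset hsub)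
  simp only [Complex.volume_ball] at h1
  rw [← Finset.sum_mul] at h1
  have h2 := (ENNReal.mul_le_mul_iff_left (by simp [NNReal.pi_pos.ne']) (by simp)).1 h1
  rw [← ENNReal.ofReal_pow hR, Finset.sum_congr rfl fun i hi => (ENNReal.ofReal_pow (hρ i hi) 2).symm,
    ← ENNReal.ofReal_sum_of_nonneg fun i hi => sq_nonneg _,
    ENNReal.ofReal_le_ofReal_iff (sq_nonneg _)] at h2
  exact h2

variable {Ω : Set ℂ} {K : ℝ} {q : ℕ → ℕ → ℂ} {d : ℕ → ℕ → ℝ}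

namespace IsConformalTree

theorem K_pos (h : IsConformalTree Ω K q d) : 0 < K := one_pos.trans_le h.one_le

theorem le_dist (h : IsConformalTree Ω K q d) {a : ℂ} (ha : a ∉ Ω) (n j : ℕ) :
    d n j ≤ K * dist (q n j) a :=
  (h.le_infDist n j).trans (mul_le_mul_of_nonneg_left (infDist_le_dist_of_mem ha) h.K_pos.le)

theorem dist_node_pos (h : IsConformalTree Ω K q d) {a : ℂ} (ha : a ∉ Ω) (n j : ℕ) :
    0 < dist (q n j) a := dist_pos.2 fun e => ha (e ▸ h.mem n j)

theorem sum_sq_le (h : IsConformalTree Ω K q d) (s : Finset (ℕ × ℕ)) (hs : ∀ p ∈ s, p.2 < 2 ^ p.1)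
    {a : ℂ} {R : ℝ} (hR : 0 ≤ R)
    (hsub : ∀ p ∈ s, dist (q p.1 p.2) a + d p.1 p.2 / K ≤ R) :
    ∑ p ∈ s, d p.1 p.2 ^ 2 ≤ K ^ 2 * R ^ 2 := by
  have := sum_sq_le_of_disjoint_balls s (x := fun p => q p.1 p.2) (ρ := fun p => d p.1 p.2 / K)
    (a := a) hR (fun p _ => div_nonneg (h.pos _ _).le h.K_pos.le)
    (fun p hp p' hp' hne => h.disjoint p p' hne (hs p hp) (hs p' hp'))
    (fun p hp => ball_subset_ball' (by linarith [hsub p hp]))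
  simp only [div_pow] at this
  rw [← Finset.sum_div, div_le_iff₀ (pow_pos h.K_pos 2)] at this
  linarith

/-- Nodes of comparable size near a given point are boundedly many. -/
theorem card_le_of_comparable (h : IsConformalTree Ω K q d) (s : Finset (ℕ × ℕ))
    (hs : ∀ p ∈ s, p.2 < 2 ^ p.1) {x : ℂ} {A B : ℝ} (hA : 0 < A) (hB : 0 ≤ B)
    (hlow : ∀ p ∈ s, A ≤ d p.1 p.2)
    (hup : ∀ p ∈ s, d p.1 p.2 ≤ B * A) (hx : ∀ p ∈ s, dist (q p.1 p.2) x ≤ 2 * K * d p.1 p.2) :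
    (s.card : ℝ) ≤ K ^ 2 * (3 * K * B) ^ 2 := by
  have hK := h.one_le
  have h1 := h.sum_sq_le s hs (a := x) (R := 3 * K * (B * A)) (by positivity) (fun p hp => by
    have h2 := hup p hp
    have h3 : d p.1 p.2 / K ≤ K * d p.1 p.2 := by
      rw [div_le_iff₀ h.K_pos]
      nlinarith [h.pos p.1 p.2, mul_le_mul hK hK zero_le_one h.K_pos.le]
    calc _ ≤ 2 * K * d p.1 p.2 + K * d p.1 p.2 := add_le_add (hx p hp) h3
      _ = 3 * K * d p.1 p.2 := by ring
      _ ≤ _ := by gcongr)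
  have h2 : s.card * A ^ 2 ≤ ∑ p ∈ s, d p.1 p.2 ^ 2 := by
    rw [← nsmul_eq_mul]
    exact Finset.card_nsmul_le_sum _ _ _ fun p hp => by
      have := hlow p hp
      gcongr
  have h3 : (s.card : ℝ) * A ^ 2 ≤ (K ^ 2 * (3 * K * B) ^ 2) * A ^ 2 := by
    refine (h2.trans h1).trans (le_of_eq (by ring))
  exact le_of_mul_le_mul_right h3 (by positivity)

/-- Nodes whose size is comparable to `ε * (r ^ 2 + dist q b ^ 2)` have bounded overlap. -/
theorem exists_card_le (h : IsConformalTree Ω K q d) {c : ℝ} (hc : 0 < c) : ∃ B : ℝ, 0 < B ∧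
    ∀ b ∉ Ω, ∀ r ε : ℝ, 0 < r → 0 < ε → ∀ s : Finset (ℕ × ℕ), IsBalanced q d c b r ε s → ∀ x : ℂ,
    (∀ p ∈ s, dist (q p.1 p.2) x ≤ 2 * K * d p.1 p.2) → (s.card : ℝ) ≤ B := by
  classical
  set η := 1 / (4 * K) with hη
  refine ⟨K ^ 2 * (3 * K * (2 / c)) ^ 2 + K ^ 2 * (3 * K * (2 * K ^ 2 / (c * η ^ 2))) ^ 2 +
    K ^ 2 * (3 * K * (18 / c)) ^ 2 + 1, by positivity, ?_⟩
  intro b hb r ε hr hε s ⟨hs, hlow, hup⟩ x hx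
  have hK := h.K_pos
  have hη0 : 0 < η := by positivity
  set s₁ := s.filter fun p => dist (q p.1 p.2) b ≤ r with hs₁
  set s₂ := s.filter fun p => r < dist (q p.1 p.2) b ∧ η * dist (q p.1 p.2) b ≤ d p.1 p.2 with hs₂
  set s₃ := s.filter fun p => r < dist (q p.1 p.2) b ∧ d p.1 p.2 < η * dist (q p.1 p.2) b with hs₃
  have hcard : s.card ≤ s₁.card + s₂.card + s₃.card := by
    have : s ⊆ s₁ ∪ s₂ ∪ s₃ := by
      intro p hp
      simp only [hs₁, hs₂, hs₃, Finset.mem_union, Finset.mem_filter, hp, true_and]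
      rcases le_or_gt (dist (q p.1 p.2) b) r with h1 | h1
      · exact Or.inl (Or.inl h1)
      · rcases le_or_gt (η * dist (q p.1 p.2) b) (d p.1 p.2) with h2 | h2
        · exact Or.inl (Or.inr ⟨h1, h2⟩)
        · exact Or.inr ⟨h1, h2⟩
    refine (Finset.card_le_card this).trans ((Finset.card_union_le _ _).trans ?_)
    gcongr
    exact Finset.card_union_le _ _
  have e₁ : (s₁.card : ℝ) ≤ K ^ 2 * (3 * K * (2 / c)) ^ 2 := by
    refine h.card_le_of_comparable s₁ (fun p hp => hs p (Finset.mem_filter.1 hp).1) (x := x)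
      (A := c * (ε * r ^ 2)) (by positivity) (by positivity) ?_ ?_
      (fun p hp => hx p (Finset.mem_filter.1 hp).1) <;> intro p hp <;>
      obtain ⟨hps, h1⟩ := Finset.mem_filter.1 hp
    · refine le_trans ?_ (hlow p hps)
      gcongr
      exact le_add_of_nonneg_right (sq_nonneg _)
    · refine (hup p hps).trans ?_
      have : dist (q p.1 p.2) b ^ 2 ≤ r ^ 2 := by gcongr
      calc ε * (r ^ 2 + dist (q p.1 p.2) b ^ 2) ≤ ε * (r ^ 2 + r ^ 2) := by gcongr
        _ = _ := by field_simp; ring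
  have e₂ : (s₂.card : ℝ) ≤ K ^ 2 * (3 * K * (2 * K ^ 2 / (c * η ^ 2))) ^ 2 := by
    refine h.card_le_of_comparable s₂ (fun p hp => hs p (Finset.mem_filter.1 hp).1) (x := x)
      (A := η * (η / (2 * ε))) (by positivity) (by positivity) ?_ ?_
      (fun p hp => hx p (Finset.mem_filter.1 hp).1) <;> intro p hp <;>
      obtain ⟨hps, h1, h2⟩ := Finset.mem_filter.1 hp
    all_goals
      have hqb := h.dist_node_pos hb p.1 p.2
      have h3 : r ^ 2 ≤ dist (q p.1 p.2) b ^ 2 := by gcongr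
    · refine le_trans ?_ h2
      gcongr
      rw [div_le_iff₀ (by positivity)]
      have h4 : η * dist (q p.1 p.2) b ≤ (dist (q p.1 p.2) b * (2 * ε)) * dist (q p.1 p.2) b := by
        refine h2.trans ((hup p hps).trans ?_)
        nlinarith
      exact le_of_mul_le_mul_right h4 hqb
    · have h5 := h.le_dist hb p.1 p.2
      have h4 : (c * ε * dist (q p.1 p.2) b) * dist (q p.1 p.2) b ≤ K * dist (q p.1 p.2) b := by
        refine le_trans ?_ ((hlow p hps).trans h5)
        have : 0 ≤ c * ε * r ^ 2 := by positivity
        nlinarith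
      have h6 : dist (q p.1 p.2) b ≤ K / (c * ε) := by
        rw [le_div_iff₀ (by positivity)]
        linarith [le_of_mul_le_mul_right h4 hqb]
      calc d p.1 p.2 ≤ K * (K / (c * ε)) := h5.trans (by gcongr)
        _ = _ := by field_simp
  have e₃ : (s₃.card : ℝ) ≤ K ^ 2 * (3 * K * (18 / c)) ^ 2 := by
    rcases s₃.eq_empty_or_nonempty with he | ⟨p₀, hp₀⟩
    · rw [he, Finset.card_empty, Nat.cast_zero]
      positivity
    have key : ∀ p ∈ s₃, 2 * dist x b ≤ 3 * dist (q p.1 p.2) b ∧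
        dist (q p.1 p.2) b ≤ 2 * dist x b := by
      intro p hp
      obtain ⟨hps, h1, h2⟩ := Finset.mem_filter.1 hp
      have h3 := hx p hps
      have h4 : 2 * K * d p.1 p.2 ≤ dist (q p.1 p.2) b / 2 := by
        calc 2 * K * d p.1 p.2 ≤ 2 * K * (η * dist (q p.1 p.2) b) := by gcongr
          _ = _ := by rw [hη]; field_simp; norm_num
      constructor <;> linarith [dist_triangle_left x b (q p.1 p.2), dist_triangle (q p.1 p.2) x b]
    have hxb : 0 < dist x b := by
      linarith [(key p₀ hp₀).2, h.dist_node_pos hb p₀.1 p₀.2]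
    refine h.card_le_of_comparable s₃ (fun p hp => hs p (Finset.mem_filter.1 hp).1) (x := x)
      (A := c * (ε * (2 / 3 * dist x b) ^ 2)) (by positivity) (by positivity) ?_ ?_
      (fun p hp => hx p (Finset.mem_filter.1 hp).1) <;> intro p hp <;>
      obtain ⟨hps, h1, h2⟩ := Finset.mem_filter.1 hp <;> obtain ⟨k1, k2⟩ := key p hp
    · refine le_trans ?_ (hlow p hps)
      have h3 : (2 / 3 * dist x b) ^ 2 ≤ dist (q p.1 p.2) b ^ 2 := by
        gcongr
        linarith
      gcongr
      linarith [sq_nonneg r]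
    · refine (hup p hps).trans ?_
      have h3 : r ^ 2 ≤ dist (q p.1 p.2) b ^ 2 := by gcongr
      have h4 : dist (q p.1 p.2) b ^ 2 ≤ (2 * dist x b) ^ 2 := by gcongr
      calc ε * (r ^ 2 + dist (q p.1 p.2) b ^ 2) ≤
          ε * ((2 * dist x b) ^ 2 + (2 * dist x b) ^ 2) := by gcongr; linarith
        _ = _ := by field_simp; ring
  have : (s.card : ℝ) ≤ s₁.card + s₂.card + s₃.card := by exact_mod_cast hcard
  linarith

end IsConformalTree

end ConformalTree

section ConformalTree

theorem exists_mem_frontier_dist_eq_infDist {Ω : Set ℂ} (hΩ : IsOpen Ω) (hne : Ω ≠ univ) {z : ℂ}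
    (hz : z ∈ Ω) : ∃ p ∈ frontier Ω, dist z p = infDist z Ωᶜ := by
  obtain ⟨p, hp, hpz⟩ := hΩ.isClosed_compl.exists_infDist_eq_dist (nonempty_compl.2 hne) z
  refine ⟨p, ?_, hpz.symm⟩
  have hzp : dist z p ≠ 0 := dist_ne_zero.2 fun e => hp (e ▸ hz)
  rw [hΩ.frontier_eq]
  refine ⟨?_, hp⟩
  have h1 : ball z (dist z p) ⊆ Ω := by
    rw [← hpz]
    exact ball_infDist_compl_subset
  refine closure_mono h1 ?_
  rw [closure_ball _ hzp, mem_closedBall, dist_comm]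

variable {Ω : Set ℂ} {K : ℝ} {q : ℕ → ℕ → ℂ} {d : ℕ → ℕ → ℝ}

namespace IsConformalTree

/-- The sizes of the nodes of a balanced family in a disk sum up to at most the radius. -/
theorem exists_sum_le (h : IsConformalTree Ω K q d) (hΩ : IsOpen Ω) (hne : Ω ≠ univ) {CA : ℝ}
    (hCA : 0 < CA) (hA : ∀ z : ℂ, ∀ r : ℝ, 0 < r →
      μH[1] (frontier Ω ∩ ball z r) ≤ ENNReal.ofReal (CA * r))
    (hH : ∀ z ∈ Ω, ∀ p ∈ frontier Ω, dist z p = infDist z Ωᶜ →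
      ENNReal.ofReal (dist z p) ≤ μH[1] (frontier Ω ∩ ball p (dist z p)))
    {c : ℝ} (hc : 0 < c) : ∃ B : ℝ, 0 < B ∧
    ∀ b ∉ Ω, ∀ r ε : ℝ, 0 < r → 0 < ε → ∀ s : Finset (ℕ × ℕ), IsBalanced q d c b r ε s →
    ∀ a ∉ Ω, ∀ ρ : ℝ, 0 < ρ →
      ∑ p ∈ s with dist (q p.1 p.2) a < ρ, d p.1 p.2 ≤ B * ρ := by
  classical
  obtain ⟨B, hB, hcard⟩ := h.exists_card_le hc
  have hK := h.K_pos
  refine ⟨K * (B * (CA * 3)), by positivity, ?_⟩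
  intro b hb r ε hr hε s hs a ha ρ hρ
  set t := s.filter fun p => dist (q p.1 p.2) a < ρ with ht
  choose P hPf hPd using fun p : ℕ × ℕ => exists_mem_frontier_dist_eq_infDist hΩ hne (h.mem p.1 p.2)
  set δ : ℕ × ℕ → ℝ := fun p => dist (q p.1 p.2) (P p) with hδ
  set m : Measure ℂ := (μH[1] : Measure ℂ).restrict (frontier Ω) with hm
  have hδ0 : ∀ p, 0 ≤ δ p := fun p => dist_nonneg
  have h1 : ∀ p, ENNReal.ofReal (δ p) ≤ ∫⁻ x, (ball (P p) (δ p)).indicator 1 x ∂m := by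
    intro p
    rw [lintegral_indicator_one measurableSet_ball, hm, Measure.restrict_apply measurableSet_ball,
      inter_comm]
    exact hH _ (h.mem _ _) _ (hPf p) (hPd p)
  have h2 : ∀ x, ∑ p ∈ t, (ball (P p) (δ p)).indicator (1 : ℂ → ℝ≥0∞) x ≤
      (ball a (3 * ρ)).indicator (fun _ => ENNReal.ofReal B) x := by
    intro x
    have hsum : ∑ p ∈ t, (ball (P p) (δ p)).indicator (1 : ℂ → ℝ≥0∞) x =
        ((t.filter fun p => x ∈ ball (P p) (δ p)).card : ℝ≥0∞) := by
      rw [Finset.card_filter, Nat.cast_sum]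
      refine Finset.sum_congr rfl fun p _ => ?_
      by_cases hx : x ∈ ball (P p) (δ p) <;> simp [hx]
    rw [hsum]
    by_cases hx : x ∈ ball a (3 * ρ)
    · rw [indicator_of_mem hx, ← ENNReal.ofReal_natCast]
      refine ENNReal.ofReal_le_ofReal ?_
      refine hcard b hb r ε hr hε _
        (hs.mono ((Finset.filter_subset _ _).trans (Finset.filter_subset _ _))) x ?_
      intro p hp
      have hp' := (Finset.mem_filter.1 hp).2
      rw [mem_ball] at hp'
      have h3 : δ p ≤ K * d p.1 p.2 := by
        rw [hδ]
        dsimp only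
        rw [hPd]
        exact h.infDist_le _ _
      have h4 := dist_triangle_right (q p.1 p.2) x (P p)
      change dist (q p.1 p.2) x ≤ δ p + _ at h4
      linarith
    · rw [indicator_of_notMem hx]
      rw [Finset.filter_eq_empty_iff.2, Finset.card_empty, Nat.cast_zero]
      intro p hp hxp
      apply hx
      have hpa := (Finset.mem_filter.1 hp).2
      have h3 : δ p ≤ dist (q p.1 p.2) a := by
        rw [hδ]
        dsimp only
        rw [hPd]
        exact infDist_le_dist_of_mem ha
      rw [mem_ball] at hxp ⊢
      have h4 := dist_triangle4 x (P p) (q p.1 p.2) a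
      rw [dist_comm (P p)] at h4
      change _ ≤ _ + δ p + _ at h4
      linarith
  have h3 : ENNReal.ofReal (∑ p ∈ t, δ p) ≤ ENNReal.ofReal (B * (CA * (3 * ρ))) := by
    calc ENNReal.ofReal (∑ p ∈ t, δ p) = ∑ p ∈ t, ENNReal.ofReal (δ p) :=
          ENNReal.ofReal_sum_of_nonneg fun p _ => hδ0 p
      _ ≤ ∑ p ∈ t, ∫⁻ x, (ball (P p) (δ p)).indicator 1 x ∂m := Finset.sum_le_sum fun p _ => h1 p
      _ = ∫⁻ x, ∑ p ∈ t, (ball (P p) (δ p)).indicator 1 x ∂m :=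
          (lintegral_finsetSum _ fun p _ => measurable_one.indicator measurableSet_ball).symm
      _ ≤ ∫⁻ x, (ball a (3 * ρ)).indicator (fun _ => ENNReal.ofReal B) x ∂m := lintegral_mono h2
      _ = ENNReal.ofReal B * μH[1] (frontier Ω ∩ ball a (3 * ρ)) := by
          rw [lintegral_indicator_const measurableSet_ball, hm,
            Measure.restrict_apply measurableSet_ball, inter_comm]
      _ ≤ ENNReal.ofReal B * ENNReal.ofReal (CA * (3 * ρ)) := by
          gcongr
          exact hA a _ (by positivity)
      _ = _ := (ENNReal.ofReal_mul hB.le).symm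
  rw [ENNReal.ofReal_le_ofReal_iff (by positivity)] at h3
  calc ∑ p ∈ t, d p.1 p.2 ≤ ∑ p ∈ t, K * δ p := by
        refine Finset.sum_le_sum fun p _ => ?_
        rw [hδ]
        dsimp only
        rw [hPd]
        exact h.le_infDist _ _
    _ = K * ∑ p ∈ t, δ p := (Finset.mul_sum _ _ _).symm
    _ ≤ K * (B * (CA * (3 * ρ))) := by gcongr
    _ = _ := by ring

end IsConformalTree

theorem inv_one_add_sq_le_sum {y : ℝ} (hy : 0 ≤ y) {M : ℕ} (hM : y < 2 ^ M) :
    ((1 + y) ^ 2)⁻¹ ≤ ∑ k ∈ Finset.range (M + 1), if y < 2 ^ k then 4 * (1 / 4 : ℝ) ^ k else 0 := by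
  classical
  have hex : ∃ k : ℕ, y < 2 ^ k := ⟨M, hM⟩
  set k := Nat.find hex with hk
  have hk1 : y < 2 ^ k := Nat.find_spec hex
  have hkM : k ≤ M := Nat.find_min' hex hM
  have hterm : ((1 + y) ^ 2)⁻¹ ≤ if y < 2 ^ k then 4 * (1 / 4 : ℝ) ^ k else 0 := by
    rw [if_pos hk1]
    rcases Nat.eq_zero_or_pos k with h0 | h0
    · rw [h0, pow_zero, mul_one]
      exact (inv_le_one_of_one_le₀ (one_le_pow₀ (by linarith))).trans (by norm_num)
    · obtain ⟨l, hl⟩ : ∃ l, k = l + 1 := ⟨k - 1, by omega⟩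
      have h2 : ¬ y < 2 ^ l := Nat.find_min hex (by omega)
      rw [not_lt] at h2
      have h3 : (4 : ℝ) * (1 / 4) ^ (l + 1) = (4 ^ l)⁻¹ := by
        rw [one_div, inv_pow, pow_succ]
        field_simp
      rw [hl, h3]
      refine inv_anti₀ (by positivity) ?_
      calc (4 : ℝ) ^ l = (2 ^ l) ^ 2 := by rw [← pow_mul, mul_comm, pow_mul]; norm_num
        _ ≤ (1 + y) ^ 2 := by gcongr; linarith
  refine hterm.trans (Finset.single_le_sum (f := fun k => if y < 2 ^ k then 4 * (1 / 4 : ℝ) ^ k else 0)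
    (fun i _ => ?_) (Finset.mem_range.2 (by omega)))
  split_ifs <;> positivity

/-- A sum with linear growth on balls, weighted by an inverse square. -/
theorem sum_mul_inv_one_add_sq_le {ι : Type*} (s : Finset ι) {d y : ι → ℝ} {B D : ℝ} (hD : 0 < D)
    (hB : 0 ≤ B) (hd : ∀ i ∈ s, 0 ≤ d i) (hy : ∀ i ∈ s, 0 ≤ y i)
    (h : ∀ ρ : ℝ, 0 < ρ → ∑ i ∈ s with y i < ρ, d i ≤ B * ρ) :
    ∑ i ∈ s, d i * ((1 + y i / D) ^ 2)⁻¹ ≤ 8 * B * D := by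
  obtain ⟨M, hM⟩ : ∃ M : ℕ, ∀ i ∈ s, y i / D < 2 ^ M := by
    obtain ⟨M, hM⟩ := pow_unbounded_of_one_lt (∑ i ∈ s, y i / D) (one_lt_two : (1 : ℝ) < 2)
    refine ⟨M, fun i hi => lt_of_le_of_lt ?_ hM⟩
    exact Finset.single_le_sum (f := fun i => y i / D) (fun i hi => div_nonneg (hy i hi) hD.le) hi
  calc ∑ i ∈ s, d i * ((1 + y i / D) ^ 2)⁻¹
      ≤ ∑ i ∈ s, d i * ∑ k ∈ Finset.range (M + 1),
          if y i / D < 2 ^ k then 4 * (1 / 4 : ℝ) ^ k else 0 := by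
        refine Finset.sum_le_sum fun i hi => mul_le_mul_of_nonneg_left ?_ (hd i hi)
        exact inv_one_add_sq_le_sum (div_nonneg (hy i hi) hD.le) (hM i hi)
    _ = ∑ k ∈ Finset.range (M + 1), 4 * (1 / 4 : ℝ) ^ k * ∑ i ∈ s with y i < 2 ^ k * D, d i := by
        simp only [Finset.mul_sum]
        rw [Finset.sum_comm]
        refine Finset.sum_congr rfl fun k _ => ?_
        rw [Finset.sum_filter]
        refine Finset.sum_congr rfl fun i _ => ?_
        simp only [div_lt_iff₀ hD]
        split_ifs <;> ring
    _ ≤ ∑ k ∈ Finset.range (M + 1), 4 * (1 / 4 : ℝ) ^ k * (B * (2 ^ k * D)) := by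
        gcongr with k _
        exact h _ (by positivity)
    _ = 4 * B * D * ∑ k ∈ Finset.range (M + 1), (1 / 2 : ℝ) ^ k := by
        rw [Finset.mul_sum]
        refine Finset.sum_congr rfl fun k _ => ?_
        have : (1 / 4 : ℝ) ^ k * 2 ^ k = (1 / 2) ^ k := by rw [← mul_pow]; norm_num
        rw [← this]
        ring
    _ ≤ 4 * B * D * 2 := by
        gcongr
        exact sum_geometric_two_le _
    _ = _ := by ring

end ConformalTree

section GenerationSum

theorem sum_generationSum_le {τ : ℕ → ℕ → ℝ} {n j : ℕ} {C : ℝ} (hC : 0 ≤ C)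
    (h : ∀ e, generationSum (fun n j => τ n j ^ 2) e n j ≤ C * (e + 1)) (k : ℕ) :
    ∑ e ∈ Finset.range k, (1 / 2 : ℝ) ^ (n + e) * generationSum τ e n j ≤
      (7 * C + 4) * (1 / 2) ^ n := by
  have hlin : ∀ e : ℕ, (e : ℝ) + 1 ≤ 2 * (3 / 2) ^ e := by
    intro e
    have := one_add_mul_le_pow (a := (1 / 2 : ℝ)) (by norm_num) e
    norm_num at this ⊢
    linarith
  have hterm : ∀ e, (1 / 2 : ℝ) ^ (n + e) * generationSum τ e n j ≤
      (1 / 2) ^ n * (C * (6 / 7) ^ e + (1 / 2) * (7 / 8) ^ e) := by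
    intro e
    have h1 : generationSum τ e n j ≤
        1 / 2 * ((8 / 7) ^ e * (C * (e + 1)) + 2 ^ e * (7 / 8) ^ e) := by
      calc generationSum τ e n j ≤ ∑ i ∈ Finset.range (2 ^ e),
            1 / 2 * ((8 / 7) ^ e * τ (n + e) (j * 2 ^ e + i) ^ 2 + (7 / 8) ^ e) := by
            refine Finset.sum_le_sum fun i _ => ?_
            have h2 : (8 / 7 : ℝ) ^ e * (7 / 8) ^ e = 1 := by
              rw [← mul_pow]
              norm_num
            have h3 : (0 : ℝ) < (8 / 7) ^ e := by positivity
            set x : ℝ := (8 / 7) ^ e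
            set y : ℝ := (7 / 8) ^ e
            set z := τ (n + e) (j * 2 ^ e + i)
            have h4 : 0 ≤ x * (z - y) ^ 2 := by positivity
            have h5 : x * (z - y) ^ 2 = x * z ^ 2 - 2 * z * (x * y) + (x * y) * y := by ring
            rw [h2] at h5
            linarith
        _ = 1 / 2 * ((8 / 7) ^ e * generationSum (fun n j => τ n j ^ 2) e n j +
              2 ^ e * (7 / 8) ^ e) := by
            rw [← Finset.mul_sum, Finset.sum_add_distrib, ← Finset.mul_sum, Finset.sum_const,
              Finset.card_range, nsmul_eq_mul]
            push_cast
            rfl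
        _ ≤ _ := by
            gcongr
            exact h e
    have e1 : (1 / 2 : ℝ) ^ e * ((8 / 7) ^ e * (3 / 2) ^ e) = (6 / 7) ^ e := by
      rw [← mul_pow, ← mul_pow]
      norm_num
    have e2 : (1 / 2 : ℝ) ^ e * 2 ^ e = 1 := by
      rw [← mul_pow]
      norm_num
    calc (1 / 2 : ℝ) ^ (n + e) * generationSum τ e n j ≤ (1 / 2 : ℝ) ^ (n + e) *
          (1 / 2 * ((8 / 7) ^ e * (C * (2 * (3 / 2) ^ e)) + 2 ^ e * (7 / 8) ^ e)) := by
          refine mul_le_mul_of_nonneg_left (h1.trans ?_) (by positivity)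
          gcongr
          exact hlin e
      _ = (1 / 2) ^ n * (C * ((1 / 2 : ℝ) ^ e * ((8 / 7) ^ e * (3 / 2) ^ e)) +
            (1 / 2) * (((1 / 2 : ℝ) ^ e * 2 ^ e) * (7 / 8) ^ e)) := by
          rw [pow_add]
          ring
      _ = _ := by rw [e1, e2, one_mul]
  have g1 : ∑ e ∈ Finset.range k, (6 / 7 : ℝ) ^ e ≤ 7 := by
    have h0 : (0 : ℝ) ≤ (6 / 7) ^ k := by positivity
    rw [geom_sum_eq (by norm_num), div_le_iff_of_neg (by norm_num)]
    linarith
  have g2 : ∑ e ∈ Finset.range k, (7 / 8 : ℝ) ^ e ≤ 8 := by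
    have h0 : (0 : ℝ) ≤ (7 / 8) ^ k := by positivity
    rw [geom_sum_eq (by norm_num), div_le_iff_of_neg (by norm_num)]
    linarith
  calc _ ≤ ∑ e ∈ Finset.range k, (1 / 2 : ℝ) ^ n * (C * (6 / 7) ^ e + (1 / 2) * (7 / 8) ^ e) :=
        Finset.sum_le_sum fun e _ => hterm e
    _ = (1 / 2 : ℝ) ^ n * (C * ∑ e ∈ Finset.range k, (6 / 7 : ℝ) ^ e +
          1 / 2 * ∑ e ∈ Finset.range k, (7 / 8 : ℝ) ^ e) := by
        rw [← Finset.mul_sum, Finset.sum_add_distrib, ← Finset.mul_sum, ← Finset.mul_sum]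
    _ ≤ (1 / 2 : ℝ) ^ n * (C * 7 + 1 / 2 * 8) := by gcongr
    _ = _ := by ring

end GenerationSum

section ConformalTree

variable {Ω : Set ℂ} {K : ℝ} {q : ℕ → ℕ → ℂ} {d : ℕ → ℕ → ℝ}

namespace IsConformalTree

theorem dist_parent_le (h : IsConformalTree Ω K q d) {a : ℂ} (ha : a ∉ Ω) (n i : ℕ) :
    dist (q n (i / 2)) a ≤ (1 + K ^ 3) * dist (q (n + 1) i) a := by
  have hK := h.K_pos
  have h1 := dist_triangle_left (q n (i / 2)) a (q (n + 1) i)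
  have h2 := h.dist_child n i
  have h3 : K * d n (i / 2) ≤ K * (K * (K * dist (q (n + 1) i) a)) := by
    gcongr
    exact (h.le_child n i).trans (by gcongr; exact h.le_dist ha _ _)
  linarith

theorem abs_log_dist_sub_le (h : IsConformalTree Ω K q d) {a : ℂ} (ha : a ∉ Ω) (n i : ℕ) :
    |Real.log (dist (q (n + 1) i) a) - Real.log (dist (q n (i / 2)) a)| ≤
      K * (1 + K ^ 3) * (d n (i / 2) / dist (q n (i / 2)) a) := by
  have hK := h.K_pos
  have hx := h.dist_node_pos ha (n + 1) i
  have hy := h.dist_node_pos ha n (i / 2)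
  have hd := h.pos n (i / 2)
  have h2 := h.dist_child n i
  rw [abs_le]
  constructor
  · have h1 : Real.log (dist (q n (i / 2)) a) - Real.log (dist (q (n + 1) i) a) ≤
        K * d n (i / 2) / dist (q (n + 1) i) a := by
      rw [← Real.log_div hy.ne' hx.ne']
      refine (Real.log_le_sub_one_of_pos (div_pos hy hx)).trans ?_
      rw [div_sub_one hx.ne']
      gcongr
      linarith [dist_triangle_left (q n (i / 2)) a (q (n + 1) i)]
    have h3 : K * d n (i / 2) / dist (q (n + 1) i) a ≤
        K * (1 + K ^ 3) * (d n (i / 2) / dist (q n (i / 2)) a) := by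
      rw [div_le_iff₀ hx, mul_assoc, mul_assoc K]
      gcongr
      rw [← mul_assoc, mul_comm _ (d n _ / _), mul_assoc, div_mul_eq_mul_div, le_div_iff₀ hy]
      gcongr
      exact h.dist_parent_le ha n i
    linarith
  · rw [← Real.log_div hx.ne' hy.ne']
    refine (Real.log_le_sub_one_of_pos (div_pos hx hy)).trans ?_
    rw [div_sub_one hy.ne', ← mul_div_assoc]
    gcongr
    have h1 := dist_triangle (q (n + 1) i) (q n (i / 2)) a
    have : 0 ≤ K * K ^ 3 * d n (i / 2) := by positivity
    nlinarith

theorem div_dist_le (h : IsConformalTree Ω K q d) {a : ℂ} (ha : a ∉ Ω) (n j : ℕ) :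
    d n j / dist (q n j) a ≤ K := (div_le_iff₀ (h.dist_node_pos ha n j)).2 (h.le_dist ha n j)

theorem abs_log_dist_descendant_le (h : IsConformalTree Ω K q d) {a : ℂ} (ha : a ∉ Ω)
    (n e i : ℕ) :
    |Real.log (dist (q (n + e) i) a) - Real.log (dist (q n (i / 2 ^ e)) a)| ≤
      K * (1 + K ^ 3) * K * e := by
  have hK := h.K_pos
  induction e generalizing i with
  | zero => simp
  | succ e ih =>
    have h1 := h.abs_log_dist_sub_le ha (n + e) i
    have h2 := ih (i / 2)
    rw [Nat.div_div_eq_div_mul, ← pow_succ'] at h2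
    have h3 : K * (1 + K ^ 3) * (d (n + e) (i / 2) / dist (q (n + e) (i / 2)) a) ≤
        K * (1 + K ^ 3) * K := by
      gcongr
      exact h.div_dist_le ha _ _
    rw [← add_assoc]
    push_cast
    refine (abs_sub_le _ (Real.log (dist (q (n + e) (i / 2)) a)) _).trans ?_
    linarith

/-- The square sum over one annulus. -/
theorem sum_sq_div_dist_le (h : IsConformalTree Ω K q d) {a : ℂ} (ha : a ∉ Ω)
    (s : Finset (ℕ × ℕ)) (hs : ∀ p ∈ s, p.2 < 2 ^ p.1) {R : ℝ} (hR : 0 < R)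
    (hlow : ∀ p ∈ s, R ≤ dist (q p.1 p.2) a) (hup : ∀ p ∈ s, dist (q p.1 p.2) a ≤ 3 * R) :
    ∑ p ∈ s, (d p.1 p.2 / dist (q p.1 p.2) a) ^ 2 ≤ 36 * K ^ 2 := by
  have hK := h.K_pos
  have h1 := h.sum_sq_le s hs (a := a) (R := 6 * R) (by positivity) fun p hp => by
    have : d p.1 p.2 / K ≤ dist (q p.1 p.2) a := (div_le_iff₀' hK).2 (h.le_dist ha _ _)
    linarith [hup p hp]
  calc ∑ p ∈ s, (d p.1 p.2 / dist (q p.1 p.2) a) ^ 2 ≤ ∑ p ∈ s, (d p.1 p.2 / R) ^ 2 := by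
        refine Finset.sum_le_sum fun p hp => ?_
        have := h.pos p.1 p.2
        gcongr
        exact hlow p hp
    _ = (∑ p ∈ s, d p.1 p.2 ^ 2) / R ^ 2 := by
        simp only [div_pow]
        rw [Finset.sum_div]
    _ ≤ K ^ 2 * (6 * R) ^ 2 / R ^ 2 := by gcongr
    _ = _ := by field_simp; ring

theorem exists_generationSum_le (h : IsConformalTree Ω K q d) : ∃ C : ℝ, 0 < C ∧
    ∀ a ∉ Ω, ∀ e n j, j < 2 ^ n →
      generationSum (fun n j => (d n j / dist (q n j) a) ^ 2) e n j ≤ C * (e + 1) := by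
  classical
  have hK := h.K_pos
  set N := ⌈K * (1 + K ^ 3) * K⌉₊ with hN
  refine ⟨36 * K ^ 2 * (2 * N + 1), by positivity, ?_⟩
  intro a ha e n j hj
  set D := dist (q n j) a with hD
  have hD0 : 0 < D := h.dist_node_pos ha n j
  set p : ℕ → ℕ × ℕ := fun i => (n + e, j * 2 ^ e + i) with hp
  set g : ℕ → ℤ := fun i => ⌊Real.log (dist (q (p i).1 (p i).2) a) - Real.log D⌋ with hg
  have hinj : Function.Injective p := fun i i' hi => by
    simpa [hp] using hi
  have hlt : ∀ i ∈ Finset.range (2 ^ e), (p i).2 < 2 ^ (p i).1 := by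
    intro i hi
    rw [Finset.mem_range] at hi
    change j * 2 ^ e + i < 2 ^ (n + e)
    have : (j + 1) * 2 ^ e ≤ 2 ^ n * 2 ^ e := Nat.mul_le_mul_right _ hj
    rw [pow_add]
    linarith
  have hmaps : ∀ i ∈ Finset.range (2 ^ e), g i ∈ Finset.Icc (-(N * e : ℤ)) (N * e) := by
    intro i hi
    rw [Finset.mem_range] at hi
    have h1 := h.abs_log_dist_descendant_le ha n e (j * 2 ^ e + i)
    have h2 : (j * 2 ^ e + i) / 2 ^ e = j := by
      rw [mul_comm, Nat.mul_add_div (by positivity), Nat.div_eq_of_lt hi, add_zero]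
    rw [h2] at h1
    have h3 : K * (1 + K ^ 3) * K * e ≤ N * e := by
      gcongr
      exact Nat.le_ceil _
    obtain ⟨h4, h5⟩ := abs_le.1 (h1.trans h3)
    rw [Finset.mem_Icc]
    constructor
    · refine Int.le_floor.2 ?_
      push_cast
      exact h4
    · have : (g i : ℝ) ≤ (N : ℝ) * e := (Int.floor_le _).trans h5
      exact_mod_cast this
  have hfib : ∀ m ∈ Finset.Icc (-(N * e : ℤ)) (N * e),
      ∑ i ∈ Finset.range (2 ^ e) with g i = m,
        (d (n + e) (j * 2 ^ e + i) / dist (q (n + e) (j * 2 ^ e + i)) a) ^ 2 ≤ 36 * K ^ 2 := by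
    intro m _
    have hb : ∀ i, g i = m → D * Real.exp m ≤ dist (q (p i).1 (p i).2) a ∧
        dist (q (p i).1 (p i).2) a ≤ 3 * (D * Real.exp m) := by
      intro i hi
      have hpos := h.dist_node_pos ha (p i).1 (p i).2
      obtain ⟨h1, h2⟩ := Int.floor_eq_iff.1 hi
      constructor
      · rw [← Real.log_le_log_iff (by positivity) hpos, Real.log_mul hD0.ne' (Real.exp_pos _).ne',
          Real.log_exp]
        linarith
      · rw [← Real.log_le_log_iff hpos (by positivity), Real.log_mul (by norm_num) (by positivity),
          Real.log_mul hD0.ne' (Real.exp_pos _).ne', Real.log_exp]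
        have : 1 ≤ Real.log 3 := by
          rw [Real.le_log_iff_exp_le (by norm_num)]
          linarith [Real.exp_one_lt_d9]
        linarith
    have := h.sum_sq_div_dist_le ha
      (((Finset.range (2 ^ e)).filter fun i => g i = m).map ⟨p, hinj⟩) (R := D * Real.exp m)
      (by
        intro x hx
        obtain ⟨i, hi, rfl⟩ := Finset.mem_map.1 hx
        exact hlt i (Finset.mem_filter.1 hi).1) (by positivity)
      (by
        intro x hx
        obtain ⟨i, hi, rfl⟩ := Finset.mem_map.1 hx
        exact (hb i (Finset.mem_filter.1 hi).2).1)
      (by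
        intro x hx
        obtain ⟨i, hi, rfl⟩ := Finset.mem_map.1 hx
        exact (hb i (Finset.mem_filter.1 hi).2).2)
    rw [Finset.sum_map] at this
    exact this
  unfold generationSum
  rw [← Finset.sum_fiberwise_of_maps_to hmaps]
  refine (Finset.sum_le_card_nsmul _ _ _ hfib).trans ?_
  rw [Int.card_Icc, nsmul_eq_mul]
  have h6 : ((N * e : ℤ) + 1 - -(N * e)).toNat = 2 * (N * e) + 1 := by
    omega
  rw [h6]
  push_cast
  have h7 : (2 * ((N : ℝ) * e) + 1) ≤ (2 * N + 1) * (e + 1) := by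
    nlinarith [Nat.cast_nonneg (α := ℝ) N, Nat.cast_nonneg (α := ℝ) e]
  calc _ ≤ ((2 * N + 1) * ((e : ℝ) + 1)) * (36 * K ^ 2) := by gcongr
    _ = _ := by ring

/-- The mean oscillation of `log (dist · a)` over the leaves of a stopped tree. -/
theorem exists_sum_abs_log_dist_le (h : IsConformalTree Ω K q d) : ∃ C : ℝ, 0 < C ∧
    ∀ a ∉ Ω, ∀ (halts : ℕ × ℕ → Prop) [DecidablePred halts], ∀ k n j, j < 2 ^ n →
      ∑ p ∈ stoppedLeaves halts k n j, (1 / 2 : ℝ) ^ p.1 *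
        |Real.log (dist (q p.1 p.2) a) - Real.log (dist (q n j) a)| ≤ C * (1 / 2) ^ n := by
  obtain ⟨C, hC, hgen⟩ := h.exists_generationSum_le
  have hK := h.K_pos
  refine ⟨K * (1 + K ^ 3) * (7 * C + 4), by positivity, ?_⟩
  intro a ha halts _ k n j hj
  have h1 := sum_stoppedLeaves_abs_sub_le (halts := halts)
    (Y := fun n j => Real.log (dist (q n j) a))
    (t := fun n j => K * (1 + K ^ 3) * (d n j / dist (q n j) a)) (fun n j => by
      have e1 := h.abs_log_dist_sub_le ha n (2 * j)
      have e2 := h.abs_log_dist_sub_le ha n (2 * j + 1)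
      rw [show (2 * j) / 2 = j by omega] at e1
      rw [show (2 * j + 1) / 2 = j by omega] at e2
      exact ⟨e1, e2⟩) k n j
  refine h1.trans ?_
  have h2 := sum_generationSum_le (τ := fun n j => d n j / dist (q n j) a) hC.le
    (fun e => hgen a ha e n j hj) k
  calc _ = K * (1 + K ^ 3) * ∑ e ∈ Finset.range k, (1 / 2 : ℝ) ^ (n + e) *
        generationSum (fun n j => d n j / dist (q n j) a) e n j := by
        rw [Finset.mul_sum]
        refine Finset.sum_congr rfl fun e _ => ?_
        unfold generationSum
        rw [← Finset.mul_sum]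
        ring
    _ ≤ K * (1 + K ^ 3) * ((7 * C + 4) * (1 / 2) ^ n) := by gcongr
    _ = _ := by ring

end IsConformalTree

end ConformalTree

section ConformalTree

/-- The stopping condition for the nodes of a conformal tree. -/
def IsStopped (q : ℕ → ℕ → ℂ) (d : ℕ → ℕ → ℝ) (b : ℂ) (r ε : ℝ) (p : ℕ × ℕ) : Prop :=
  d p.1 p.2 ≤ ε * (r ^ 2 + dist (q p.1 p.2) b ^ 2)

noncomputable instance (q : ℕ → ℕ → ℂ) (d : ℕ → ℕ → ℝ) (b : ℂ) (r ε : ℝ) :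
    DecidablePred (IsStopped q d b r ε) := Classical.decPred _

variable {Ω : Set ℂ} {K : ℝ} {q : ℕ → ℕ → ℂ} {d : ℕ → ℕ → ℝ}

namespace IsConformalTree

theorem isBalanced_stoppedLeaves (h : IsConformalTree Ω K q d) {b : ℂ} (hb : b ∉ Ω) {r ε : ℝ}
    (hε : 0 < ε) {k n j : ℕ} (hj : j < 2 ^ n)
    (hN : ∀ i < 2 ^ (n + k), IsStopped q d b r ε (n + k, i)) (hns : ¬ IsStopped q d b r ε (n, j)) :
    IsBalanced q d (1 / (K * (1 + K ^ 2) ^ 2)) b r ε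
      (stoppedLeaves (IsStopped q d b r ε) k n j) := by
  have hK := h.K_pos
  refine ⟨fun p hp => snd_lt_of_mem_stoppedLeaves hj hp, ?_,
    fun p hp => halts_of_mem_stoppedLeaves hj hN hp⟩
  rintro ⟨m', i⟩ hp
  rcases not_halts_parent_of_mem_stoppedLeaves hp with h1 | ⟨m, hm, hpar⟩
  · exact absurd (h1 ▸ halts_of_mem_stoppedLeaves hj hN hp) hns
  · dsimp only at hm hpar ⊢
    subst hm
    rw [IsStopped, not_le] at hpar
    dsimp only at hpar
    have h1 := h.le_child m i
    have h2 : dist (q (m + 1) i) b ≤ (1 + K ^ 2) * dist (q m (i / 2)) b := by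
      have e1 := dist_triangle (q (m + 1) i) (q m (i / 2)) b
      have e2 := h.dist_child m i
      have e3 : K * d m (i / 2) ≤ K * (K * dist (q m (i / 2)) b) := by
        gcongr
        exact h.le_dist hb _ _
      linarith
    have h3 : r ^ 2 + dist (q (m + 1) i) b ^ 2 ≤
        (1 + K ^ 2) ^ 2 * (r ^ 2 + dist (q m (i / 2)) b ^ 2) := by
      have e1 : dist (q (m + 1) i) b ^ 2 ≤ ((1 + K ^ 2) * dist (q m (i / 2)) b) ^ 2 := by gcongr
      have e2 : r ^ 2 ≤ (1 + K ^ 2) ^ 2 * r ^ 2 :=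
        le_mul_of_one_le_left (sq_nonneg _) (one_le_pow₀ (by nlinarith))
      linarith
    rw [div_mul_eq_mul_div, one_mul, div_le_iff₀ (by positivity)]
    calc ε * (r ^ 2 + dist (q (m + 1) i) b ^ 2)
        ≤ ε * ((1 + K ^ 2) ^ 2 * (r ^ 2 + dist (q m (i / 2)) b ^ 2)) := by gcongr
      _ = (1 + K ^ 2) ^ 2 * (ε * (r ^ 2 + dist (q m (i / 2)) b ^ 2)) := by ring
      _ ≤ (1 + K ^ 2) ^ 2 * (K * d (m + 1) i) := by
          exact mul_le_mul_of_nonneg_left (hpar.le.trans h1) (by positivity)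
      _ = _ := by ring

theorem exists_forall_isStopped (h : IsConformalTree Ω K q d) {b : ℂ} (hb : b ∉ Ω) {r ε : ℝ}
    (hr : 0 < r) (hε : 0 < ε) :
    ∃ N₀ : ℕ, ∀ N ≥ N₀, ∀ i < 2 ^ N, IsStopped q d b r ε (N, i) := by
  have hK := h.K_pos
  set U : Set (ℕ × ℕ) := {p | p.2 < 2 ^ p.1 ∧ ¬ IsStopped q d b r ε p} with hU
  have hfin : U.Finite := by
    by_contra hinf
    obtain ⟨M, hM⟩ := exists_nat_gt (K ^ 2 * (2 * K / ε) ^ 2 / (ε * r ^ 2) ^ 2)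
    obtain ⟨s, hs, hcard⟩ := Set.Infinite.exists_subset_card_eq hinf M
    have hns : ∀ p ∈ s, ε * (r ^ 2 + dist (q p.1 p.2) b ^ 2) < d p.1 p.2 := fun p hp =>
      not_le.1 (hs hp).2
    have h1 := h.sum_sq_le s (fun p hp => (hs hp).1) (a := b) (R := 2 * K / ε) (by positivity)
      fun p hp => by
        have e1 := hns p hp
        have e2 := h.le_dist hb p.1 p.2
        have e3 := h.dist_node_pos hb p.1 p.2
        have e4 : d p.1 p.2 / K ≤ dist (q p.1 p.2) b := (div_le_iff₀' hK).2 e2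
        have e5 : dist (q p.1 p.2) b ≤ K / ε := by
          rw [le_div_iff₀ hε]
          have e6 : (dist (q p.1 p.2) b * ε) * dist (q p.1 p.2) b ≤ K * dist (q p.1 p.2) b := by
            have : 0 ≤ ε * r ^ 2 := by positivity
            nlinarith
          exact le_of_mul_le_mul_right e6 e3
        have e7 : 2 * K / ε = K / ε + K / ε := by ring
        linarith
    have h2 : (M : ℝ) * (ε * r ^ 2) ^ 2 ≤ ∑ p ∈ s, d p.1 p.2 ^ 2 := by
      rw [← hcard, ← nsmul_eq_mul]
      refine Finset.card_nsmul_le_sum _ _ _ fun p hp => ?_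
      have e1 := hns p hp
      have : ε * r ^ 2 ≤ d p.1 p.2 := by
        have : 0 ≤ ε * dist (q p.1 p.2) b ^ 2 := by positivity
        linarith
      gcongr
    rw [div_lt_iff₀ (by positivity)] at hM
    linarith
  obtain ⟨N₀, hN₀⟩ := (hfin.image Prod.fst).bddAbove
  refine ⟨N₀ + 1, fun N hN i hi => ?_⟩
  by_contra hns
  have := hN₀ (mem_image_of_mem Prod.fst (show (N, i) ∈ U from ⟨hi, hns⟩))
  dsimp only at this
  omega

/-- Under an unstopped node the square root of the density has a large mean over the leaves which
are not too far away. -/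
theorem exists_density_le (h : IsConformalTree Ω K q d) (hΩ : IsOpen Ω) (hne : Ω ≠ univ) {CA : ℝ}
    (hCA : 0 < CA) (hA : ∀ z : ℂ, ∀ r : ℝ, 0 < r →
      μH[1] (frontier Ω ∩ ball z r) ≤ ENNReal.ofReal (CA * r))
    (hH : ∀ z ∈ Ω, ∀ p ∈ frontier Ω, dist z p = infDist z Ωᶜ →
      ENNReal.ofReal (dist z p) ≤ μH[1] (frontier Ω ∩ ball p (dist z p))) :
    ∃ C : ℝ, 0 < C ∧ ∀ b ∉ Ω, ∀ r ε : ℝ, 0 < r → 0 < ε → ∀ k n j, j < 2 ^ n →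
    (∀ i < 2 ^ (n + k), IsStopped q d b r ε (n + k, i)) → ¬ IsStopped q d b r ε (n, j) →
    d n j * 2 ^ n ≤ C * (2 ^ n * ∑ p ∈ stoppedLeaves (IsStopped q d b r ε) k n j with
      dist (q p.1 p.2) b ≤ C * dist (q n j) b, (1 / 2 : ℝ) ^ p.1 * √(d p.1 p.2 * 2 ^ p.1)) ^ 2 := by
  classical
  have hK := h.K_pos
  obtain ⟨B, hB, hsum⟩ := h.exists_sum_le hΩ hne hCA hA hH
    (c := 1 / (K * (1 + K ^ 2) ^ 2)) (by positivity)
  obtain ⟨CY, hCY, hY⟩ := h.exists_sum_abs_log_dist_le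
  set C₈ := 16 * B * K + 4 + 5 * CY + 2 * K with hC₈
  have hC₈0 : 0 < C₈ := by positivity
  refine ⟨4 * Real.exp (2 * C₈) + 2, by positivity, ?_⟩
  intro b hb r ε hr hε k n j hj hN hns
  set s := stoppedLeaves (IsStopped q d b r ε) k n j with hs
  have hbal : IsBalanced q d (1 / (K * (1 + K ^ 2) ^ 2)) b r ε s :=
    h.isBalanced_stoppedLeaves hb hε hj hN hns
  obtain ⟨a, haf, haD⟩ := exists_mem_frontier_dist_eq_infDist hΩ hne (h.mem n j)
  have ha : a ∉ Ω := by
    rw [hΩ.frontier_eq] at haf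
    exact haf.2
  set D := dist (q n j) a with hD
  have hD0 : 0 < D := h.dist_node_pos ha n j
  have hDb : D ≤ dist (q n j) b := haD.le.trans (infDist_le_dist_of_mem hb)
  have hd := h.pos n j
  have hpos : ∀ p : ℕ × ℕ, 0 < d p.1 p.2 := fun p => h.pos p.1 p.2
  set w : ℕ × ℕ → ℝ := fun p => (1 / 2 : ℝ) ^ p.1 with hw
  have hw0 : ∀ p, 0 < w p := fun p => by positivity
  set u : ℕ × ℕ → ℝ := fun p => Real.log (d p.1 p.2 * 2 ^ p.1) - Real.log (d n j * 2 ^ n) with hu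
  set Y : ℕ × ℕ → ℝ := fun p => Real.log (dist (q p.1 p.2) a) - Real.log D with hYdef
  set y : ℕ × ℕ → ℝ := fun p => dist (q p.1 p.2) a with hy
  set Z : ℕ × ℕ → ℝ := fun p => Real.exp (u p) * ((1 + y p / D) ^ 2)⁻¹ with hZ
  have hexpY : ∀ p, Real.exp (Y p) = y p / D := by
    intro p
    rw [hYdef]
    dsimp only
    rw [← Real.log_div (h.dist_node_pos ha _ _).ne' hD0.ne', Real.exp_log]
    exact div_pos (h.dist_node_pos ha _ _) hD0
  have hexpu : ∀ p, Real.exp (u p) = d p.1 p.2 * 2 ^ p.1 / (d n j * 2 ^ n) := by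
    intro p
    have := hpos p
    rw [hu]
    dsimp only
    rw [← Real.log_div (by positivity) (by positivity), Real.exp_log (by positivity)]
  have hwsum : ∑ p ∈ s, w p = (1 / 2) ^ n := sum_stoppedLeaves_weight k n j
  have hwY : ∑ p ∈ s, w p * |Y p| ≤ CY * (1 / 2) ^ n := hY a ha _ k n j hj
  have hwZ : ∑ p ∈ s, w p * Z p ≤ 8 * B * K * (1 / 2) ^ n := by
    have h1 := sum_mul_inv_one_add_sq_le s (d := fun p => d p.1 p.2) (y := y) hD0 hB.le
      (fun p _ => (hpos p).le) (fun p _ => dist_nonneg)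
      (fun ρ hρ => hsum b hb r ε hr hε s hbal a ha ρ hρ)
    have h2 : ∑ p ∈ s, w p * Z p = (∑ p ∈ s, d p.1 p.2 * ((1 + y p / D) ^ 2)⁻¹) *
        ((1 / 2) ^ n / d n j) := by
      rw [Finset.sum_mul]
      refine Finset.sum_congr rfl fun p _ => ?_
      rw [hZ, hw]
      dsimp only
      rw [hexpu]
      simp only [one_div, inv_pow]
      field_simp
    rw [h2]
    have h3 : D ≤ K * d n j := haD.le.trans (h.infDist_le n j)
    calc _ ≤ 8 * B * D * ((1 / 2) ^ n / d n j) := by gcongr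
      _ ≤ 8 * B * (K * d n j) * ((1 / 2) ^ n / d n j) := by gcongr
      _ = _ := by field_simp
  have hwu : |∑ p ∈ s, w p * u p| ≤ 2 * K * (1 / 2) ^ n := by
    obtain ⟨S, hS, hSl⟩ := h.exists_log (n + k)
    have h1 : ∑ p ∈ s, S p.1 p.2 = S n j := sum_stoppedLeaves_eq fun m hm i => hS m hm i
    have h2 : |∑ p ∈ s, (S p.1 p.2 - w p * Real.log (d p.1 p.2 * 2 ^ p.1))| ≤ K * (1 / 2) ^ n := by
      refine (Finset.abs_sum_le_sum_abs _ _).trans ?_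
      rw [← hwsum, Finset.mul_sum]
      refine Finset.sum_le_sum fun p hp => ?_
      obtain ⟨e, he, hpe, -⟩ := exists_of_mem_stoppedLeaves hp
      exact hSl p.1 (by omega) p.2
    have h3 := hSl n (by omega) j
    rw [Finset.sum_sub_distrib, h1] at h2
    have h4 : ∑ p ∈ s, w p * u p = ∑ p ∈ s, w p * Real.log (d p.1 p.2 * 2 ^ p.1) -
        (1 / 2) ^ n * Real.log (d n j * 2 ^ n) := by
      simp only [hu, mul_sub]
      rw [Finset.sum_sub_distrib, ← Finset.sum_mul, hwsum]
    rw [h4]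
    rw [abs_le] at h2 h3 ⊢
    constructor <;> linarith
  have hule : ∀ p, |u p| ≤ 2 * Z p + 4 + 4 * |Y p| - u p := by
    intro p
    have hy0 : 0 < y p / D := div_pos (h.dist_node_pos ha _ _) hD0
    have h1 : 1 + y p / D ≤ 2 * Real.exp |Y p| := by
      have e1 : y p / D ≤ Real.exp |Y p| := by
        rw [← hexpY]
        exact Real.exp_le_exp.2 (le_abs_self _)
      linarith [Real.one_le_exp (abs_nonneg (Y p))]
    have h2 : Real.log (1 + y p / D) ≤ Real.log 2 + |Y p| := by
      have e1 := Real.log_le_log (by positivity) h1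
      rwa [Real.log_mul (by norm_num) (Real.exp_pos _).ne', Real.log_exp] at e1
    have h3 : Real.log (Z p) = u p - 2 * Real.log (1 + y p / D) := by
      rw [hZ]
      dsimp only
      rw [Real.log_mul (Real.exp_pos _).ne' (by positivity), Real.log_exp, Real.log_inv,
        Real.log_pow]
      push_cast
      ring
    have hZ0 : 0 < Z p := by positivity
    have h4 := Real.log_le_sub_one_of_pos hZ0
    have h5 : Real.log 2 ≤ 1 := by linarith [Real.log_two_lt_d9]
    have h6 : u p ≤ Z p + 2 + 2 * |Y p| := by linarith
    have h7 := abs_nonneg (Y p)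
    rcases abs_cases (u p) with ⟨e, -⟩ | ⟨e, -⟩ <;> rw [e] <;> linarith
  have htot : ∑ p ∈ s, w p * (|u p| + |Y p|) ≤ C₈ * (1 / 2) ^ n := by
    calc ∑ p ∈ s, w p * (|u p| + |Y p|)
        ≤ ∑ p ∈ s, (2 * (w p * Z p) + 4 * w p + 5 * (w p * |Y p|) - w p * u p) := by
          refine Finset.sum_le_sum fun p _ => ?_
          have := mul_le_mul_of_nonneg_left (hule p) (hw0 p).le
          linarith
      _ = 2 * ∑ p ∈ s, w p * Z p + 4 * ∑ p ∈ s, w p + 5 * ∑ p ∈ s, w p * |Y p| -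
            ∑ p ∈ s, w p * u p := by
          rw [Finset.sum_sub_distrib, Finset.sum_add_distrib, Finset.sum_add_distrib,
            ← Finset.mul_sum, ← Finset.mul_sum, ← Finset.mul_sum]
      _ ≤ _ := by
          rw [hwsum]
          have := (abs_le.1 hwu).1
          rw [hC₈]
          linarith
  set G := s.filter fun p => |u p| + |Y p| ≤ 2 * C₈ with hG
  have hGw : (1 / 2 : ℝ) ^ n / 2 ≤ ∑ p ∈ G, w p := by
    have h1 := Finset.sum_filter_add_sum_filter_not s (fun p => |u p| + |Y p| ≤ 2 * C₈) w
    have h2 : 2 * C₈ * ∑ p ∈ s with ¬ (|u p| + |Y p| ≤ 2 * C₈), w p ≤ C₈ * (1 / 2) ^ n := by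
      refine le_trans ?_ htot
      rw [Finset.mul_sum]
      refine (Finset.sum_le_sum fun p hp => ?_).trans
        (Finset.sum_le_sum_of_subset_of_nonneg (Finset.filter_subset _ _) fun p _ _ =>
          mul_nonneg (hw0 p).le (add_nonneg (abs_nonneg _) (abs_nonneg _)))
      rw [mul_comm]
      exact mul_le_mul_of_nonneg_left (not_le.1 (Finset.mem_filter.1 hp).2).le (hw0 p).le
    have h3 : ∑ p ∈ s with ¬ (|u p| + |Y p| ≤ 2 * C₈), w p ≤ (1 / 2) ^ n / 2 := by
      have : C₈ * (2 * ∑ p ∈ s with ¬ (|u p| + |Y p| ≤ 2 * C₈), w p) ≤ C₈ * (1 / 2) ^ n := by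
        linarith
      linarith [le_of_mul_le_mul_left this hC₈0]
    rw [hwsum] at h1
    linarith
  have hGd : ∀ p ∈ G, Real.exp (-C₈) * √(d n j * 2 ^ n) ≤ √(d p.1 p.2 * 2 ^ p.1) := by
    intro p hp
    have h1 := (Finset.mem_filter.1 hp).2
    have h2 : -(2 * C₈) ≤ u p := by linarith [neg_abs_le (u p), abs_nonneg (Y p)]
    have h3 := Real.exp_le_exp.2 h2
    rw [hexpu, le_div_iff₀ (by positivity)] at h3
    have h4 : Real.exp (-C₈) = √(Real.exp (-(2 * C₈))) := by
      rw [show -(2 * C₈) = -C₈ + -C₈ by ring, Real.exp_add, Real.sqrt_mul_self (Real.exp_pos _).le]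
    rw [h4, ← Real.sqrt_mul (Real.exp_pos _).le]
    exact Real.sqrt_le_sqrt h3
  have hGdist : ∀ p ∈ G, dist (q p.1 p.2) b ≤ (4 * Real.exp (2 * C₈) + 2) * dist (q n j) b := by
    intro p hp
    have h1 := (Finset.mem_filter.1 hp).2
    have h2 : Y p ≤ 2 * C₈ := by linarith [le_abs_self (Y p), abs_nonneg (u p)]
    have h3 := Real.exp_le_exp.2 h2
    rw [hexpY, div_le_iff₀ hD0] at h3
    have h4 := dist_triangle4 (q p.1 p.2) a (q n j) b
    rw [dist_comm a] at h4
    have h5 : Real.exp (2 * C₈) * D ≤ 4 * Real.exp (2 * C₈) * dist (q n j) b := by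
      have : 0 < Real.exp (2 * C₈) := Real.exp_pos _
      nlinarith [dist_nonneg (x := q n j) (y := b)]
    change dist (q p.1 p.2) b ≤ y p + D + _ at h4
    linarith
  have hfinal : Real.exp (-C₈) * √(d n j * 2 ^ n) / 2 ≤ 2 ^ n * ∑ p ∈ s with
      dist (q p.1 p.2) b ≤ (4 * Real.exp (2 * C₈) + 2) * dist (q n j) b,
      w p * √(d p.1 p.2 * 2 ^ p.1) := by
    have e1 : (2 : ℝ) ^ n * (1 / 2) ^ n = 1 := by
      rw [← mul_pow]
      norm_num
    calc Real.exp (-C₈) * √(d n j * 2 ^ n) / 2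
        = 2 ^ n * (((1 / 2 : ℝ) ^ n / 2) * (Real.exp (-C₈) * √(d n j * 2 ^ n))) := by
          linear_combination (-(Real.exp (-C₈) * √(d n j * 2 ^ n) / 2)) * e1
      _ ≤ 2 ^ n * ((∑ p ∈ G, w p) * (Real.exp (-C₈) * √(d n j * 2 ^ n))) := by gcongr
      _ ≤ 2 ^ n * ∑ p ∈ G, w p * √(d p.1 p.2 * 2 ^ p.1) := by
          rw [Finset.sum_mul]
          gcongr with p hp
          exact hGd p hp
      _ ≤ _ := by
          refine mul_le_mul_of_nonneg_left ?_ (by positivity)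
          refine Finset.sum_le_sum_of_subset_of_nonneg (fun p hp => ?_) fun p _ _ =>
            mul_nonneg (hw0 p).le (Real.sqrt_nonneg _)
          exact Finset.mem_filter.2 ⟨(Finset.mem_filter.1 hp).1, hGdist p hp⟩
  have hsq := pow_le_pow_left₀ (by positivity) hfinal 2
  have e2 : (Real.exp (-C₈) * √(d n j * 2 ^ n) / 2) ^ 2 =
      (4 * Real.exp (2 * C₈))⁻¹ * (d n j * 2 ^ n) := by
    rw [div_pow, mul_pow, Real.sq_sqrt (by positivity), mul_inv, ← Real.exp_neg, ← Real.exp_nat_mul]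
    push_cast
    rw [show (2 : ℝ) * -C₈ = -(2 * C₈) by ring]
    ring
  rw [e2, inv_mul_le_iff₀ (by positivity)] at hsq
  refine hsq.trans ?_
  gcongr
  linarith [Real.exp_pos (2 * C₈)]

end IsConformalTree

end ConformalTree

section Bellman

theorem two_mul_sub_le_sq_div (F lam : ℝ) {x : ℝ} (hx : 0 < x) :
    2 * lam * F - lam ^ 2 * x ≤ F ^ 2 / x := by
  rw [le_div_iff₀ hx]
  nlinarith [sq_nonneg (F - lam * x)]

/-- The dyadic Carleson embedding inequality, at one node. -/
theorem carleson_embedding_step {P ℓ M A M₁ M₂ F₁ F₂ : ℝ} (hP : 0 < P) (hℓ : 0 < ℓ) (hA : 0 ≤ A)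
    (h₁ : 0 ≤ M₁) (h₂ : 0 ≤ M₂) (hM : A + M₁ + M₂ ≤ M) (hMP : M ≤ P * ℓ) :
    A * ((F₁ + F₂) / ℓ) ^ 2 ≤ 4 * P * (F₁ ^ 2 / (ℓ / 2 + M₁ / P) + F₂ ^ 2 / (ℓ / 2 + M₂ / P) -
      (F₁ + F₂) ^ 2 / (ℓ + M / P)) := by
  have hM0 : 0 ≤ M := by linarith
  set X := ℓ + M / P with hX
  have hX0 : 0 < X := by positivity
  have hX2 : X ≤ 2 * ℓ := by
    have : M / P ≤ ℓ := (div_le_iff₀' hP).2 hMP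
    linarith
  set lam := (F₁ + F₂) / X with hlam
  have e1 := two_mul_sub_le_sq_div F₁ lam (x := ℓ / 2 + M₁ / P) (by positivity)
  have e2 := two_mul_sub_le_sq_div F₂ lam (x := ℓ / 2 + M₂ / P) (by positivity)
  have e3 : (ℓ / 2 + M₁ / P) + (ℓ / 2 + M₂ / P) ≤ X - A / P := by
    have : (A + M₁ + M₂) / P ≤ M / P := by gcongr
    rw [add_div, add_div] at this
    linarith
  have e4 := mul_le_mul_of_nonneg_left e3 (sq_nonneg lam)
  have e5 : lam * (F₁ + F₂) = (F₁ + F₂) ^ 2 / X := by rw [hlam]; ring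
  have e6 : lam ^ 2 * X = (F₁ + F₂) ^ 2 / X := by rw [hlam]; field_simp
  have e7 : lam ^ 2 * (A / P) ≤ F₁ ^ 2 / (ℓ / 2 + M₁ / P) + F₂ ^ 2 / (ℓ / 2 + M₂ / P) -
      (F₁ + F₂) ^ 2 / X := by linarith
  have e8 : ((F₁ + F₂) / ℓ) ^ 2 ≤ 4 * lam ^ 2 := by
    rw [hlam, div_pow, div_pow, ← mul_div_assoc, div_le_div_iff₀ (by positivity) (by positivity)]
    have : X ^ 2 ≤ (2 * ℓ) ^ 2 := by gcongr
    nlinarith [mul_le_mul_of_nonneg_left this (sq_nonneg (F₁ + F₂))]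
  calc A * ((F₁ + F₂) / ℓ) ^ 2 ≤ A * (4 * lam ^ 2) := by gcongr
    _ = 4 * P * (lam ^ 2 * (A / P)) := by field_simp
    _ ≤ _ := by gcongr

theorem sum_range_two_mul (g : ℕ → ℝ) (k : ℕ) :
    ∑ j ∈ Finset.range (2 * k), g j = ∑ j ∈ Finset.range k, (g (2 * j) + g (2 * j + 1)) := by
  induction k with
  | zero => simp
  | succ k ih =>
    rw [mul_add, mul_one, Finset.sum_range_succ, Finset.sum_range_succ, ih, Finset.sum_range_succ,
      add_assoc]

/-- A function on the dyadic tree which dominates `g` plus its values at the children dominates the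
sum of `g` over the tree. -/
theorem sum_tree_le {V g : ℕ → ℕ → ℝ} {m : ℕ} (hV : ∀ j < 2 ^ m, 0 ≤ V m j)
    (h : ∀ n < m, ∀ j < 2 ^ n, g n j + V (n + 1) (2 * j) + V (n + 1) (2 * j + 1) ≤ V n j) :
    ∑ n ∈ Finset.range m, ∑ j ∈ Finset.range (2 ^ n), g n j ≤ V 0 0 := by
  have key : ∀ k ≤ m, ∑ n ∈ Finset.range k, ∑ j ∈ Finset.range (2 ^ n), g n j +
      ∑ j ∈ Finset.range (2 ^ k), V k j ≤ V 0 0 := by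
    intro k
    induction k with
    | zero => simp
    | succ k ih =>
      intro hk
      refine le_trans ?_ (ih (by omega))
      rw [Finset.sum_range_succ, pow_succ', sum_range_two_mul, add_assoc, ← Finset.sum_add_distrib]
      gcongr with j hj
      have := h k hk j (Finset.mem_range.1 hj)
      linarith
  have h1 := key m le_rfl
  have h2 : 0 ≤ ∑ j ∈ Finset.range (2 ^ m), V m j :=
    Finset.sum_nonneg fun j hj => hV j (Finset.mem_range.1 hj)
  linarith

end Bellman

section ConformalTree

variable {Ω : Set ℂ} {K : ℝ} {q : ℕ → ℕ → ℂ} {d : ℕ → ℕ → ℝ}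

namespace IsConformalTree

/-- The discrete form of the estimate for the push-forward of a Carleson measure. -/
theorem exists_sum_carleson_le (h : IsConformalTree Ω K q d) (hΩ : IsOpen Ω) (hne : Ω ≠ univ)
    {CA : ℝ} (hCA : 0 < CA) (hA : ∀ z : ℂ, ∀ r : ℝ, 0 < r →
      μH[1] (frontier Ω ∩ ball z r) ≤ ENNReal.ofReal (CA * r))
    (hH : ∀ z ∈ Ω, ∀ p ∈ frontier Ω, dist z p = infDist z Ωᶜ →
      ENNReal.ofReal (dist z p) ≤ μH[1] (frontier Ω ∩ ball p (dist z p))) {C₀ : ℝ} (hC₀ : 0 < C₀) :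
    ∃ C : ℝ, 0 < C ∧ ∀ (A M : ℕ → ℕ → ℝ) (P : ℝ), 0 < P → (∀ n j, 0 ≤ A n j) →
      (∀ n j, 0 ≤ M n j) → (∀ n j, M n j ≤ P * (1 / 2) ^ n) →
      (∀ n j, A n j + M (n + 1) (2 * j) + M (n + 1) (2 * j + 1) ≤ M n j) →
      ∀ b ∉ Ω, ∀ r : ℝ, 0 < r → ∀ m : ℕ,
        ∑ n ∈ Finset.range m, ∑ j ∈ Finset.range (2 ^ n),
          (if dist (q n j) b < C₀ * r then A n j * (d n j * 2 ^ n) else 0) ≤ C * (P * r) := by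
  classical
  have hK := h.K_pos
  obtain ⟨B, hB, hsum⟩ := h.exists_sum_le hΩ hne hCA hA hH
    (c := 1 / (K * (1 + K ^ 2) ^ 2)) (by positivity)
  obtain ⟨C₁, hC₁, hdens⟩ := h.exists_density_le hΩ hne hCA hA hH
  refine ⟨C₁ * (4 * (B * (2 * (C₁ * C₀)))), by positivity, ?_⟩
  intro A M P hP hA0 hM0 hMP hAM b hb r hr m
  obtain ⟨ε, hε, hns⟩ : ∃ ε > 0, ∀ n ≤ m, ∀ j < 2 ^ n, ¬ IsStopped q d b r ε (n, j) := by
    have h1 : ∀ᶠ ε in nhdsWithin (0 : ℝ) (Ioi 0), ∀ n ∈ Finset.range (m + 1),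
        ∀ j ∈ Finset.range (2 ^ n), ¬ IsStopped q d b r ε (n, j) := by
      rw [Finset.eventually_all]
      intro n _
      rw [Finset.eventually_all]
      intro j _
      have h2 : Filter.Tendsto (fun ε : ℝ => ε * (r ^ 2 + dist (q n j) b ^ 2)) (nhds 0)
          (nhds (0 * (r ^ 2 + dist (q n j) b ^ 2))) := by
        exact (continuous_id.mul continuous_const).tendsto 0
      rw [zero_mul] at h2
      filter_upwards [nhdsWithin_le_nhds (h2.eventually (gt_mem_nhds (h.pos n j)))] with ε hε
      exact not_le.2 hε
    obtain ⟨ε, h3, h4⟩ := (h1.and self_mem_nhdsWithin).exists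
    exact ⟨ε, h4, fun n hn j hj => h3 n (Finset.mem_range.2 (by omega)) j (Finset.mem_range.2 hj)⟩
  obtain ⟨N₀, hN₀⟩ := h.exists_forall_isStopped hb hr hε
  set N := max N₀ (m + 1) with hN
  have hNs := hN₀ N (le_max_left _ _)
  have hmN : m + 1 ≤ N := le_max_right _ _
  set s : ℕ → ℕ → Finset (ℕ × ℕ) := fun n j => stoppedLeaves (IsStopped q d b r ε) (N - n) n j
    with hs
  set R := C₁ * (C₀ * r) with hR
  set f : ℕ × ℕ → ℝ := fun p => if dist (q p.1 p.2) b ≤ R then √(d p.1 p.2 * 2 ^ p.1) else 0 with hf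
  have hf0 : ∀ p, 0 ≤ f p := fun p => by
    rw [hf]
    dsimp only
    split_ifs <;> positivity
  set F : ℕ → ℕ → ℝ := fun n j => ∑ p ∈ s n j, (1 / 2 : ℝ) ^ p.1 * f p with hF
  set G : ℕ → ℕ → ℝ := fun n j => ∑ p ∈ s n j, (1 / 2 : ℝ) ^ p.1 * f p ^ 2 with hG
  set V : ℕ → ℕ → ℝ := fun n j => 4 * P * (G n j - F n j ^ 2 / ((1 / 2) ^ n + M n j / P)) with hV
  have hNn : ∀ n < m, ∀ i < 2 ^ (n + (N - n)), IsStopped q d b r ε (n + (N - n), i) := by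
    intro n hn
    rw [Nat.add_sub_cancel' (by omega)]
    exact hNs
  have hsplit : ∀ g : ℕ × ℕ → ℝ, ∀ n < m, ∀ j < 2 ^ n, ∑ p ∈ s n j, g p =
      ∑ p ∈ s (n + 1) (2 * j), g p + ∑ p ∈ s (n + 1) (2 * j + 1), g p := by
    intro g n hn j hj
    have h1 : N - n = (N - (n + 1)) + 1 := by omega
    rw [hs]
    dsimp only
    rw [h1, stoppedLeaves_succ (hns n hn.le j hj), Finset.sum_union (disjoint_stoppedLeaves _ _ _)]
  have hV0 : ∀ n j, 0 ≤ V n j := by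
    intro n j
    have h1 : F n j ^ 2 ≤ (1 / 2) ^ n * G n j := by
      have h2 := Finset.sum_mul_sq_le_sq_mul_sq (s n j) (fun p => √((1 / 2 : ℝ) ^ p.1))
        (fun p => √((1 / 2 : ℝ) ^ p.1) * f p)
      simp only [mul_pow, ← mul_assoc] at h2
      have h3 : ∀ p : ℕ × ℕ, √((1 / 2 : ℝ) ^ p.1) ^ 2 = (1 / 2) ^ p.1 := fun p =>
        Real.sq_sqrt (by positivity)
      have h4 : ∀ p : ℕ × ℕ, √((1 / 2 : ℝ) ^ p.1) * √((1 / 2 : ℝ) ^ p.1) = (1 / 2) ^ p.1 :=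
        fun p => Real.mul_self_sqrt (by positivity)
      simp only [h3, h4] at h2
      rwa [sum_stoppedLeaves_weight] at h2
    have h5 : F n j ^ 2 / ((1 / 2) ^ n + M n j / P) ≤ G n j := by
      have h6 : 0 ≤ M n j / P := div_nonneg (hM0 n j) hP.le
      have h7 : 0 ≤ G n j := Finset.sum_nonneg fun p _ => by positivity
      rw [div_le_iff₀ (by positivity)]
      nlinarith
    exact mul_nonneg (by positivity) (by linarith)
  have hstep : ∀ n < m, ∀ j < 2 ^ n, A n j * (F n j / (1 / 2) ^ n) ^ 2 +
      V (n + 1) (2 * j) + V (n + 1) (2 * j + 1) ≤ V n j := by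
    intro n hn j hj
    have e1 : F n j = F (n + 1) (2 * j) + F (n + 1) (2 * j + 1) := hsplit _ n hn j hj
    have e2 : G n j = G (n + 1) (2 * j) + G (n + 1) (2 * j + 1) := hsplit _ n hn j hj
    have e3 := carleson_embedding_step (F₁ := F (n + 1) (2 * j)) (F₂ := F (n + 1) (2 * j + 1)) hP
      (ℓ := (1 / 2) ^ n) (by positivity) (hA0 n j) (hM0 _ _) (hM0 _ _) (hAM n j) (hMP n j)
    rw [← e1, show (1 / 2 : ℝ) ^ n / 2 = (1 / 2) ^ (n + 1) by rw [pow_succ]; ring] at e3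
    rw [hV]
    dsimp only
    rw [e2]
    linarith
  have htree := sum_tree_le (fun j _ => hV0 m j) hstep
  have hterm : ∀ n < m, ∀ j < 2 ^ n,
      (if dist (q n j) b < C₀ * r then A n j * (d n j * 2 ^ n) else 0) ≤
        C₁ * (A n j * (F n j / (1 / 2) ^ n) ^ 2) := by
    intro n hn j hj
    have hA0' := hA0 n j
    split_ifs with hd
    · have e1 := hdens b hb r ε hr hε (N - n) n j hj (hNn n hn) (hns n hn.le j hj)
      have e2 : ∑ p ∈ s n j with dist (q p.1 p.2) b ≤ C₁ * dist (q n j) b,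
          (1 / 2 : ℝ) ^ p.1 * √(d p.1 p.2 * 2 ^ p.1) ≤ F n j := by
        rw [Finset.sum_filter]
        refine Finset.sum_le_sum fun p _ => ?_
        split_ifs with hp
        · rw [hf]
          dsimp only
          rw [if_pos]
          refine hp.trans ?_
          rw [hR]
          gcongr
        · exact mul_nonneg (by positivity) (hf0 p)
      have e3 : F n j / (1 / 2) ^ n = 2 ^ n * F n j := by
        rw [one_div, inv_pow, div_inv_eq_mul, mul_comm]
      rw [e3]
      calc A n j * (d n j * 2 ^ n) ≤ A n j * (C₁ * (2 ^ n * F n j) ^ 2) := by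
            refine mul_le_mul_of_nonneg_left (e1.trans ?_) hA0'
            gcongr
        _ = _ := by ring
    · positivity
  have hG00 : G 0 0 ≤ B * (2 * R) := by
    have hbal := h.isBalanced_stoppedLeaves hb hε (n := 0) (j := 0) (k := N) (by norm_num)
      (by rw [zero_add]; exact hNs) (hns 0 (Nat.zero_le _) 0 (by norm_num))
    refine le_trans ?_ (hsum b hb r ε hr hε _ hbal b hb (2 * R) (by positivity))
    rw [Finset.sum_filter]
    refine Finset.sum_le_sum fun p _ => ?_
    have hd := h.pos p.1 p.2
    rw [hf]
    dsimp only
    by_cases hp : dist (q p.1 p.2) b ≤ R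
    · have hR0 : 0 < R := by positivity
      rw [if_pos hp, if_pos (by linarith), Real.sq_sqrt (by positivity), mul_left_comm,
        ← mul_pow]
      norm_num
    · rw [if_neg hp]
      split_ifs <;> simp [hd.le]
  have hV00 : V 0 0 ≤ 4 * P * (B * (2 * R)) := by
    refine mul_le_mul_of_nonneg_left ?_ (by positivity)
    have : 0 ≤ F 0 0 ^ 2 / ((1 / 2) ^ 0 + M 0 0 / P) := by
      have := hM0 0 0
      positivity
    linarith
  calc _ ≤ ∑ n ∈ Finset.range m, ∑ j ∈ Finset.range (2 ^ n),
        C₁ * (A n j * (F n j / (1 / 2) ^ n) ^ 2) :=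
        Finset.sum_le_sum fun n hn => Finset.sum_le_sum fun j hj =>
          hterm n (Finset.mem_range.1 hn) j (Finset.mem_range.1 hj)
    _ = C₁ * ∑ n ∈ Finset.range m, ∑ j ∈ Finset.range (2 ^ n),
        A n j * (F n j / (1 / 2) ^ n) ^ 2 := by simp only [Finset.mul_sum]
    _ ≤ C₁ * (4 * P * (B * (2 * R))) := by
        gcongr
        exact htree.trans hV00
    _ = _ := by rw [hR]; ring

end IsConformalTree

end ConformalTree

section DiscCover

/-- The covering map `ζ ↦ exp (2 π i ζ)` of the upper half-plane onto the punctured disk. -/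
noncomputable def discCover (ζ : ℂ) : ℂ := Complex.exp (2 * Real.pi * Complex.I * ζ)

theorem norm_discCover (ζ : ℂ) : ‖discCover ζ‖ = Real.exp (-(2 * Real.pi * ζ.im)) := by
  rw [discCover, Complex.norm_exp]
  congr 1
  simp

theorem norm_discCover_lt_one {ζ : ℂ} (hζ : 0 < ζ.im) : ‖discCover ζ‖ < 1 := by
  rw [norm_discCover, Real.exp_lt_one_iff]
  have := Real.pi_pos
  nlinarith [mul_pos this hζ]

theorem discCover_mem {ζ : ℂ} (hζ : 0 < ζ.im) : discCover ζ ∈ unitDisk :=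
  mem_ball_zero_iff.2 (norm_discCover_lt_one hζ)

theorem discCover_ne_zero (ζ : ℂ) : discCover ζ ≠ 0 := Complex.exp_ne_zero _

theorem hasDerivAt_discCover (ζ : ℂ) :
    HasDerivAt discCover (2 * Real.pi * Complex.I * discCover ζ) ζ := by
  have := ((hasDerivAt_id ζ).const_mul (2 * Real.pi * Complex.I : ℂ)).cexp
  rw [mul_one] at this
  exact this.congr_deriv (mul_comm _ _)

theorem exists_int_of_discCover_eq {ζ ζ' : ℂ} (h : discCover ζ = discCover ζ') :
    ∃ m : ℤ, ζ = ζ' + m := by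
  obtain ⟨m, hm⟩ := Complex.exp_eq_exp_iff_exists_int.1 h
  refine ⟨m, ?_⟩
  have h0 : (2 * Real.pi * Complex.I : ℂ) ≠ 0 := Complex.two_pi_I_ne_zero
  refine mul_left_cancel₀ h0 ?_
  rw [hm]
  ring

variable {φ : ℂ → ℂ}

theorem hasDerivAt_comp_discCover (hφ : DifferentiableOn ℂ φ unitDisk) {ζ : ℂ} (hζ : 0 < ζ.im) :
    HasDerivAt (φ ∘ discCover) (deriv φ (discCover ζ) * (2 * Real.pi * Complex.I * discCover ζ)) ζ :=
  ((hφ.differentiableAt (isOpen_unitDisk.mem_nhds (discCover_mem hζ))).hasDerivAt).comp ζ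
    (hasDerivAt_discCover ζ)

theorem norm_deriv_comp_discCover (hφ : DifferentiableOn ℂ φ unitDisk) {ζ : ℂ} (hζ : 0 < ζ.im) :
    ‖deriv (φ ∘ discCover) ζ‖ = ‖deriv φ (discCover ζ)‖ *
      (2 * Real.pi * Real.exp (-(2 * Real.pi * ζ.im))) := by
  rw [(hasDerivAt_comp_discCover hφ hζ).deriv, norm_mul, norm_mul, norm_discCover]
  simp [abs_of_pos Real.pi_pos]

theorem deriv_comp_discCover_ne_zero (hφ : DifferentiableOn ℂ φ unitDisk)
    (hinj : InjOn φ unitDisk) {ζ : ℂ} (hζ : 0 < ζ.im) : deriv (φ ∘ discCover) ζ ≠ 0 := by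
  rw [(hasDerivAt_comp_discCover hφ hζ).deriv]
  exact mul_ne_zero (deriv_ne_zero_of_injOn_ball hφ hinj (discCover_mem hζ))
    (mul_ne_zero Complex.two_pi_I_ne_zero (discCover_ne_zero ζ))

theorem isOpen_setOf_im_pos : IsOpen {ζ : ℂ | 0 < ζ.im} :=
  isOpen_lt continuous_const Complex.continuous_im

theorem differentiableOn_comp_discCover (hφ : DifferentiableOn ℂ φ unitDisk) :
    DifferentiableOn ℂ (φ ∘ discCover) {ζ : ℂ | 0 < ζ.im} := fun _ hζ =>
  (hasDerivAt_comp_discCover hφ hζ).differentiableAt.differentiableWithinAt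

theorem im_mem_of_mem_ball {ζ ξ : ℂ} {ρ : ℝ} (h : ξ ∈ ball ζ ρ) :
    ζ.im - ρ < ξ.im ∧ ξ.im < ζ.im + ρ := by
  rw [mem_ball, dist_eq_norm] at h
  have := abs_lt.1 ((Complex.abs_im_le_norm _).trans_lt h)
  rw [Complex.sub_im] at this
  constructor <;> linarith

theorem injOn_comp_discCover (hinj : InjOn φ unitDisk) {ζ : ℂ} {ρ : ℝ} (hρ : ρ ≤ ζ.im)
    (hρ2 : ρ ≤ 1 / 2) : InjOn (φ ∘ discCover) (ball ζ ρ) := by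
  intro ξ hξ ξ' hξ' he
  have h1 := (im_mem_of_mem_ball hξ).1
  have h2 := (im_mem_of_mem_ball hξ').1
  obtain ⟨m, hm⟩ := exists_int_of_discCover_eq
    (hinj (discCover_mem (by linarith)) (discCover_mem (by linarith)) he)
  have h3 : dist ξ ξ' < 1 := by
    rw [mem_ball] at hξ hξ'
    linarith [dist_triangle_right ξ ξ' ζ]
  rw [dist_eq_norm, hm, add_sub_cancel_left, Complex.norm_intCast] at h3
  have h4 : |m| < 1 := by exact_mod_cast h3
  rw [Int.abs_lt_one_iff] at h4
  simpa [h4] using hm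

/-- A logarithm of the derivative in the half-plane, which is Lipschitz in the hyperbolic metric. -/
theorem exists_log_deriv_comp_discCover : ∃ C : ℝ, 0 < C ∧ ∀ φ : ℂ → ℂ,
    DifferentiableOn ℂ φ unitDisk → InjOn φ unitDisk → ∃ g g' : ℂ → ℂ, ∀ ζ : ℂ, 0 < ζ.im →
      HasDerivAt g (g' ζ) ζ ∧ Complex.exp (g ζ) = deriv (φ ∘ discCover) ζ ∧
      (ζ.im ≤ 1 → ‖g' ζ‖ ≤ C / ζ.im) := by
  obtain ⟨C, hC, hdist⟩ := exists_norm_deriv_deriv_le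
  refine ⟨2 * C, by positivity, fun φ hφ hinj => ?_⟩
  obtain ⟨L, hL, hLexp⟩ := exists_log_on_ball (hφ.deriv isOpen_unitDisk) fun z hz =>
    deriv_ne_zero_of_injOn_ball hφ hinj hz
  set g : ℂ → ℂ := fun ζ => L (discCover ζ) + 2 * Real.pi * Complex.I * ζ +
    Complex.log (2 * Real.pi * Complex.I) with hg
  have hgd : ∀ ζ : ℂ, 0 < ζ.im → DifferentiableAt ℂ g ζ := by
    intro ζ hζ
    have h1 := (hL _ (discCover_mem hζ)).differentiableAt.comp ζ
      (hasDerivAt_discCover ζ).differentiableAt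
    exact (h1.add ((differentiableAt_id).const_mul _)).add_const _
  have hgexp : ∀ ζ : ℂ, 0 < ζ.im → Complex.exp (g ζ) = deriv (φ ∘ discCover) ζ := by
    intro ζ hζ
    rw [(hasDerivAt_comp_discCover hφ hζ).deriv, hg]
    dsimp only
    rw [Complex.exp_add, Complex.exp_add, Complex.exp_log Complex.two_pi_I_ne_zero,
      hLexp _ (discCover_mem hζ), discCover]
    ring
  refine ⟨g, deriv g, fun ζ hζ => ⟨(hgd ζ hζ).hasDerivAt, hgexp ζ hζ, fun hζ1 => ?_⟩⟩
  have h1 : HasDerivAt (deriv (φ ∘ discCover)) (Complex.exp (g ζ) * deriv g ζ) ζ := by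
    refine (hgd ζ hζ).hasDerivAt.cexp.congr_of_eventuallyEq ?_
    filter_upwards [isOpen_setOf_im_pos.mem_nhds hζ] with ξ hξ
    exact (hgexp ξ hξ).symm
  have h2 := hdist (φ ∘ discCover) ζ (ζ.im / 2)
    ((differentiableOn_comp_discCover hφ).mono fun ξ hξ => by
      have := (im_mem_of_mem_ball hξ).1
      change 0 < ξ.im
      linarith)
    (injOn_comp_discCover hinj (by linarith) (by linarith)) (by linarith)
  rw [h1.deriv, hgexp ζ hζ, norm_mul] at h2
  have h3 : 0 < ‖deriv (φ ∘ discCover) ζ‖ :=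
    norm_pos_iff.2 (deriv_comp_discCover_ne_zero hφ hinj hζ)
  rw [le_div_iff₀ hζ]
  have h4 : ‖deriv (φ ∘ discCover) ζ‖ * (‖deriv g ζ‖ * ζ.im) ≤
      ‖deriv (φ ∘ discCover) ζ‖ * (2 * C) := by linarith
  exact le_of_mul_le_mul_left h4 h3

theorem norm_sub_le_of_norm_deriv_le {g g' : ℂ → ℂ} {C : ℝ} (hC : 0 ≤ C)
    (hg : ∀ ζ : ℂ, 0 < ζ.im → HasDerivAt g (g' ζ) ζ)
    (hg' : ∀ ζ : ℂ, 0 < ζ.im → ζ.im ≤ 1 → ‖g' ζ‖ ≤ C / ζ.im) {ζ ζ' : ℂ} {y : ℝ} (hy : 0 < y)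
    (h1 : y ≤ ζ.im) (h2 : ζ.im ≤ 1) (h1' : y ≤ ζ'.im) (h2' : ζ'.im ≤ 1) :
    ‖g ζ - g ζ'‖ ≤ C / y * ‖ζ - ζ'‖ := by
  have hconv : Convex ℝ {ξ : ℂ | y ≤ ξ.im ∧ ξ.im ≤ 1} :=
    (convex_halfSpace_im_ge y).inter (convex_halfSpace_im_le 1)
  refine hconv.norm_image_sub_le_of_norm_hasDerivWithin_le (f' := g')
    (fun ξ hξ => (hg ξ (hy.trans_le hξ.1)).hasDerivWithinAt) (fun ξ hξ => ?_) ⟨h1', h2'⟩ ⟨h1, h2⟩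
  refine (hg' ξ (hy.trans_le hξ.1) hξ.2).trans ?_
  gcongr
  exact hξ.1

theorem norm_sub_le_log_of_norm_deriv_le {g g' : ℂ → ℂ} {C : ℝ}
    (hg : ∀ ζ : ℂ, 0 < ζ.im → HasDerivAt g (g' ζ) ζ)
    (hg' : ∀ ζ : ℂ, 0 < ζ.im → ζ.im ≤ 1 → ‖g' ζ‖ ≤ C / ζ.im) {x t l : ℝ} (ht : 0 < t)
    (htl : t ≤ l) (hl : l ≤ 1) :
    ‖g (x + t * Complex.I) - g (x + l * Complex.I)‖ ≤ C * (Real.log l - Real.log t) := by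
  set k : ℝ → ℂ := fun s => g (x + (Real.exp s : ℝ) * Complex.I) with hk
  have him : ∀ s : ℝ, ((x : ℂ) + (Real.exp s : ℝ) * Complex.I).im = Real.exp s := fun s => by
    simp [-Complex.ofReal_exp]
  have hkd : ∀ s : ℝ, HasDerivAt k (g' (x + (Real.exp s : ℝ) * Complex.I) *
      ((Real.exp s : ℝ) * Complex.I)) s := by
    intro s
    have h1 : HasDerivAt (fun s : ℝ => (x : ℂ) + (Real.exp s : ℝ) * Complex.I)
        ((Real.exp s : ℝ) * Complex.I) s :=
      (((Real.hasDerivAt_exp s).ofReal_comp).mul_const Complex.I).const_add _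
    exact (hg _ (by rw [him]; exact Real.exp_pos s)).comp_of_eq s h1 rfl
  have hl0 : 0 < l := ht.trans_le htl
  have := (convex_Icc (Real.log t) (Real.log l)).norm_image_sub_le_of_norm_hasDerivWithin_le
    (f := k) (C := C) (fun s _ => (hkd s).hasDerivWithinAt) (fun s hs => by
      have e1 : Real.exp s ≤ 1 := by
        refine (Real.exp_le_exp.2 hs.2).trans ?_
        rwa [Real.exp_log hl0]
      have e2 := hg' (x + (Real.exp s : ℝ) * Complex.I) (by rw [him]; exact Real.exp_pos s)
        (by rwa [him])
      rw [him, le_div_iff₀ (Real.exp_pos s)] at e2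
      rw [norm_mul, norm_mul, Complex.norm_I, mul_one, Complex.norm_real, Real.norm_eq_abs,
        Real.abs_exp]
      exact e2)
    (right_mem_Icc.2 (Real.log_le_log ht htl)) (left_mem_Icc.2 (Real.log_le_log ht htl))
  rw [hk] at this
  dsimp only at this
  rw [Real.exp_log ht, Real.exp_log hl0, Real.norm_eq_abs, abs_sub_comm,
    abs_of_nonneg (sub_nonneg.2 (Real.log_le_log ht htl))] at this
  exact this

end DiscCover

section DiscCover

theorem norm_integral_sub_le_of_norm_deriv_le {g g' : ℂ → ℂ} {C : ℝ} (hC : 0 ≤ C)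
    (hg : ∀ ζ : ℂ, 0 < ζ.im → HasDerivAt g (g' ζ) ζ)
    (hg' : ∀ ζ : ℂ, 0 < ζ.im → ζ.im ≤ 1 → ‖g' ζ‖ ≤ C / ζ.im) (a : ℝ) {y l : ℝ} (hy : 0 < y)
    (hyl : y ≤ l) (hl : l ≤ 1) :
    ‖(∫ x in a..(a + l), g (x + y * Complex.I)) - l * g (a + l * Complex.I)‖ ≤ 4 * C * l := by
  have hl0 : 0 < l := hy.trans_le hyl
  have him : ∀ x t : ℝ, ((x : ℂ) + t * Complex.I).im = t := fun x t => by simp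
  have hcont : ContinuousOn g {ζ : ℂ | 0 < ζ.im} := fun ζ hζ =>
    (hg ζ hζ).continuousAt.continuousWithinAt
  have hhor : ∀ t : ℝ, 0 < t → ∀ b c : ℝ, IntervalIntegrable
      (fun x : ℝ => g (x + t * Complex.I)) volume b c := fun t ht b c =>
    (hcont.comp_continuous (by fun_prop) fun x => by
      change 0 < ((x : ℂ) + t * Complex.I).im
      rwa [him]).intervalIntegrable _ _
  have hver : ∀ b : ℝ, IntervalIntegrable
      (fun t : ℝ => g (b + t * Complex.I)) volume y l := fun b => by
    refine (hcont.comp (by fun_prop) fun t ht => ?_).intervalIntegrable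
    rw [uIcc_of_le hyl] at ht
    change 0 < ((b : ℂ) + t * Complex.I).im
    rw [him]
    exact hy.trans_le ht.1
  have htop : ‖(∫ x in a..(a + l), g (x + l * Complex.I)) - l * g (a + l * Complex.I)‖ ≤ C * l := by
    have h1 : (∫ x in a..(a + l), g (x + l * Complex.I)) - l * g (a + l * Complex.I) =
        ∫ x in a..(a + l), (g (x + l * Complex.I) - g (a + l * Complex.I)) := by
      rw [intervalIntegral.integral_sub (hhor l hl0 _ _) intervalIntegrable_const,
        intervalIntegral.integral_const, add_sub_cancel_left, Complex.real_smul]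
    rw [h1]
    have h2 := intervalIntegral.norm_integral_le_of_norm_le_const (a := a) (b := a + l) (C := C)
      (f := fun x : ℝ => g (x + l * Complex.I) - g (a + l * Complex.I)) (fun x hx => by
        rw [uIoc_of_le (by linarith)] at hx
        have h3 := norm_sub_le_of_norm_deriv_le hC hg hg' hl0 (ζ := x + l * Complex.I)
          (ζ' := a + l * Complex.I) (him x l).ge ((him x l).le.trans hl) (him a l).ge
          ((him a l).le.trans hl)
        refine h3.trans ?_
        rw [add_sub_add_right_eq_sub, ← Complex.ofReal_sub, Complex.norm_real, Real.norm_eq_abs,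
          abs_of_nonneg (by linarith [hx.1]), div_mul_eq_mul_div, div_le_iff₀ hl0]
        gcongr
        linarith [hx.2])
    rwa [add_sub_cancel_left, abs_of_pos hl0] at h2
  have hrect := Complex.integral_boundary_rect_eq_zero_of_differentiableOn g
    (a + y * Complex.I) ((a + l : ℝ) + l * Complex.I) (fun ζ hζ => by
      refine (hg ζ ?_).differentiableAt.differentiableWithinAt
      have h1 := (Complex.mem_reProdIm.1 hζ).2
      rw [him, him, uIcc_of_le hyl] at h1
      exact hy.trans_le h1.1)
  have hre : ∀ x t : ℝ, ((x : ℂ) + t * Complex.I).re = x := fun x t => by simp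
  simp only [him, hre] at hrect
  have hside : ‖(∫ t in y..l, g ((a + l : ℝ) + t * Complex.I)) -
      ∫ t in y..l, g (a + t * Complex.I)‖ ≤ 3 * C * l := by
    rw [← intervalIntegral.integral_sub (hver _) (hver _)]
    have hlogi : IntervalIntegrable Real.log volume y l := intervalIntegral.intervalIntegrable_log'
    have hbi : IntervalIntegrable (fun t : ℝ => C + 2 * C * (Real.log l - Real.log t)) volume y l :=
      (intervalIntegrable_const).add ((intervalIntegrable_const.sub hlogi).const_mul _)
    have h1 := intervalIntegral.norm_integral_le_of_norm_le hyl
      (f := fun t : ℝ => g ((a + l : ℝ) + t * Complex.I) - g (a + t * Complex.I))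
      (Filter.Eventually.of_forall fun t ht => by
        have ht0 : 0 < t := hy.trans ht.1
        have e1 := norm_sub_le_log_of_norm_deriv_le hg hg' (x := a + l) ht0 ht.2 hl
        have e2 := norm_sub_le_log_of_norm_deriv_le hg hg' (x := a) ht0 ht.2 hl
        have e3 := norm_sub_le_of_norm_deriv_le hC hg hg' hl0 (ζ := (a + l : ℝ) + l * Complex.I)
          (ζ' := a + l * Complex.I) (him _ l).ge ((him _ l).le.trans hl) (him a l).ge
          ((him a l).le.trans hl)
        rw [add_sub_add_right_eq_sub, ← Complex.ofReal_sub, Complex.norm_real, Real.norm_eq_abs,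
          add_sub_cancel_left, abs_of_pos hl0, div_mul_cancel₀ _ hl0.ne'] at e3
        have e4 := norm_add₃_le
          (a := g ((a + l : ℝ) + t * Complex.I) - g ((a + l : ℝ) + l * Complex.I))
          (b := g ((a + l : ℝ) + l * Complex.I) - g (a + l * Complex.I))
          (c := g (a + l * Complex.I) - g (a + t * Complex.I))
        rw [norm_sub_rev (g (a + l * Complex.I)), sub_add_sub_cancel, sub_add_sub_cancel] at e4
        show _ ≤ C + 2 * C * (Real.log l - Real.log t)
        linarith) hbi
    refine h1.trans ?_
    rw [intervalIntegral.integral_add intervalIntegrable_const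
      ((intervalIntegrable_const.sub hlogi).const_mul _), intervalIntegral.integral_const_mul,
      intervalIntegral.integral_sub intervalIntegrable_const hlogi, intervalIntegral.integral_const,
      intervalIntegral.integral_const, integral_log, smul_eq_mul, smul_eq_mul]
    have h2 := mul_nonneg hy.le (sub_nonneg.2 (Real.log_le_log hy hyl))
    have h3 : (l - y) * C ≤ C * l := by nlinarith
    have h4 : (l - y) * Real.log l - (l * Real.log l - y * Real.log y - l + y) ≤ l := by
      linarith
    have := mul_le_mul_of_nonneg_left h4 (by positivity : 0 ≤ 2 * C)
    linarith
  have hbt : (∫ x in a..(a + l), g (x + y * Complex.I)) - ∫ x in a..(a + l), g (x + l * Complex.I) =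
      -(Complex.I • ((∫ t in y..l, g ((a + l : ℝ) + t * Complex.I)) -
        ∫ t in y..l, g (a + t * Complex.I))) := by
    rw [smul_sub]
    linear_combination hrect
  calc _ = ‖((∫ x in a..(a + l), g (x + y * Complex.I)) -
        ∫ x in a..(a + l), g (x + l * Complex.I)) +
        ((∫ x in a..(a + l), g (x + l * Complex.I)) - l * g (a + l * Complex.I))‖ := by
        rw [sub_add_sub_cancel]
    _ ≤ 3 * C * l + C * l := by
        refine (norm_add_le _ _).trans (add_le_add ?_ htop)
        rw [hbt, norm_neg, norm_smul, Complex.norm_I, one_mul]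
        exact hside
    _ = _ := by ring

end DiscCover

section DistanceEstimates

variable {φ : ℂ → ℂ}

theorem norm_deriv_mul_one_sub_norm_le (hφ : DifferentiableOn ℂ φ unitDisk)
    (hinj : InjOn φ unitDisk) (hne : φ '' unitDisk ≠ univ) {z : ℂ} (hz : z ∈ unitDisk) :
    ‖deriv φ z‖ * (1 - ‖z‖) ≤ 784 * infDist (φ z) (φ '' unitDisk)ᶜ := by
  have hz1 : ‖z‖ < 1 := mem_ball_zero_iff.1 hz
  have hsub : ball z (1 - ‖z‖) ⊆ unitDisk := ball_subset_ball' (by simp)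
  have h0 : (784 : ℝ)⁻¹ * (‖deriv φ z‖ * (1 - ‖z‖)) ≤ infDist (φ z) (φ '' unitDisk)ᶜ := by
    refine (le_infDist (nonempty_compl.2 hne)).2 fun a ha => ?_
    have := norm_deriv_mul_le_of_notMem_image (hφ.mono hsub) (hinj.mono hsub) (sub_pos.2 hz1)
      (a := a) fun h => ha (image_mono hsub h)
    rw [dist_eq_norm]
    linarith
  linarith

theorem infDist_compl_le_mul_one_sub_norm (hφ : DifferentiableOn ℂ φ unitDisk)
    (hinj : InjOn φ unitDisk) {z : ℂ} (hz : z ∈ unitDisk) (hz0 : z ≠ 0) :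
    infDist (φ z) (φ '' unitDisk)ᶜ ≤ 784 * ‖deriv φ z‖ * (1 - ‖z‖) := by
  have hz1 : ‖z‖ < 1 := mem_ball_zero_iff.1 hz
  have hn0 : 0 < ‖z‖ := norm_pos_iff.2 hz0
  rcases infDist_nonneg.eq_or_lt (a := (0 : ℝ)) (b := infDist (φ z) (φ '' unitDisk)ᶜ) with h | h
  · rw [← h]
    have := sub_pos.2 hz1
    positivity
  have hb : z / ‖z‖ ∉ ball (0 : ℂ) 1 := by
    simp [hn0.ne']
  have hd : dist z (z / ‖z‖) = 1 - ‖z‖ := by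
    have : z - z / ‖z‖ = (((‖z‖ - 1) / ‖z‖ : ℝ) : ℂ) * z := by
      have : (‖z‖ : ℂ) ≠ 0 := by exact_mod_cast hn0.ne'
      push_cast
      field_simp
    rw [dist_eq_norm, this, norm_mul, Complex.norm_real, Real.norm_eq_abs, abs_div, abs_norm,
      div_mul_cancel₀ _ hn0.ne', abs_of_neg (by linarith)]
    ring
  have := le_of_ball_subset_image hφ hinj hz h ball_infDist_compl_subset hb
  rwa [hd] at this

theorem norm_deriv_comp_discCover_mul_im_le (hφ : DifferentiableOn ℂ φ unitDisk)
    (hinj : InjOn φ unitDisk) (hne : φ '' unitDisk ≠ univ) {ζ : ℂ} (hζ : 0 < ζ.im) :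
    ‖deriv (φ ∘ discCover) ζ‖ * ζ.im ≤ 784 * infDist (φ (discCover ζ)) (φ '' unitDisk)ᶜ := by
  refine le_trans ?_ (norm_deriv_mul_one_sub_norm_le hφ hinj hne (discCover_mem hζ))
  rw [norm_deriv_comp_discCover hφ hζ, norm_discCover, mul_assoc]
  refine mul_le_mul_of_nonneg_left ?_ (norm_nonneg _)
  have h1 := Real.add_one_le_exp (2 * Real.pi * ζ.im)
  have h2 : Real.exp (2 * Real.pi * ζ.im) * Real.exp (-(2 * Real.pi * ζ.im)) = 1 := by
    rw [← Real.exp_add, add_neg_cancel, Real.exp_zero]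
  have := mul_le_mul_of_nonneg_right h1 (Real.exp_pos (-(2 * Real.pi * ζ.im))).le
  rw [h2] at this
  linarith

theorem infDist_comp_discCover_le (hφ : DifferentiableOn ℂ φ unitDisk)
    (hinj : InjOn φ unitDisk) {ζ : ℂ} (hζ : 0 < ζ.im) (hζ1 : ζ.im ≤ 1) :
    infDist (φ (discCover ζ)) (φ '' unitDisk)ᶜ ≤
      784 * Real.exp (2 * Real.pi) * (‖deriv (φ ∘ discCover) ζ‖ * ζ.im) := by
  refine (infDist_compl_le_mul_one_sub_norm hφ hinj (discCover_mem hζ)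
    (discCover_ne_zero ζ)).trans ?_
  rw [norm_deriv_comp_discCover hφ hζ, norm_discCover]
  have hpi := Real.pi_pos
  have h1 : 1 - Real.exp (-(2 * Real.pi * ζ.im)) ≤ 2 * Real.pi * ζ.im := by
    linarith [Real.add_one_le_exp (-(2 * Real.pi * ζ.im))]
  have h2 : 1 ≤ Real.exp (2 * Real.pi) * Real.exp (-(2 * Real.pi * ζ.im)) := by
    rw [← Real.exp_add]
    exact Real.one_le_exp (by nlinarith)
  calc _ ≤ 784 * ‖deriv φ (discCover ζ)‖ * (2 * Real.pi * ζ.im) := by gcongr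
    _ ≤ 784 * ‖deriv φ (discCover ζ)‖ * (2 * Real.pi * ζ.im) *
        (Real.exp (2 * Real.pi) * Real.exp (-(2 * Real.pi * ζ.im))) :=
      le_mul_of_one_le_right (by positivity) h2
    _ = _ := by ring

end DistanceEstimates

section DyadicPoints

/-- The dyadic points of the upper half-plane. -/
noncomputable def dyadicPoint (n j : ℕ) : ℂ := ((j / 2 ^ n : ℝ) : ℂ) + ((1 / 2 : ℝ) ^ n : ℝ) * Complex.I

theorem re_dyadicPoint (n j : ℕ) : (dyadicPoint n j).re = j / 2 ^ n := by
  simp [dyadicPoint, -Complex.ofReal_div, -Complex.ofReal_pow]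

theorem im_dyadicPoint (n j : ℕ) : (dyadicPoint n j).im = (1 / 2) ^ n := by
  simp [dyadicPoint, -Complex.ofReal_div, -Complex.ofReal_pow]

theorem im_dyadicPoint_pos (n j : ℕ) : 0 < (dyadicPoint n j).im := by
  rw [im_dyadicPoint]; positivity

theorem im_dyadicPoint_le (n j : ℕ) : (dyadicPoint n j).im ≤ 1 := by
  rw [im_dyadicPoint]; exact pow_le_one₀ (by norm_num) (by norm_num)

theorem norm_dyadicPoint_sub_le (n i : ℕ) :
    ‖dyadicPoint (n + 1) i - dyadicPoint n (i / 2)‖ ≤ (1 / 2) ^ n := by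
  refine (Complex.norm_le_abs_re_add_abs_im _).trans ?_
  rw [Complex.sub_re, Complex.sub_im, re_dyadicPoint, re_dyadicPoint, im_dyadicPoint,
    im_dyadicPoint]
  have h1 : (i : ℝ) = 2 * (i / 2 : ℕ) + (i % 2 : ℕ) := by exact_mod_cast (Nat.div_add_mod i 2).symm
  have h2 : ((i % 2 : ℕ) : ℝ) ≤ 1 := by exact_mod_cast Nat.lt_succ_iff.1 (Nat.mod_lt i two_pos)
  have h3 : (i : ℝ) / 2 ^ (n + 1) - (i / 2 : ℕ) / 2 ^ n = (i % 2 : ℕ) * (1 / 2) ^ (n + 1) := by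
    rw [h1, pow_succ, one_div, inv_pow, pow_succ]
    field_simp
    ring
  have h4 : (1 / 2 : ℝ) ^ (n + 1) - (1 / 2) ^ n = -((1 / 2) ^ (n + 1)) := by ring
  rw [h3, h4, abs_neg, abs_of_nonneg (by positivity), abs_of_nonneg (by positivity)]
  have h5 : (0 : ℝ) < (1 / 2) ^ (n + 1) := by positivity
  calc _ ≤ 1 * (1 / 2 : ℝ) ^ (n + 1) + (1 / 2) ^ (n + 1) := by gcongr
    _ = _ := by ring

theorem eq_of_norm_dyadicPoint_sub_lt {n j n' j' : ℕ} {ξ ξ' : ℂ} {m : ℤ}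
    (hξ : ξ ∈ ball (dyadicPoint n j) ((1 / 2) ^ n / 4))
    (hξ' : ξ' ∈ ball (dyadicPoint n' j') ((1 / 2) ^ n' / 4)) (hm : ξ = ξ' + m)
    (hj : j < 2 ^ n) (hj' : j' < 2 ^ n') : (n, j) = (n', j') := by
  have him : ξ.im = ξ'.im := by simp [hm]
  have h1 := im_mem_of_mem_ball hξ
  have h2 := im_mem_of_mem_ball hξ'
  rw [im_dyadicPoint] at h1 h2
  have hmono : ∀ a b : ℕ, a < b → (1 / 2 : ℝ) ^ b ≤ (1 / 2) ^ a / 2 := fun a b hab => by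
    calc (1 / 2 : ℝ) ^ b ≤ (1 / 2) ^ (a + 1) :=
          pow_le_pow_of_le_one (by norm_num) (by norm_num) hab
      _ = _ := by ring
  have hn : n = n' := by
    rcases lt_trichotomy n n' with h | h | h
    · have := hmono _ _ h
      have : (0 : ℝ) < (1 / 2) ^ n := by positivity
      linarith
    · exact h
    · have := hmono _ _ h
      have : (0 : ℝ) < (1 / 2) ^ n' := by positivity
      linarith
  subst hn
  rw [mem_ball, dist_eq_norm] at hξ hξ'
  have e1 := abs_lt.1 ((Complex.abs_re_le_norm _).trans_lt hξ)
  have e2 := abs_lt.1 ((Complex.abs_re_le_norm _).trans_lt hξ')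
  have hre : ξ.re = ξ'.re + m := by simp [hm]
  rw [Complex.sub_re, re_dyadicPoint] at e1 e2
  have hp : (0 : ℝ) < 2 ^ n := by positivity
  have hlt : |(j : ℝ) - j' - m * 2 ^ n| < 1 := by
    have h3 : (j : ℝ) - j' - m * 2 ^ n = ((j : ℝ) / 2 ^ n - j' / 2 ^ n - m) * 2 ^ n := by
      field_simp
    have h4 : (1 / 2 : ℝ) ^ n * 2 ^ n = 1 := by rw [← mul_pow]; norm_num
    rw [h3, abs_mul, abs_of_pos hp, ← h4]
    refine mul_lt_mul_of_pos_right ?_ hp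
    rw [abs_lt]
    constructor <;> linarith [(show (0 : ℝ) < (1 / 2) ^ n by positivity)]
  have hz : (j : ℤ) - j' - m * 2 ^ n = 0 := by
    rw [← Int.abs_lt_one_iff]
    exact_mod_cast hlt
  have hm0 : m = 0 := by
    have a1 : (j : ℤ) < 2 ^ n := by exact_mod_cast hj
    have a2 : (j' : ℤ) < 2 ^ n := by exact_mod_cast hj'
    by_contra hm0
    rcases lt_or_gt_of_ne hm0 with h | h <;> nlinarith
  rw [hm0] at hz
  have : j = j' := by omega
  rw [this]

end DyadicPoints

section TreeOfDyadicPoints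

theorem exists_distortion_comp_discCover : ∃ E : ℝ, 1 ≤ E ∧ ∀ φ : ℂ → ℂ,
    DifferentiableOn ℂ φ unitDisk → InjOn φ unitDisk → ∀ y : ℝ, 0 < y → ∀ ζ ζ' : ℂ,
      y ≤ ζ.im → ζ.im ≤ 1 → y ≤ ζ'.im → ζ'.im ≤ 1 → ‖ζ - ζ'‖ ≤ 4 * y →
      ‖deriv (φ ∘ discCover) ζ‖ ≤ E * ‖deriv (φ ∘ discCover) ζ'‖ ∧
      dist (φ (discCover ζ)) (φ (discCover ζ')) ≤ E * (‖deriv (φ ∘ discCover) ζ'‖ * (4 * y)) := by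
  obtain ⟨C, hC, hlog⟩ := exists_log_deriv_comp_discCover
  refine ⟨Real.exp (C * 4), Real.one_le_exp (by positivity), fun φ hφ hinj => ?_⟩
  obtain ⟨g, g', hg⟩ := hlog φ hφ hinj
  have key : ∀ y : ℝ, 0 < y → ∀ ζ ζ' : ℂ, y ≤ ζ.im → ζ.im ≤ 1 → y ≤ ζ'.im → ζ'.im ≤ 1 →
      ‖ζ - ζ'‖ ≤ 4 * y →
      ‖deriv (φ ∘ discCover) ζ‖ ≤ Real.exp (C * 4) * ‖deriv (φ ∘ discCover) ζ'‖ := by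
    intro y hy ζ ζ' h1 h2 h1' h2' h
    rw [← (hg ζ (hy.trans_le h1)).2.1, ← (hg ζ' (hy.trans_le h1')).2.1, Complex.norm_exp,
      Complex.norm_exp, ← Real.exp_add, Real.exp_le_exp]
    have e1 := norm_sub_le_of_norm_deriv_le hC.le (fun ζ hζ => (hg ζ hζ).1)
      (fun ζ hζ => (hg ζ hζ).2.2) hy h1 h2 h1' h2'
    have e2 := (Complex.abs_re_le_norm _).trans e1
    rw [Complex.sub_re] at e2
    have e3 : C / y * ‖ζ - ζ'‖ ≤ C * 4 := by
      rw [div_mul_eq_mul_div, div_le_iff₀ hy]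
      nlinarith
    linarith [le_abs_self ((g ζ).re - (g ζ').re)]
  intro y hy ζ ζ' h1 h2 h1' h2' h
  refine ⟨key y hy ζ ζ' h1 h2 h1' h2' h, ?_⟩
  have hconv : Convex ℝ ({ξ : ℂ | y ≤ ξ.im ∧ ξ.im ≤ 1} ∩ closedBall ζ' (4 * y)) :=
    ((convex_halfSpace_im_ge y).inter (convex_halfSpace_im_le 1)).inter (convex_closedBall _ _)
  have := hconv.norm_image_sub_le_of_norm_deriv_le (𝕜 := ℂ) (f := φ ∘ discCover)
    (C := Real.exp (C * 4) * ‖deriv (φ ∘ discCover) ζ'‖)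
    (fun ξ hξ => (hasDerivAt_comp_discCover hφ (hy.trans_le hξ.1.1)).differentiableAt)
    (fun ξ hξ => key y hy ξ ζ' hξ.1.1 hξ.1.2 h1' h2' (mem_closedBall_iff_norm.1 hξ.2))
    (x := ζ') (y := ζ) ⟨⟨h1', h2'⟩, mem_closedBall_self (by positivity)⟩
    ⟨⟨h1, h2⟩, mem_closedBall_iff_norm.2 h⟩
  rw [dist_eq_norm]
  refine this.trans ?_
  rw [← mul_assoc]
  gcongr

theorem exists_isConformalTree : ∃ K : ℝ, ∀ φ : ℂ → ℂ, DifferentiableOn ℂ φ unitDisk →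
    InjOn φ unitDisk → φ '' unitDisk ≠ univ → IsConformalTree (φ '' unitDisk) K
      (fun n j => φ (discCover (dyadicPoint n j)))
      (fun n j => ‖deriv (φ ∘ discCover) (dyadicPoint n j)‖ * (1 / 2) ^ n) := by
  obtain ⟨C, hC, hlog⟩ := exists_log_deriv_comp_discCover
  obtain ⟨E, hE, hdist⟩ := exists_distortion_comp_discCover
  have hexp := Real.exp_pos (2 * Real.pi)
  set K : ℝ := 784 * Real.exp (2 * Real.pi) + 2 * E + 3136 + 4 * C with hK
  have hpar : ∀ (n i : ℕ), (1 / 2 : ℝ) ^ (n + 1) ≤ (dyadicPoint n (i / 2)).im ∧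
      (1 / 2 : ℝ) ^ (n + 1) ≤ (dyadicPoint (n + 1) i).im ∧
      ‖dyadicPoint n (i / 2) - dyadicPoint (n + 1) i‖ ≤ 4 * (1 / 2 : ℝ) ^ (n + 1) := by
    intro n i
    rw [im_dyadicPoint, im_dyadicPoint, norm_sub_rev]
    have h0 : (0 : ℝ) < (1 / 2) ^ n := by positivity
    refine ⟨?_, le_rfl, (norm_dyadicPoint_sub_le n i).trans ?_⟩ <;> rw [pow_succ] <;> linarith
  have h2 : ∀ n : ℕ, (1 / 2 : ℝ) ^ n * 2 ^ n = 1 := fun n => by rw [← mul_pow]; norm_num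
  refine ⟨K, fun φ hφ hinj hne => ?_⟩
  set ψ := φ ∘ discCover with hψ
  have hpos : ∀ n j, 0 < ‖deriv ψ (dyadicPoint n j)‖ := fun n j =>
    norm_pos_iff.2 (deriv_comp_discCover_ne_zero hφ hinj (im_dyadicPoint_pos n j))
  refine ⟨by linarith, fun n j => mem_image_of_mem _ (discCover_mem (im_dyadicPoint_pos n j)),
    fun n j => mul_pos (hpos n j) (by positivity), fun n j => ?_, fun n j => ?_, fun n i => ?_,
    fun n i => ?_, fun p p' hpp' hp hp' => ?_, fun N => ?_⟩
  · have := norm_deriv_comp_discCover_mul_im_le hφ hinj hne (im_dyadicPoint_pos n j)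
    rw [im_dyadicPoint] at this
    refine this.trans (mul_le_mul_of_nonneg_right ?_ infDist_nonneg)
    have := Real.one_le_exp (x := 2 * Real.pi) (by positivity)
    linarith
  · have := infDist_comp_discCover_le hφ hinj (im_dyadicPoint_pos n j) (im_dyadicPoint_le n j)
    rw [im_dyadicPoint] at this
    refine this.trans (mul_le_mul_of_nonneg_right ?_ (by positivity))
    linarith
  · obtain ⟨e1, e2, e3⟩ := hpar n i
    have := (hdist φ hφ hinj _ (by positivity) _ _ e1 (im_dyadicPoint_le _ _) e2
      (im_dyadicPoint_le _ _) e3).1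
    calc ‖deriv ψ (dyadicPoint n (i / 2))‖ * (1 / 2) ^ n
        ≤ E * ‖deriv ψ (dyadicPoint (n + 1) i)‖ * (1 / 2) ^ n := by gcongr
      _ = 2 * E * (‖deriv ψ (dyadicPoint (n + 1) i)‖ * (1 / 2) ^ (n + 1)) := by ring
      _ ≤ K * (‖deriv ψ (dyadicPoint (n + 1) i)‖ * (1 / 2) ^ (n + 1)) := by
        refine mul_le_mul_of_nonneg_right ?_ (by positivity)
        linarith
  · obtain ⟨e1, e2, e3⟩ := hpar n i
    rw [norm_sub_rev] at e3
    have := (hdist φ hφ hinj _ (by positivity) _ _ e2 (im_dyadicPoint_le _ _) e1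
      (im_dyadicPoint_le _ _) e3).2
    calc _ ≤ _ := this
      _ = 2 * E * (‖deriv ψ (dyadicPoint n (i / 2))‖ * (1 / 2) ^ n) := by ring
      _ ≤ K * (‖deriv ψ (dyadicPoint n (i / 2))‖ * (1 / 2) ^ n) := by
        refine mul_le_mul_of_nonneg_right ?_ (by positivity)
        linarith
  · have hsub : ∀ n j : ℕ, ball (φ (discCover (dyadicPoint n j)))
        (‖deriv ψ (dyadicPoint n j)‖ * (1 / 2) ^ n / K) ⊆
        ψ '' ball (dyadicPoint n j) ((1 / 2) ^ n / 4) := by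
      intro n j
      have hp0 : (0 : ℝ) < (1 / 2) ^ n := by positivity
      have hp1 : (1 / 2 : ℝ) ^ n ≤ 1 := pow_le_one₀ (by norm_num) (by norm_num)
      have hR : (1 / 2 : ℝ) ^ n / 4 ≤ (dyadicPoint n j).im := by
        rw [im_dyadicPoint]; linarith
      have hb := ball_subset_image_of_injOn (f := ψ) (c := dyadicPoint n j)
        (R := (1 / 2) ^ n / 4)
        ((differentiableOn_comp_discCover hφ).mono fun ξ hξ => by
          have := (im_mem_of_mem_ball hξ).1
          change 0 < ξ.im
          linarith)
        (injOn_comp_discCover hinj hR (by linarith)) (by positivity)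
      refine (ball_subset_ball ?_).trans hb
      rw [← mul_div_assoc, div_div]
      exact div_le_div_of_nonneg_left (by positivity) (by norm_num) (by linarith)
    rw [disjoint_left]
    intro w hw hw'
    obtain ⟨ξ, hξ, rfl⟩ := hsub _ _ hw
    obtain ⟨ξ', hξ', he⟩ := hsub _ _ hw'
    have him : ∀ (n j : ℕ) (ξ : ℂ), ξ ∈ ball (dyadicPoint n j) ((1 / 2) ^ n / 4) → 0 < ξ.im := by
      intro n j ξ hξ
      have h1 := (im_mem_of_mem_ball hξ).1
      rw [im_dyadicPoint] at h1
      have : (0 : ℝ) < (1 / 2) ^ n := by positivity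
      linarith
    obtain ⟨m, hm⟩ := exists_int_of_discCover_eq
      (hinj (discCover_mem (him _ _ _ hξ)) (discCover_mem (him _ _ _ hξ')) he.symm)
    exact hpp' (eq_of_norm_dyadicPoint_sub_lt hξ hξ' hm hp hp')
  · obtain ⟨g, g', hg⟩ := hlog φ hφ hinj
    set y : ℝ := (1 / 2) ^ N with hy
    have hy0 : 0 < y := by positivity
    have hint : ∀ b c : ℝ, IntervalIntegrable (fun x : ℝ => g (x + y * Complex.I)) volume b c :=
      fun b c => by
        refine Continuous.intervalIntegrable (continuous_iff_continuousAt.2 fun x => ?_) _ _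
        refine ContinuousAt.comp (f := fun x : ℝ => (x : ℂ) + y * Complex.I)
          (hg _ (by simpa using hy0)).1.continuousAt (by fun_prop)
    refine ⟨fun n j => (∫ x in (j / 2 ^ n : ℝ)..(j / 2 ^ n + (1 / 2) ^ n),
      g (x + y * Complex.I)).re, fun n _ j => ?_, fun n hn j => ?_⟩
    · have e1 : ((2 * j : ℕ) : ℝ) / 2 ^ (n + 1) = j / 2 ^ n := by
        push_cast; rw [pow_succ]; field_simp
      have e2 : ((2 * j + 1 : ℕ) : ℝ) / 2 ^ (n + 1) = j / 2 ^ n + (1 / 2) ^ (n + 1) := by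
        rw [← e1, one_div, inv_pow]; push_cast; field_simp
      have e3 : (j : ℝ) / 2 ^ n + (1 / 2) ^ (n + 1) + (1 / 2) ^ (n + 1) =
          j / 2 ^ n + (1 / 2) ^ n := by ring
      beta_reduce
      rw [e1, e2, e3, ← Complex.add_re, intervalIntegral.integral_add_adjacent_intervals
        (hint _ _) (hint _ _)]
    · have e1 := norm_integral_sub_le_of_norm_deriv_le hC.le (fun ζ hζ => (hg ζ hζ).1)
        (fun ζ hζ => (hg ζ hζ).2.2) (j / 2 ^ n) hy0
        (pow_le_pow_of_le_one (by norm_num) (by norm_num) hn)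
        (pow_le_one₀ (n := n) (by norm_num) (by norm_num : (1 / 2 : ℝ) ≤ 1))
      have e2 := (Complex.abs_re_le_norm _).trans e1
      rw [Complex.sub_re, Complex.re_ofReal_mul] at e2
      have e3 : Real.log (‖deriv ψ (dyadicPoint n j)‖ * (1 / 2) ^ n * 2 ^ n) =
          (g (dyadicPoint n j)).re := by
        rw [mul_assoc, h2, mul_one, ← (hg _ (im_dyadicPoint_pos n j)).2.1, Complex.norm_exp,
          Real.log_exp]
      rw [e3]
      refine e2.trans (mul_le_mul_of_nonneg_right ?_ (by positivity))
      linarith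

end TreeOfDyadicPoints

section LinearMeasureOfBoundary

theorem not_sphere_subset_of_isSimplyConnected {Ω : Set ℂ} (hΩ : IsOpen Ω)
    (hsc : IsSimplyConnected Ω) {p : ℂ} (hp : p ∉ Ω) (t : ℝ) : ¬ sphere p |t| ⊆ Ω := by
  intro hsub
  obtain ⟨f, hf, hexp⟩ := Complex.exists_continuousOn_eqOn_exp_comp hsc hΩ
    (g := fun z => z - p) (by fun_prop) (by
      rintro ⟨z, hz, h⟩
      exact hp (sub_eq_zero.1 h ▸ hz))
  have hmem : ∀ θ, circleMap p t θ ∈ Ω := fun θ => hsub (circleMap_mem_sphere' p t θ)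
  set h : ℝ → ℝ := fun θ => (f (circleMap p t θ)).im - θ with hh
  have hcont : Continuous h :=
    (Complex.continuous_im.comp (hf.comp_continuous (continuous_circleMap p t) hmem)).sub
      continuous_id
  have ht : (t : ℂ) ≠ 0 := by
    intro h0
    refine hp (hsub ?_)
    simp [Complex.ofReal_eq_zero.1 h0]
  have hval : ∀ θ, Complex.exp (f (circleMap p t θ) - θ * Complex.I) = t := fun θ => by
    have h1 : Complex.exp (f (circleMap p t θ)) = circleMap p t θ - p := hexp (hmem θ)
    rw [Complex.exp_sub, h1, circleMap, add_sub_cancel_left,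
      mul_div_cancel_right₀ _ (Complex.exp_ne_zero _)]
  have hper : f (circleMap p t (2 * Real.pi)) = f (circleMap p t 0) := by
    simpa using congrArg f (periodic_circleMap p t 0)
  have h2 : h (2 * Real.pi) = h 0 - 2 * Real.pi := by simp [hh, hper]
  obtain ⟨θ, -, hθ⟩ : h 0 - Real.pi ∈ h '' Icc 0 (2 * Real.pi) :=
    intermediate_value_Icc' (by positivity) hcont.continuousOn
      ⟨by rw [h2]; linarith [Real.pi_pos], by linarith [Real.pi_pos]⟩
  obtain ⟨m, hm⟩ := Complex.exp_eq_exp_iff_exists_int.1 ((hval θ).trans (hval 0).symm)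
  have him := congrArg Complex.im hm
  have him' : h θ = h 0 + m * (2 * Real.pi) := by simpa [hh] using him
  have h3 : ((2 * m + 1 : ℤ) : ℝ) * Real.pi = 0 := by
    push_cast
    linarith
  rcases mul_eq_zero.1 h3 with h4 | h4
  · have : 2 * m + 1 = 0 := by exact_mod_cast h4
    omega
  · exact Real.pi_pos.ne' h4

theorem ofReal_dist_le_hausdorffMeasure_frontier {Ω : Set ℂ} (hΩ : IsOpen Ω)
    (hsc : IsSimplyConnected Ω) {z p : ℂ} (hp : p ∈ frontier Ω) (hzp : dist z p = infDist z Ωᶜ) :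
    ENNReal.ofReal (dist z p) ≤ μH[1] (frontier Ω ∩ ball p (dist z p)) := by
  have hpΩ : p ∉ Ω := (hΩ.frontier_eq ▸ hp).2
  have hsub : Ioo 0 (dist z p) ⊆ (fun x => dist x p) '' (frontier Ω ∩ ball p (dist z p)) := by
    intro t ht
    have hδ : 0 < dist z p := ht.1.trans ht.2
    have hconn : IsPreconnected (sphere p t) :=
      isPreconnected_sphere (by rw [Complex.rank_real_complex]; norm_num) p t
    have hx : p + (t / dist z p : ℝ) * (z - p) ∈ sphere p t := by
      rw [mem_sphere_iff_norm, add_sub_cancel_left, norm_mul, Complex.norm_real, Real.norm_eq_abs,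
        abs_of_pos (div_pos ht.1 hδ), ← dist_eq_norm, div_mul_cancel₀ _ hδ.ne']
    have hxΩ : p + (t / dist z p : ℝ) * (z - p) ∈ Ω := by
      refine ball_infDist_compl_subset (x := z) ?_
      rw [← hzp, mem_ball, dist_eq_norm]
      have : p + (t / dist z p : ℝ) * (z - p) - z = ((t / dist z p - 1 : ℝ) : ℂ) * (z - p) := by
        push_cast; ring
      rw [this, norm_mul, Complex.norm_real, Real.norm_eq_abs, ← dist_eq_norm]
      have h1 : t / dist z p < 1 := (div_lt_one hδ).2 ht.2
      have h2 := div_pos ht.1 hδ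
      rw [abs_of_neg (by linarith)]
      nlinarith
    have hnot : ¬ sphere p t ⊆ Ω := by
      have := not_sphere_subset_of_isSimplyConnected hΩ hsc hpΩ t
      rwa [abs_of_pos ht.1] at this
    obtain ⟨x', hx', hx'Ω⟩ := not_subset.1 hnot
    obtain ⟨y, hy, hyf⟩ : (sphere p t ∩ frontier Ω).Nonempty := by
      by_contra h
      have hcl : ∀ y ∈ sphere p t, y ∉ Ω → y ∉ closure Ω := fun y hy hyΩ hyc =>
        h ⟨y, hy, hΩ.frontier_eq ▸ ⟨hyc, hyΩ⟩⟩
      obtain ⟨y, -, hy, hy'⟩ := hconn Ω (closure Ω)ᶜ hΩ isClosed_closure.isOpen_compl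
        (fun y hy => or_iff_not_imp_left.2 (hcl y hy)) ⟨_, hx, hxΩ⟩
        ⟨x', hx', hcl x' hx' hx'Ω⟩
      exact hy' (subset_closure hy)
    exact ⟨y, ⟨hyf, mem_ball.2 ((mem_sphere.1 hy).trans_lt ht.2)⟩, mem_sphere.1 hy⟩
  have h1 := (LipschitzWith.dist_left p).hausdorffMeasure_image_le (d := 1) zero_le_one
    (frontier Ω ∩ ball p (dist z p))
  rw [ENNReal.coe_one, ENNReal.one_rpow, one_mul] at h1
  have h2 := measure_mono (μ := μH[1]) hsub
  rw [hausdorffMeasure_real, Real.volume_Ioo, sub_zero] at h2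
  rw [hausdorffMeasure_real] at h1
  exact h2.trans h1

end LinearMeasureOfBoundary

section CarlesonBoxes

/-- The angular coordinate of a point, normalized to `[0, 1)`. -/
noncomputable def turn (z : ℂ) : ℝ := Int.fract (Complex.arg z / (2 * Real.pi))

/-- The normalized logarithmic distance of a point to the unit circle. -/
noncomputable def height (z : ℂ) : ℝ := -Real.log ‖z‖ / (2 * Real.pi)

theorem measurable_turn : Measurable turn :=
  measurable_fract.comp (Complex.measurable_arg.div_const _)

theorem measurable_height : Measurable height :=
  ((Real.measurable_log.comp measurable_norm).neg).div_const _

theorem discCover_turn_height {z : ℂ} (hz : z ≠ 0) :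
    discCover (turn z + height z * Complex.I) = z := by
  have hpi : (Real.pi : ℂ) ≠ 0 := by exact_mod_cast Real.pi_ne_zero
  have h : 2 * Real.pi * Complex.I * (turn z + height z * Complex.I) =
      Complex.log z - (⌊Complex.arg z / (2 * Real.pi)⌋ : ℤ) * (2 * Real.pi * Complex.I) := by
    rw [turn, height, Int.fract, Complex.log]
    push_cast
    field_simp
    linear_combination (-Real.log ‖z‖ : ℂ) * Complex.I_sq
  rw [discCover, h, Complex.exp_sub, Complex.exp_int_mul_two_pi_mul_I, div_one,
    Complex.exp_log hz]

/-- The dyadic Carleson boxes of the unit disk. -/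
def carlesonBox (n j : ℕ) : Set ℂ :=
  {z | (j ≤ 2 ^ n * turn z ∧ 2 ^ n * turn z < j + 1) ∧ 0 < height z ∧ height z ≤ (1 / 2) ^ n}

/-- The upper halves of the dyadic Carleson boxes of the unit disk. -/
def whitneyBox (n j : ℕ) : Set ℂ :=
  {z | (j ≤ 2 ^ n * turn z ∧ 2 ^ n * turn z < j + 1) ∧ (1 / 2) ^ (n + 1) < height z ∧
    height z ≤ (1 / 2) ^ n}

theorem measurableSet_carlesonBox (n j : ℕ) : MeasurableSet (carlesonBox n j) :=
  ((measurableSet_le measurable_const (measurable_turn.const_mul _)).inter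
    (measurableSet_lt (measurable_turn.const_mul _) measurable_const)).inter
    ((measurableSet_lt measurable_const measurable_height).inter
      (measurableSet_le measurable_height measurable_const))

theorem measurableSet_whitneyBox (n j : ℕ) : MeasurableSet (whitneyBox n j) :=
  ((measurableSet_le measurable_const (measurable_turn.const_mul _)).inter
    (measurableSet_lt (measurable_turn.const_mul _) measurable_const)).inter
    ((measurableSet_lt measurable_const measurable_height).inter
      (measurableSet_le measurable_height measurable_const))

theorem ne_zero_of_height_pos {z : ℂ} (hz : 0 < height z) : z ≠ 0 := by
  rintro rfl
  simp [height] at hz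

theorem whitneyBox_subset (n j : ℕ) : whitneyBox n j ⊆ carlesonBox n j := fun _ hz =>
  ⟨hz.1, lt_trans (by positivity) hz.2.1, hz.2.2⟩

theorem carlesonBox_child_subset (n j i : ℕ) (hi : i / 2 = j) :
    carlesonBox (n + 1) i ⊆ carlesonBox n j := by
  intro z hz
  have h1 : (i : ℝ) = 2 * j + (i % 2 : ℕ) := by
    rw [← hi]; exact_mod_cast (Nat.div_add_mod i 2).symm
  have h2 : ((i % 2 : ℕ) : ℝ) ≤ 1 := by exact_mod_cast Nat.lt_succ_iff.1 (Nat.mod_lt i two_pos)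
  have h0 : (0 : ℝ) ≤ (i % 2 : ℕ) := by positivity
  obtain ⟨⟨e1, e2⟩, e3, e4⟩ := hz
  rw [pow_succ] at e1 e2 e4
  have h3 : (0 : ℝ) < (1 / 2) ^ n := by positivity
  exact ⟨⟨by linarith, by linarith⟩, e3, by linarith⟩

theorem carlesonBox_subset_unitDisk (n j : ℕ) : carlesonBox n j ⊆ unitDisk := by
  intro z hz
  have h := discCover_mem (ζ := turn z + height z * Complex.I) (by simpa using hz.2.1)
  rwa [discCover_turn_height (ne_zero_of_height_pos hz.2.1)] at h

theorem measure_boxes_add_le (ν : Measure ℂ) (n j : ℕ) :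
    ν (whitneyBox n j) + ν (carlesonBox (n + 1) (2 * j)) + ν (carlesonBox (n + 1) (2 * j + 1)) ≤
      ν (carlesonBox n j) := by
  rw [← measure_union _ (measurableSet_carlesonBox _ _), ← measure_union _
    (measurableSet_carlesonBox _ _)]
  · exact measure_mono (union_subset (union_subset (whitneyBox_subset n j)
      (carlesonBox_child_subset n j _ (by omega))) (carlesonBox_child_subset n j _ (by omega)))
  · rw [disjoint_left]
    rintro z (hz | hz) hz'
    · exact hz.2.1.not_ge hz'.2.2
    · have h1 := hz.1.2
      have h2 := hz'.1.1
      push_cast at h1 h2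
      linarith
  · rw [disjoint_left]
    exact fun z hz hz' => hz.2.1.not_ge hz'.2.2

theorem exists_mem_whitneyBox {z : ℂ} (hz : z ∈ unitDisk) (h : Real.exp (-(2 * Real.pi)) ≤ ‖z‖) :
    ∃ n, ∃ j < 2 ^ n, z ∈ whitneyBox n j := by
  have hz1 : ‖z‖ < 1 := mem_ball_zero_iff.1 hz
  have hz0 : 0 < ‖z‖ := (Real.exp_pos _).trans_le h
  have hpi := Real.pi_pos
  have h0 : 0 < height z := div_pos (neg_pos.2 (Real.log_neg hz0 hz1)) (by positivity)
  have h1 : height z ≤ 1 := by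
    rw [height, div_le_one (by positivity)]
    have := (Real.le_log_iff_exp_le hz0).2 h
    linarith
  obtain ⟨n, hn1, hn2⟩ := exists_nat_pow_near_of_lt_one h0 h1 (by norm_num : (0 : ℝ) < 1 / 2)
    (by norm_num)
  have ht0 : 0 ≤ (2 : ℝ) ^ n * turn z := mul_nonneg (by positivity) (Int.fract_nonneg _)
  refine ⟨n, ⌊2 ^ n * turn z⌋₊, ?_, ⟨Nat.floor_le ht0, Nat.lt_floor_add_one _⟩, hn1, hn2⟩
  rw [Nat.floor_lt ht0]
  push_cast
  exact mul_lt_of_lt_one_right (by positivity) (Int.fract_lt_one _)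

theorem carlesonBox_subset_ball (n j : ℕ) :
    carlesonBox n j ⊆ ball (discCover ((j / 2 ^ n : ℝ) : ℂ)) (13 * (1 / 2) ^ n) := by
  intro z hz
  have hp : (0 : ℝ) < (1 / 2) ^ n := by positivity
  have hp' : (0 : ℝ) < 2 ^ n := by positivity
  have h2 : (1 / 2 : ℝ) ^ n * 2 ^ n = 1 := by rw [← mul_pow]; norm_num
  set ζ : ℂ := turn z + height z * Complex.I with hζ
  have hre : ζ.re = turn z := by simp [hζ]
  have him : ζ.im = height z := by simp [hζ]
  have h := (convex_halfSpace_im_ge 0).norm_image_sub_le_of_norm_hasDerivWithin_le (𝕜 := ℂ)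
    (f := discCover) (C := 2 * Real.pi) (fun ξ _ => (hasDerivAt_discCover ξ).hasDerivWithinAt)
    (fun ξ hξ => by
      have : Real.exp (-(2 * Real.pi * ξ.im)) ≤ 1 := by
        rw [Real.exp_le_one_iff, neg_nonpos]
        exact mul_nonneg (by positivity) hξ
      simpa [norm_discCover, abs_of_pos Real.pi_pos] using
        mul_le_of_le_one_right (by positivity : 0 ≤ 2 * Real.pi) this)
    (x := ((j / 2 ^ n : ℝ) : ℂ)) (y := ζ) (by simp [-Complex.ofReal_div])
    (by change 0 ≤ ζ.im; rw [him]; exact hz.2.1.le)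
  rw [hζ, discCover_turn_height (ne_zero_of_height_pos hz.2.1), ← hζ] at h
  have hnorm : ‖ζ - ((j / 2 ^ n : ℝ) : ℂ)‖ ≤ 2 * (1 / 2) ^ n := by
    refine (Complex.norm_le_abs_re_add_abs_im _).trans ?_
    rw [Complex.sub_re, Complex.sub_im, Complex.ofReal_re, Complex.ofReal_im, hre, him, sub_zero,
      abs_of_pos hz.2.1, abs_of_nonneg (sub_nonneg.2 ((div_le_iff₀' hp').2 hz.1.1))]
    have e1 : turn z - j / 2 ^ n ≤ (1 / 2) ^ n := by
      rw [← mul_le_mul_iff_left₀ hp', h2, sub_mul, div_mul_cancel₀ _ hp'.ne']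
      linarith [hz.1.2]
    linarith [hz.2.2]
  rw [mem_ball, dist_eq_norm]
  have := Real.pi_lt_d2
  calc _ ≤ _ := h
    _ ≤ 2 * Real.pi * (2 * (1 / 2) ^ n) := by gcongr
    _ < _ := by nlinarith

theorem measure_unitDisk_inter_ball_le (ν : Measure ℂ) {z : ℂ} (hz : ‖z‖ = 1) {r : ℝ} (hr : 0 < r) :
    ν (unitDisk ∩ ball z r) ≤ 2 * carlesonNorm unitDisk ν * ENNReal.ofReal r := by
  have hle := carlesonNorm_le_iff.1 (le_refl (carlesonNorm unitDisk ν))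
  rw [ediam_frontier_unitDisk, frontier_unitDisk] at hle
  have hcar : ∀ w : ℂ, ‖w‖ = 1 → ∀ s : ℝ, 0 < s → s < 2 →
      ν (unitDisk ∩ ball w s) ≤ carlesonNorm unitDisk ν * ENNReal.ofReal s := fun w hw s hs hs2 =>
    hle w (mem_sphere_zero_iff_norm.2 hw) s hs ((ENNReal.ofReal_lt_ofReal_iff two_pos).2 hs2)
  rcases lt_or_ge r 2 with h | h
  · refine (hcar z hz r hr h).trans (mul_le_mul_left ?_ _)
    exact le_mul_of_one_le_left zero_le (by norm_num)
  have hsub : unitDisk ∩ ball z r ⊆ unitDisk ∩ ball 1 (19 / 10) ∪ unitDisk ∩ ball (-1) (19 / 10) := by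
    rintro x ⟨hx, -⟩
    have hx1 : ‖x‖ < 1 := mem_ball_zero_iff.1 hx
    have hn : x.re ^ 2 + x.im ^ 2 < 1 := by
      have := Complex.sq_norm x
      rw [Complex.normSq_apply] at this
      nlinarith [norm_nonneg x]
    have key : ∀ w : ℂ, (x - w).re ^ 2 + (x - w).im ^ 2 ≤ 2 → x ∈ ball w (19 / 10) := by
      intro w hw
      rw [mem_ball, dist_eq_norm]
      have := Complex.sq_norm (x - w)
      rw [Complex.normSq_apply] at this
      nlinarith [norm_nonneg (x - w)]
    rcases le_total 0 x.re with h0 | h0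
    · exact Or.inl ⟨hx, key _ (by simp; nlinarith)⟩
    · exact Or.inr ⟨hx, key _ (by simp; nlinarith)⟩
  calc _ ≤ _ := (measure_mono hsub).trans (measure_union_le _ _)
    _ ≤ carlesonNorm unitDisk ν * ENNReal.ofReal r + carlesonNorm unitDisk ν * ENNReal.ofReal r := by
      refine add_le_add ((hcar _ (by simp) _ (by norm_num) (by norm_num)).trans ?_)
        ((hcar _ (by simp) _ (by norm_num) (by norm_num)).trans ?_) <;>
      · gcongr
        linarith
    _ = _ := by ring

end CarlesonBoxes

section PushForward

variable {φ : ℂ → ℂ}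

theorem norm_sub_dyadicPoint_le {n j : ℕ} {z : ℂ} (hz : z ∈ whitneyBox n j) :
    ‖(turn z + height z * Complex.I) - dyadicPoint n j‖ ≤ 4 * (1 / 2 : ℝ) ^ (n + 1) := by
  have hp : (0 : ℝ) < (1 / 2) ^ n := by positivity
  have hp' : (0 : ℝ) < 2 ^ n := by positivity
  have h2 : (1 / 2 : ℝ) ^ n * 2 ^ n = 1 := by rw [← mul_pow]; norm_num
  have hre : ((turn z : ℂ) + height z * Complex.I).re = turn z := by simp
  have him : ((turn z : ℂ) + height z * Complex.I).im = height z := by simp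
  refine (Complex.norm_le_abs_re_add_abs_im _).trans ?_
  rw [Complex.sub_re, Complex.sub_im, hre, him, re_dyadicPoint, im_dyadicPoint,
    abs_of_nonneg (sub_nonneg.2 ((div_le_iff₀' hp').2 hz.1.1)),
    abs_of_nonpos (sub_nonpos.2 hz.2.2)]
  have e1 : turn z - j / 2 ^ n ≤ (1 / 2) ^ n := by
    rw [← mul_le_mul_iff_left₀ hp', h2, sub_mul, div_mul_cancel₀ _ hp'.ne']
    linarith [hz.1.2]
  have e2 := hz.2.1
  rw [pow_succ] at e2 ⊢
  linarith

theorem lintegral_whitneyBox_le (hφ : DifferentiableOn ℂ φ unitDisk)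
    (hinj : InjOn φ unitDisk) {E : ℝ} (hE : 1 ≤ E) (hdist : ∀ y : ℝ, 0 < y → ∀ ζ ζ' : ℂ,
      y ≤ ζ.im → ζ.im ≤ 1 → y ≤ ζ'.im → ζ'.im ≤ 1 → ‖ζ - ζ'‖ ≤ 4 * y →
      ‖deriv (φ ∘ discCover) ζ‖ ≤ E * ‖deriv (φ ∘ discCover) ζ'‖ ∧
      dist (φ (discCover ζ)) (φ (discCover ζ')) ≤ E * (‖deriv (φ ∘ discCover) ζ'‖ * (4 * y)))
    {w : ℂ} (hw : w ∉ φ '' unitDisk) (r : ℝ) (ν : Measure ℂ) {n j : ℕ}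
    (hν : ν (whitneyBox n j) ≠ ⊤) :
    ∫⁻ z in unitDisk ∩ φ ⁻¹' ball w r ∩ whitneyBox n j, ‖deriv φ z‖₊ ∂ν ≤
      ENNReal.ofReal (E * Real.exp (2 * Real.pi)) * ENNReal.ofReal
        (if dist (φ (discCover (dyadicPoint n j))) w < (1 + 3136 * E) * r then
          (ν (whitneyBox n j)).toReal * (‖deriv (φ ∘ discCover) (dyadicPoint n j)‖ *
            (1 / 2) ^ n * 2 ^ n) else 0) := by
  have hp : (0 : ℝ) < (1 / 2) ^ (n + 1) := by positivity
  have hne : φ '' unitDisk ≠ univ := fun h => hw (h ▸ mem_univ w)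
  have hpos : ∀ z ∈ whitneyBox n j, 0 < height z := fun z hz => hp.trans hz.2.1
  have himz : ∀ z : ℂ, ((turn z : ℂ) + height z * Complex.I).im = height z := fun z => by simp
  have hle1 : ∀ z ∈ whitneyBox n j, height z ≤ 1 := fun z hz =>
    hz.2.2.trans (pow_le_one₀ (by norm_num) (by norm_num))
  have hpi := Real.pi_gt_three
  have hyQ : (1 / 2 : ℝ) ^ (n + 1) ≤ (dyadicPoint n j).im := by
    rw [im_dyadicPoint]
    exact pow_le_pow_of_le_one (by norm_num) (by norm_num) n.le_succ
  have hder : ∀ z ∈ whitneyBox n j,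
      ‖deriv φ z‖ ≤ E * Real.exp (2 * Real.pi) * ‖deriv (φ ∘ discCover) (dyadicPoint n j)‖ := by
    intro z hz
    have h1 := (hdist _ hp _ _ ((himz z).symm ▸ hz.2.1.le) ((himz z).symm ▸ hle1 z hz) hyQ
      (im_dyadicPoint_le n j) (norm_sub_dyadicPoint_le hz)).1
    rw [norm_deriv_comp_discCover hφ ((himz z).symm ▸ hpos z hz),
      discCover_turn_height (ne_zero_of_height_pos (hpos z hz)), himz] at h1
    have h2 : 1 ≤ Real.exp (2 * Real.pi) * Real.exp (-(2 * Real.pi * height z)) := by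
      rw [← Real.exp_add]
      have := mul_le_mul_of_nonneg_left (hle1 z hz) (by positivity : 0 ≤ 2 * Real.pi)
      exact Real.one_le_exp (by linarith)
    have h3 : ‖deriv φ z‖ * Real.exp (-(2 * Real.pi * height z)) ≤
        E * ‖deriv (φ ∘ discCover) (dyadicPoint n j)‖ := by
      refine le_trans (mul_le_mul_of_nonneg_left ?_ (norm_nonneg _)) h1
      exact le_mul_of_one_le_left (Real.exp_pos _).le (by linarith)
    calc ‖deriv φ z‖ ≤ ‖deriv φ z‖ *
          (Real.exp (2 * Real.pi) * Real.exp (-(2 * Real.pi * height z))) :=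
          le_mul_of_one_le_right (norm_nonneg _) h2
      _ = Real.exp (2 * Real.pi) *
          (‖deriv φ z‖ * Real.exp (-(2 * Real.pi * height z))) := by ring
      _ ≤ Real.exp (2 * Real.pi) * (E * ‖deriv (φ ∘ discCover) (dyadicPoint n j)‖) := by gcongr
      _ = _ := by ring
  have hnear : ∀ z ∈ whitneyBox n j, φ z ∈ ball w r →
      dist (φ (discCover (dyadicPoint n j))) w < (1 + 3136 * E) * r := by
    intro z hz hzw
    have h0 : 0 < ((turn z : ℂ) + height z * Complex.I).im := (himz z).symm ▸ hpos z hz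
    have hzd : discCover (turn z + height z * Complex.I) = z :=
      discCover_turn_height (ne_zero_of_height_pos (hpos z hz))
    have h1 := (hdist _ hp _ _ hyQ (im_dyadicPoint_le n j) ((himz z).symm ▸ hz.2.1.le)
      ((himz z).symm ▸ hle1 z hz) (by rw [norm_sub_rev]; exact norm_sub_dyadicPoint_le hz)).2
    have h2 := norm_deriv_comp_discCover_mul_im_le hφ hinj hne h0
    rw [hzd] at h1 h2
    rw [himz] at h2
    have h3 : infDist (φ z) (φ '' unitDisk)ᶜ ≤ dist (φ z) w := infDist_le_dist_of_mem hw
    have h4 := mem_ball.1 hzw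
    have h5 := mul_le_mul_of_nonneg_left hz.2.1.le
      (norm_nonneg (deriv (φ ∘ discCover) (turn z + height z * Complex.I)))
    have h6 : ‖deriv (φ ∘ discCover) (turn z + height z * Complex.I)‖ *
        (4 * (1 / 2 : ℝ) ^ (n + 1)) ≤ 3136 * r := by linarith
    have h7 := mul_le_mul_of_nonneg_left h6 (zero_le_one.trans hE)
    linarith [dist_triangle (φ (discCover (dyadicPoint n j))) (φ z) w]
  have h2 : (1 / 2 : ℝ) ^ n * 2 ^ n = 1 := by rw [← mul_pow]; norm_num
  rw [mul_assoc ‖_‖, h2, mul_one]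
  split_ifs with h
  · calc ∫⁻ z in unitDisk ∩ φ ⁻¹' ball w r ∩ whitneyBox n j, ‖deriv φ z‖₊ ∂ν
        ≤ ∫⁻ z in whitneyBox n j, ‖deriv φ z‖₊ ∂ν := lintegral_mono_set inter_subset_right
      _ ≤ ∫⁻ z in whitneyBox n j, ENNReal.ofReal
          (E * Real.exp (2 * Real.pi) * ‖deriv (φ ∘ discCover) (dyadicPoint n j)‖) ∂ν := by
        refine setLIntegral_mono' (measurableSet_whitneyBox n j) fun z hz => ?_
        rw [← enorm_eq_nnnorm, ← ofReal_norm]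
        exact ENNReal.ofReal_le_ofReal (hder z hz)
      _ = _ := by
        rw [setLIntegral_const, ENNReal.ofReal_mul (by positivity),
          ENNReal.ofReal_mul ENNReal.toReal_nonneg, ENNReal.ofReal_toReal hν, mul_assoc,
          mul_comm (ν _)]
  · have : unitDisk ∩ φ ⁻¹' ball w r ∩ whitneyBox n j = ∅ :=
      eq_empty_of_forall_notMem fun z hz => h (hnear z hz.2 hz.1.2)
    simp [this]

theorem lintegral_center_le (hφ : DifferentiableOn ℂ φ unitDisk) (hinj : InjOn φ unitDisk)
    {w : ℂ} (hw : w ∉ φ '' unitDisk) (r : ℝ) (ν : Measure ℂ) :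
    ∫⁻ z in unitDisk ∩ φ ⁻¹' ball w r ∩ ball 0 (1 / 2), ‖deriv φ z‖₊ ∂ν ≤
      ENNReal.ofReal (1568 * r) * ν unitDisk := by
  have hne : φ '' unitDisk ≠ univ := fun h => hw (h ▸ mem_univ w)
  have hopen : IsOpen (unitDisk ∩ φ ⁻¹' ball w r) :=
    hφ.continuousOn.isOpen_inter_preimage isOpen_unitDisk isOpen_ball
  calc _ ≤ ∫⁻ z in unitDisk ∩ φ ⁻¹' ball w r ∩ ball 0 (1 / 2), ENNReal.ofReal (1568 * r) ∂ν := by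
        refine setLIntegral_mono' (hopen.inter isOpen_ball).measurableSet fun z hz => ?_
        rw [← enorm_eq_nnnorm, ← ofReal_norm]
        refine ENNReal.ofReal_le_ofReal ?_
        have h1 := norm_deriv_mul_one_sub_norm_le hφ hinj hne hz.1.1
        have h2 : infDist (φ z) (φ '' unitDisk)ᶜ ≤ dist (φ z) w := infDist_le_dist_of_mem hw
        have h3 := mem_ball.1 hz.1.2
        have h4 := mem_ball_zero_iff.1 hz.2
        nlinarith [norm_nonneg (deriv φ z)]
    _ ≤ _ := by
      rw [setLIntegral_const]
      exact mul_le_mul_right (measure_mono (inter_subset_left.trans inter_subset_left)) _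

theorem setLIntegral_biUnion_finset_le {α ι : Type*} [MeasurableSpace α] {μ : Measure α}
    (f : α → ℝ≥0∞) (s : Finset ι) (t : ι → Set α) :
    ∫⁻ x in ⋃ i ∈ s, t i, f x ∂μ ≤ ∑ i ∈ s, ∫⁻ x in t i, f x ∂μ := by
  have h : ⋃ i ∈ s, t i = ⋃ i : s, t i := by simp [iUnion_subtype]
  rw [h, ← Finset.sum_coe_sort s fun i => ∫⁻ x in t i, f x ∂μ, ← tsum_fintype (L := .unconditional _)]
  exact lintegral_iUnion_le _ _

theorem isCarleson_pushForward (hφ : DifferentiableOn ℂ φ unitDisk) (hinj : InjOn φ unitDisk)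
    (hΩ : IsOpen (φ '' unitDisk)) (hne : φ '' unitDisk ≠ univ)
    (hsc : IsSimplyConnected (φ '' unitDisk)) {CA : ℝ} (hCA : 0 < CA)
    (hA : ∀ z : ℂ, ∀ r : ℝ, 0 < r →
      μH[1] (frontier (φ '' unitDisk) ∩ ball z r) ≤ ENNReal.ofReal (CA * r))
    {ν : Measure ℂ} (hν : IsCarleson unitDisk ν) :
    IsCarleson (φ '' unitDisk) (pushForward unitDisk φ ν) := by
  obtain ⟨E, hE, hdist⟩ := exists_distortion_comp_discCover
  obtain ⟨K, htree⟩ := exists_isConformalTree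
  obtain ⟨C, hC, hsum⟩ := (htree φ hφ hinj hne).exists_sum_carleson_le hΩ hne hCA hA
    (fun z _ p hp hzp => ofReal_dist_le_hausdorffMeasure_frontier hΩ hsc hp hzp)
    (C₀ := 1 + 3136 * E) (by positivity)
  have hball := fun (z : ℂ) (hz : ‖z‖ = 1) (r : ℝ) => measure_unitDisk_inter_ball_le ν hz (r := r)
  lift carlesonNorm unitDisk ν to ℝ≥0 using hν.ne with N hN
  have hNr : 2 * (N : ℝ≥0∞) = ENNReal.ofReal (2 * N) := by
    rw [ENNReal.ofReal_mul two_pos.le, ENNReal.ofReal_coe_nnreal, ENNReal.ofReal_ofNat]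
  have hbox : ∀ n j, ν (carlesonBox n j) ≤ ENNReal.ofReal ((26 * N + 1) * (1 / 2) ^ n) := by
    intro n j
    have h1 : ‖discCover ((j / 2 ^ n : ℝ) : ℂ)‖ = 1 := by
      rw [norm_discCover, Complex.ofReal_im, mul_zero, neg_zero, Real.exp_zero]
    refine (measure_mono (subset_inter (carlesonBox_subset_unitDisk n j)
      (carlesonBox_subset_ball n j))).trans ((hball _ h1 _ (by positivity)).trans ?_)
    rw [hNr, ← ENNReal.ofReal_mul (by positivity)]
    refine ENNReal.ofReal_le_ofReal ?_
    nlinarith [show (0 : ℝ) < (1 / 2) ^ n by positivity]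
  have hfin : ∀ n j, ν (carlesonBox n j) ≠ ⊤ := fun n j =>
    ((hbox n j).trans_lt ENNReal.ofReal_lt_top).ne
  have hfinw : ∀ n j, ν (whitneyBox n j) ≠ ⊤ := fun n j =>
    ((measure_mono (whitneyBox_subset n j)).trans_lt (hfin n j).lt_top).ne
  have hdisk : ν unitDisk ≤ ENNReal.ofReal (2 * N * 2) := by
    have h1 : unitDisk ⊆ unitDisk ∩ ball 1 2 := fun z hz => ⟨hz, by
      have h2 : ‖z‖ < 1 := mem_ball_zero_iff.1 hz
      rw [mem_ball, dist_eq_norm]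
      exact (norm_sub_le _ _).trans_lt (by rw [norm_one]; linarith)⟩
    refine (measure_mono h1).trans ((hball 1 norm_one 2 two_pos).trans ?_)
    rw [hNr, ← ENNReal.ofReal_mul (by positivity)]
  have hcover : ∀ S ⊆ unitDisk, S ⊆ S ∩ ball 0 (1 / 2) ∪
      ⋃ n, ⋃ j ∈ Finset.range (2 ^ n), S ∩ whitneyBox n j := by
    intro S hS z hz
    rcases lt_or_ge ‖z‖ (1 / 2) with h | h
    · exact Or.inl ⟨hz, mem_ball_zero_iff.2 h⟩
    · have h1 : Real.exp (-(2 * Real.pi)) ≤ 1 / 2 := by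
        rw [Real.exp_neg, one_div]
        refine inv_anti₀ two_pos ?_
        linarith [Real.add_one_le_exp (2 * Real.pi), Real.pi_gt_three]
      obtain ⟨n, j, hj, hzj⟩ := exists_mem_whitneyBox (hS hz) (h1.trans h)
      exact Or.inr (mem_iUnion.2 ⟨n, mem_iUnion₂.2 ⟨j, Finset.mem_range.2 hj, hz, hzj⟩⟩)
  have hlt : carlesonNorm (φ '' unitDisk) (pushForward unitDisk φ ν) ≤ ENNReal.ofReal
      (1568 * (2 * N * 2) + E * Real.exp (2 * Real.pi) * (C * (26 * N + 1))) := by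
    rw [carlesonNorm_le_iff]
    intro w hw r hr _
    have hwΩ : w ∉ φ '' unitDisk := (hΩ.frontier_eq ▸ hw).2
    refine (measure_mono inter_subset_right).trans ?_
    rw [pushForward_apply isOpen_unitDisk hφ.continuousOn ν isOpen_ball]
    set a : ℕ → ℕ → ℝ := fun n j =>
      if dist (φ (discCover (dyadicPoint n j))) w < (1 + 3136 * E) * r then
        (ν (whitneyBox n j)).toReal * (‖deriv (φ ∘ discCover) (dyadicPoint n j)‖ *
          (1 / 2) ^ n * 2 ^ n) else 0 with ha
    have ha0 : ∀ n j, 0 ≤ a n j := fun n j => by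
      simp only [ha]; split_ifs <;> positivity
    have hsum' : ∑' n, ∑ j ∈ Finset.range (2 ^ n), ENNReal.ofReal (a n j) ≤
        ENNReal.ofReal (C * ((26 * N + 1) * r)) := by
      rw [ENNReal.tsum_eq_iSup_nat, iSup_le_iff]
      intro m
      have h1 : ∀ n, ∑ j ∈ Finset.range (2 ^ n), ENNReal.ofReal (a n j) =
          ENNReal.ofReal (∑ j ∈ Finset.range (2 ^ n), a n j) := fun n =>
        (ENNReal.ofReal_sum_of_nonneg fun j _ => ha0 n j).symm
      rw [Finset.sum_congr rfl fun n _ => h1 n, ← ENNReal.ofReal_sum_of_nonneg fun n _ =>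
        Finset.sum_nonneg fun j _ => ha0 n j]
      refine ENNReal.ofReal_le_ofReal ?_
      refine hsum (fun n j => (ν (whitneyBox n j)).toReal) (fun n j => (ν (carlesonBox n j)).toReal)
        (26 * N + 1) (by positivity) (fun _ _ => ENNReal.toReal_nonneg)
        (fun _ _ => ENNReal.toReal_nonneg) (fun n j => ?_) (fun n j => ?_) w hwΩ r hr m
      · exact ENNReal.toReal_le_of_le_ofReal (by positivity) (hbox n j)
      · rw [← ENNReal.toReal_add (hfinw _ _) (hfin _ _), ← ENNReal.toReal_add
          (ENNReal.add_ne_top.2 ⟨hfinw _ _, hfin _ _⟩) (hfin _ _)]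
        exact ENNReal.toReal_mono (hfin _ _) (measure_boxes_add_le ν n j)
    calc ∫⁻ z in unitDisk ∩ φ ⁻¹' ball w r, ‖deriv φ z‖₊ ∂ν
        ≤ (∫⁻ z in unitDisk ∩ φ ⁻¹' ball w r ∩ ball 0 (1 / 2), ‖deriv φ z‖₊ ∂ν) +
          ∑' n, ∑ j ∈ Finset.range (2 ^ n),
            ∫⁻ z in unitDisk ∩ φ ⁻¹' ball w r ∩ whitneyBox n j, ‖deriv φ z‖₊ ∂ν := by
          refine (lintegral_mono_set (hcover _ inter_subset_left)).trans
            ((lintegral_union_le _ _ _).trans (add_le_add_right ?_ _))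
          refine (lintegral_iUnion_le _ _).trans (ENNReal.tsum_le_tsum fun n => ?_)
          exact setLIntegral_biUnion_finset_le _ _ _
      _ ≤ ENNReal.ofReal (1568 * r) * ENNReal.ofReal (2 * N * 2) +
          ∑' n, ∑ j ∈ Finset.range (2 ^ n),
            ENNReal.ofReal (E * Real.exp (2 * Real.pi)) * ENNReal.ofReal (a n j) := by
          refine add_le_add ((lintegral_center_le hφ hinj hwΩ r ν).trans
            (mul_le_mul_right hdisk _)) (ENNReal.tsum_le_tsum fun n => Finset.sum_le_sum
            fun j _ => lintegral_whitneyBox_le hφ hinj hE (hdist φ hφ hinj) hwΩ r ν (hfinw n j))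
      _ ≤ ENNReal.ofReal (1568 * r) * ENNReal.ofReal (2 * N * 2) +
          ENNReal.ofReal (E * Real.exp (2 * Real.pi)) *
            ENNReal.ofReal (C * ((26 * N + 1) * r)) := by
          simp_rw [← Finset.mul_sum]
          rw [ENNReal.tsum_mul_left]
          exact add_le_add_right (mul_le_mul_right hsum' _) _
      _ = _ := by
          rw [← ENNReal.ofReal_mul (by positivity), ← ENNReal.ofReal_mul (by positivity),
            ← ENNReal.ofReal_mul (by positivity), ← ENNReal.ofReal_add (by positivity)
            (by positivity)]
          congr 1
          ring
  exact hlt.trans_lt ENNReal.ofReal_lt_top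

end PushForward

/-- Let `φ` be a conformal map of the unit disk onto a simply connected
domain `Ω ⊊ ℂ` whose boundary is a locally rectifiable curve.  Then `∂Ω` is Ahlfors-regular
iff the push-forward operator `(φ⁻¹)*` is well-defined from `CM(Δ)` to `CM(Ω)`. -/
theorem stmt_0 (φ : ℂ → ℂ) (Ω : Set ℂ)
    (hΩopen : IsOpen Ω) (hΩne : Ω.Nonempty) (hΩproper : Ω ≠ Set.univ)
    (hΩconn : IsConnected Ω) (hΩsc : SimplyConnectedSpace Ω)
    (hdiff : DifferentiableOn ℂ φ unitDisk)
    (hinj : Set.InjOn φ unitDisk)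
    (honto : φ '' unitDisk = Ω)
    (hlocrect : ∀ z ∈ frontier Ω, ∃ r : ℝ, 0 < r ∧
      μH[1] (frontier Ω ∩ Metric.ball z r) < ⊤) :
    (∃ C : ℝ, 0 < C ∧ ∀ z : ℂ, ∀ r : ℝ, 0 < r →
        μH[1] (frontier Ω ∩ Metric.ball z r) ≤ ENNReal.ofReal (C * r)) ↔
      (∀ ν : Measure ℂ, IsCarleson unitDisk ν →
        IsCarleson Ω (pushForward unitDisk φ ν)) := by
  subst honto
  constructor
  · rintro ⟨C, hC, h⟩ ν hν
    exact isCarleson_pushForward hdiff hinj hΩopen hΩproper hΩsc hC h hν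
  · exact ahlforsRegular_of_pushForward hdiff hΩopen
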